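/- Suppose α > λ₁. Then there exists an irreducible degree-d GL solution. Moreover, every degree-d field pair (a,φ) with E(a,φ) = inf{E(a',φ') : (a',φ') a degree-d field pair} is irreducible. -/

import Mathlib

open MeasureTheory Complex

noncomputable section

/-- Partial derivative in the first coordinate direction. -/
def pd1 {E : Type*} [NormedAddCommGroup E] [NormedSpace ℝ E]
    (f : ℝ × ℝ → E) (x : ℝ × ℝ) : E := fderiv ℝ f x (1, 0)

/-- Partial derivative in the second coordinate direction. -/
def pd2 {E : Type*} [NormedAddCommGroup E] [NormedSpace ℝ E]
    (f : ℝ × ℝ → E) (x : ℝ × ℝ) : E := fderiv ℝ f x (0, 1)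

/-- Covariant derivative `D₁φ = ∂₁φ + i a₁ φ`. -/
def D1 (a1 : ℝ × ℝ → ℝ) (φ : ℝ × ℝ → ℂ) : ℝ × ℝ → ℂ :=
  fun x => pd1 φ x + Complex.I * (a1 x : ℂ) * φ x

/-- Covariant derivative `D₂φ = ∂₂φ + i a₂ φ`. -/
def D2 (a2 : ℝ × ℝ → ℝ) (φ : ℝ × ℝ → ℂ) : ℝ × ℝ → ℂ :=
  fun x => pd2 φ x + Complex.I * (a2 x : ℂ) * φ x

/-- Curvature `F(a) = ∂₁a₂ − ∂₂a₁`. -/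
def curv (a1 a2 : ℝ × ℝ → ℝ) : ℝ × ℝ → ℝ :=
  fun x => pd1 a2 x - pd2 a1 x

/-- The fundamental domain `[0,1]²`. -/
def unitSquare : Set (ℝ × ℝ) := Set.Icc (0, 0) (1, 1)

/-- A degree-`d` field pair on the torus: smooth quasi-periodic `(a, φ)`. -/
structure FieldPair (d : ℤ) where
  a1 : ℝ × ℝ → ℝ
  a2 : ℝ × ℝ → ℝ
  φ : ℝ × ℝ → ℂ
  smooth_a1 : ContDiff ℝ (⊤ : ℕ∞) a1
  smooth_a2 : ContDiff ℝ (⊤ : ℕ∞) a2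
  smooth_φ : ContDiff ℝ (⊤ : ℕ∞) φ
  per1_a1 : ∀ x : ℝ × ℝ, a1 (x.1 + 1, x.2) = a1 x
  per1_a2 : ∀ x : ℝ × ℝ, a2 (x.1 + 1, x.2) = a2 x
  per1_φ : ∀ x : ℝ × ℝ, φ (x.1 + 1, x.2) = φ x
  per2_a2 : ∀ x : ℝ × ℝ, a2 (x.1, x.2 + 1) = a2 x
  per2_a1 : ∀ x : ℝ × ℝ, a1 (x.1, x.2 + 1) = a1 x - 2 * Real.pi * d
  per2_φ : ∀ x : ℝ × ℝ, φ (x.1, x.2 + 1) =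
      Complex.exp (2 * Real.pi * Complex.I * (d : ℂ) * (x.1 : ℂ)) * φ x

/-- The smooth ℤ²-periodic external field with `∫_{[0,1]²} F₀ = 2πd`. -/
def ExternalField (d : ℤ) (F₀ : ℝ × ℝ → ℝ) : Prop :=
  ContDiff ℝ (⊤ : ℕ∞) F₀ ∧ (∀ x : ℝ × ℝ, F₀ (x.1 + 1, x.2) = F₀ x) ∧
    (∀ x : ℝ × ℝ, F₀ (x.1, x.2 + 1) = F₀ x) ∧
    (∫ x in unitSquare, F₀ x) = 2 * Real.pi * d

/-- The Ginzburg–Landau free energy. -/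
def energy (α β : ℝ) (F₀ : ℝ × ℝ → ℝ) {d : ℤ} (P : FieldPair d) : ℝ :=
  (1 / 2) * ∫ x in unitSquare,
    ((curv P.a1 P.a2 x - F₀ x) ^ 2 + ‖D1 P.a1 P.φ x‖ ^ 2 + ‖D2 P.a2 P.φ x‖ ^ 2
      - α * ‖P.φ x‖ ^ 2 + (β / 2) * ‖P.φ x‖ ^ 4)

/-- The Ginzburg–Landau equations. -/
def IsGLSolution (α β : ℝ) (F₀ : ℝ × ℝ → ℝ) {d : ℤ} (P : FieldPair d) : Prop :=
  (∀ x : ℝ × ℝ,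
      pd2 (fun y => curv P.a1 P.a2 y - F₀ y) x
        + ((starRingEnd ℂ) (P.φ x) * D1 P.a1 P.φ x).im = 0) ∧
  (∀ x : ℝ × ℝ,
      -pd1 (fun y => curv P.a1 P.a2 y - F₀ y) x
        + ((starRingEnd ℂ) (P.φ x) * D2 P.a2 P.φ x).im = 0) ∧
  (∀ x : ℝ × ℝ,
      -(D1 P.a1 (D1 P.a1 P.φ) x + D2 P.a2 (D2 P.a2 P.φ) x)
        = (α : ℂ) * P.φ x - (β : ℂ) * (‖P.φ x‖ : ℂ) ^ 2 * P.φ x)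

/-- The set of energies of all degree-`d` field pairs. -/
def energySet (α β : ℝ) (F₀ : ℝ × ℝ → ℝ) (d : ℤ) : Set ℝ :=
  { t : ℝ | ∃ P : FieldPair d, t = energy α β F₀ P }

/-- `λ₁`, the lowest eigenvalue of the covariant Laplacian among connections
with curvature `F₀`. -/
def lambda1 (d : ℤ) (F₀ : ℝ × ℝ → ℝ) : ℝ :=
  sInf { t : ℝ | ∃ P : FieldPair d,
    (∀ x : ℝ × ℝ, curv P.a1 P.a2 x = F₀ x) ∧
    (∫ x in unitSquare, ‖P.φ x‖ ^ 2) = 1 ∧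
    t = ∫ x in unitSquare, (‖D1 P.a1 P.φ x‖ ^ 2 + ‖D2 P.a2 P.φ x‖ ^ 2) }

namespace GinzburgLandau

/-- The character `x ↦ exp (2πi k·x)` of the torus. -/
def e (k : ℤ × ℤ) (x : ℝ × ℝ) : ℂ :=
  cexp (2 * Real.pi * I * (k.1 * x.1 + k.2 * x.2))

lemma e_add (k l : ℤ × ℤ) (x : ℝ × ℝ) : e (k + l) x = e k x * e l x := by
  simp only [e, ← Complex.exp_add]
  congr 1
  simp only [Prod.fst_add, Prod.snd_add]
  push_cast
  ring

@[simp] lemma e_zero (x : ℝ × ℝ) : e 0 x = 1 := by simp [e]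

lemma norm_e (k : ℤ × ℤ) (x : ℝ × ℝ) : ‖e k x‖ = 1 := by
  have : e k x = cexp ((2 * Real.pi * (k.1 * x.1 + k.2 * x.2) : ℝ) * I) := by
    simp only [e]; congr 1; push_cast; ring
  rw [this, Complex.norm_exp_ofReal_mul_I]

lemma conj_e (k : ℤ × ℤ) (x : ℝ × ℝ) : (starRingEnd ℂ) (e k x) = e (-k) x := by
  simp only [e, ← Complex.exp_conj]
  congr 1
  have h2 : (starRingEnd ℂ) (2 : ℂ) = 2 := Complex.conj_ofReal 2
  simp only [map_mul, map_add, h2, Complex.conj_ofReal, Complex.conj_I, map_intCast,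
    Prod.fst_neg, Prod.snd_neg, Int.cast_neg]
  ring

lemma contDiff_e (k : ℤ × ℤ) {n : WithTop ℕ∞} : ContDiff ℝ n (e k) := by
  unfold e
  have h1 : ContDiff ℝ n (fun x : ℝ × ℝ => (x.1 : ℂ)) :=
    Complex.ofRealCLM.contDiff.comp contDiff_fst
  have h2 : ContDiff ℝ n (fun x : ℝ × ℝ => (x.2 : ℂ)) :=
    Complex.ofRealCLM.contDiff.comp contDiff_snd
  exact (contDiff_const.mul ((contDiff_const.mul h1).add (contDiff_const.mul h2))).cexp

lemma continuous_e (k : ℤ × ℤ) : Continuous (e k) := (contDiff_e k (n := 0)).continuous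

lemma hasFDerivAt_e (k : ℤ × ℤ) (x : ℝ × ℝ) :
    HasFDerivAt (e k) ((2 * Real.pi * I * e k x) •
      (((k.1 : ℂ) • (Complex.ofRealCLM ∘L ContinuousLinearMap.fst ℝ ℝ ℝ)) +
        (k.2 : ℂ) • (Complex.ofRealCLM ∘L ContinuousLinearMap.snd ℝ ℝ ℝ))) x := by
  have h1 : HasFDerivAt (fun x : ℝ × ℝ => (x.1 : ℂ))
      (Complex.ofRealCLM ∘L ContinuousLinearMap.fst ℝ ℝ ℝ) x :=
    (Complex.ofRealCLM ∘L ContinuousLinearMap.fst ℝ ℝ ℝ).hasFDerivAt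
  have h2 : HasFDerivAt (fun x : ℝ × ℝ => (x.2 : ℂ))
      (Complex.ofRealCLM ∘L ContinuousLinearMap.snd ℝ ℝ ℝ) x :=
    (Complex.ofRealCLM ∘L ContinuousLinearMap.snd ℝ ℝ ℝ).hasFDerivAt
  have h3 := (((h1.const_mul (k.1 : ℂ)).add (h2.const_mul (k.2 : ℂ))).const_mul
    (2 * Real.pi * I)).cexp
  refine h3.congr_fderiv ?_
  ext <;> simp [e] <;> ring

/-- The weight `1 + |k₁| + |k₂|` on frequencies. -/
def jp (k : ℤ × ℤ) : ℝ := 1 + |(k.1 : ℝ)| + |(k.2 : ℝ)|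

lemma one_le_jp (k : ℤ × ℤ) : 1 ≤ jp k := by
  unfold jp; linarith [abs_nonneg (k.1 : ℝ), abs_nonneg (k.2 : ℝ)]

lemma jp_pos (k : ℤ × ℤ) : 0 < jp k := lt_of_lt_of_le one_pos (one_le_jp k)

lemma jp_neg (k : ℤ × ℤ) : jp (-k) = jp k := by simp [jp]

@[simp] lemma jp_zero : jp 0 = 1 := by simp [jp]

lemma jp_add_le_mul (k l : ℤ × ℤ) : jp (k + l) ≤ jp k * jp l := by
  simp only [jp, Prod.fst_add, Prod.snd_add]
  push_cast
  nlinarith [abs_add_le (k.1 : ℝ) l.1, abs_add_le (k.2 : ℝ) l.2, abs_nonneg (k.1 : ℝ),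
    abs_nonneg (k.2 : ℝ), abs_nonneg (l.1 : ℝ), abs_nonneg (l.2 : ℝ),
    mul_nonneg (add_nonneg (abs_nonneg (k.1 : ℝ)) (abs_nonneg (k.2 : ℝ)))
      (add_nonneg (abs_nonneg (l.1 : ℝ)) (abs_nonneg (l.2 : ℝ)))]

lemma jp_add_le_add (k l : ℤ × ℤ) : jp (k + l) ≤ jp k + jp l := by
  simp only [jp, Prod.fst_add, Prod.snd_add]
  push_cast
  linarith [abs_add_le (k.1 : ℝ) l.1, abs_add_le (k.2 : ℝ) l.2]

lemma jp_sq_le {k : ℤ × ℤ} (hk : k ≠ 0) : jp k ^ 2 ≤ 8 * ((k.1 : ℝ) ^ 2 + (k.2 : ℝ) ^ 2) := by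
  have h1 : 1 ≤ |(k.1 : ℝ)| + |(k.2 : ℝ)| := by
    have : k.1 ≠ 0 ∨ k.2 ≠ 0 := by
      by_contra! hc
      exact hk (Prod.ext hc.1 hc.2)
    rcases this with h | h
    · have : (1 : ℝ) ≤ |(k.1 : ℝ)| := by exact_mod_cast Int.one_le_abs h
      linarith [abs_nonneg (k.2 : ℝ)]
    · have : (1 : ℝ) ≤ |(k.2 : ℝ)| := by exact_mod_cast Int.one_le_abs h
      linarith [abs_nonneg (k.1 : ℝ)]
  rw [← sq_abs (k.1 : ℝ), ← sq_abs (k.2 : ℝ)]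
  unfold jp
  nlinarith [sq_nonneg (|(k.1 : ℝ)| - |(k.2 : ℝ)|), abs_nonneg (k.1 : ℝ), abs_nonneg (k.2 : ℝ)]

lemma summable_one_add_abs_rpow {p : ℝ} (hp : 1 < p) :
    Summable (fun n : ℤ => (1 + |(n : ℝ)|) ^ (-p)) := by
  have h := (Real.summable_abs_int_rpow hp).add
    (summable_of_ne_finset_zero (s := {0}) (f := fun n : ℤ => if n = 0 then (1 : ℝ) else 0)
      (by simp +contextual))
  refine Summable.of_nonneg_of_le (fun n => by positivity) (fun n => ?_) h
  by_cases hn : n = 0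
  · subst hn
    simp only [Int.cast_zero, abs_zero, add_zero, Real.one_rpow, if_true]
    linarith [Real.rpow_nonneg (le_refl (0 : ℝ)) (-p)]
  · simp only [hn, if_false, add_zero]
    exact Real.rpow_le_rpow_of_nonpos (by positivity) (by linarith) (by linarith)

lemma summable_jp_rpow {p : ℝ} (hp : 2 < p) : Summable (fun k : ℤ × ℤ => jp k ^ (-p)) := by
  have h1 := summable_one_add_abs_rpow (p := p / 2) (by linarith)
  have h := h1.mul_of_nonneg h1 (fun n => by positivity) (fun n => by positivity)
  refine Summable.of_nonneg_of_le (fun k => Real.rpow_nonneg (jp_pos k).le _) (fun k => ?_) h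
  have h2 : (0 : ℝ) < 1 + |(k.1 : ℝ)| := by positivity
  have h3 : (0 : ℝ) < 1 + |(k.2 : ℝ)| := by positivity
  rw [← Real.mul_rpow h2.le h3.le]
  have h4 : jp k ^ (-p) = (jp k ^ 2) ^ (-(p / 2)) := by
    rw [← Real.rpow_natCast, ← Real.rpow_mul (jp_pos k).le]; congr 1; push_cast; ring
  rw [h4]
  refine Real.rpow_le_rpow_of_nonpos (by positivity) ?_ (by linarith)
  unfold jp
  nlinarith [abs_nonneg (k.1 : ℝ), abs_nonneg (k.2 : ℝ),
    mul_nonneg (abs_nonneg (k.1 : ℝ)) (abs_nonneg (k.2 : ℝ))]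

lemma summable_jp_inv_cube : Summable (fun k : ℤ × ℤ => (jp k ^ 3)⁻¹) := by
  refine (summable_jp_rpow (p := 3) (by norm_num)).congr (fun k => ?_)
  rw [Real.rpow_neg (jp_pos k).le]
  norm_cast

/-! Integration over the unit square. -/

lemma unitSquare_eq : unitSquare = Set.Icc (0 : ℝ) 1 ×ˢ Set.Icc (0 : ℝ) 1 :=
  (Set.Icc_prod_eq _ _)

lemma isCompact_unitSquare : IsCompact unitSquare := by
  rw [unitSquare_eq]; exact isCompact_Icc.prod isCompact_Icc

lemma volume_unitSquare : (volume : Measure (ℝ × ℝ)) unitSquare = 1 := by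
  rw [unitSquare_eq, Measure.volume_eq_prod, Measure.prod_prod]; simp

instance : IsProbabilityMeasure ((volume : Measure (ℝ × ℝ)).restrict unitSquare) :=
  ⟨by rw [Measure.restrict_apply_univ, volume_unitSquare]⟩

lemma integrable_sq {E : Type*} [NormedAddCommGroup E] {f : ℝ × ℝ → E} (hf : Continuous f) :
    Integrable f (volume.restrict unitSquare) :=
  hf.continuousOn.integrableOn_compact isCompact_unitSquare

lemma integral_sq {E : Type*} [NormedAddCommGroup E] [NormedSpace ℝ E] {f : ℝ × ℝ → E}
    (hf : Continuous f) :
    ∫ x in unitSquare, f x = ∫ s in (0 : ℝ)..1, ∫ t in (0 : ℝ)..1, f (s, t) := by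
  have h := integrable_sq hf
  rw [unitSquare_eq, Measure.volume_eq_prod] at *
  rw [setIntegral_prod f h, intervalIntegral.integral_of_le zero_le_one, integral_Icc_eq_integral_Ioc]
  refine integral_congr_ae (Filter.Eventually.of_forall fun s => ?_)
  simp only
  rw [intervalIntegral.integral_of_le zero_le_one, integral_Icc_eq_integral_Ioc]

lemma integral_sq_swap {E : Type*} [NormedAddCommGroup E] [NormedSpace ℝ E] {f : ℝ × ℝ → E}
    (hf : Continuous f) :
    ∫ x in unitSquare, f x = ∫ t in (0 : ℝ)..1, ∫ s in (0 : ℝ)..1, f (s, t) := by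
  rw [integral_sq hf]
  have h := integrable_sq hf
  rw [unitSquare_eq, Measure.volume_eq_prod] at h
  simp only [intervalIntegral.integral_of_le zero_le_one]
  refine integral_integral_swap (f := fun s t => f (s, t)) ?_
  rw [Measure.prod_restrict]
  exact h.mono_measure (Measure.restrict_mono
      (Set.prod_mono Set.Ioc_subset_Icc_self Set.Ioc_subset_Icc_self) le_rfl)

lemma integral_sq_nonneg_eq_zero {f : ℝ × ℝ → ℝ} (hf : Continuous f) (h0 : ∀ x, 0 ≤ f x)
    (hi : ∫ x in unitSquare, f x ≤ 0) : ∀ x ∈ unitSquare, f x = 0 := by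
  have h1 : ∫ x in unitSquare, f x = 0 :=
    le_antisymm hi (integral_nonneg h0)
  rw [integral_eq_zero_iff_of_nonneg (fun x => h0 x) (integrable_sq hf)] at h1
  have h2 : Set.EqOn f 0 (closure (interior unitSquare)) := by
    have h3 : Set.EqOn f 0 (interior unitSquare) := by
      refine Measure.eqOn_open_of_ae_eq (μ := volume) ?_ isOpen_interior hf.continuousOn
        continuousOn_const
      exact ae_restrict_of_ae_restrict_of_subset interior_subset h1
    exact h3.closure hf continuous_const
  have h4 : closure (interior unitSquare) = unitSquare := by
    rw [unitSquare_eq, interior_prod_eq, closure_prod_eq, interior_Icc, closure_Ioo (by norm_num)]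
  rw [h4] at h2
  exact h2

/-- The Fourier series with coefficients `c`. -/
def S (c : ℤ × ℤ → ℂ) (x : ℝ × ℝ) : ℂ := ∑' k, c k * e k x

/-- The Fourier coefficients of `f`. -/
def coef (f : ℝ × ℝ → ℂ) (k : ℤ × ℤ) : ℂ := ∫ x in unitSquare, f x * e (-k) x

lemma integral_cexp_int (n : ℤ) :
    ∫ t in (0 : ℝ)..1, cexp (2 * Real.pi * I * n * t) = if n = 0 then 1 else 0 := by
  by_cases hn : n = 0
  · simp [hn]
  · have h0 : (2 * Real.pi * I * n : ℂ) ≠ 0 := by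
      simp [hn, Real.pi_ne_zero]
    rw [integral_exp_mul_complex h0]
    have : cexp (2 * Real.pi * I * n) = 1 := by
      rw [mul_comm, Complex.exp_int_mul_two_pi_mul_I]
    simp [hn, this]

lemma integral_e (k : ℤ × ℤ) : ∫ x in unitSquare, e k x = if k = 0 then 1 else 0 := by
  rw [integral_sq (continuous_e k)]
  have h : ∀ s t : ℝ, e k (s, t) = cexp (2 * Real.pi * I * k.1 * s) *
      cexp (2 * Real.pi * I * k.2 * t) := by
    intro s t
    rw [← Complex.exp_add, e]
    congr 1
    ring
  simp only [h, intervalIntegral.integral_const_mul, intervalIntegral.integral_mul_const,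
    integral_cexp_int]
  by_cases h1 : k.1 = 0 <;> by_cases h2 : k.2 = 0 <;> simp [h1, h2, Prod.ext_iff]

lemma norm_term (c : ℤ × ℤ → ℂ) (k : ℤ × ℤ) (x : ℝ × ℝ) : ‖c k * e k x‖ = ‖c k‖ := by
  rw [norm_mul, norm_e, mul_one]

lemma summable_term {c : ℤ × ℤ → ℂ} (hc : Summable fun k => ‖c k‖) (x : ℝ × ℝ) :
    Summable fun k => c k * e k x :=
  Summable.of_norm (hc.congr fun k => (norm_term c k x).symm)

lemma norm_S_le {c : ℤ × ℤ → ℂ} (hc : Summable fun k => ‖c k‖) (x : ℝ × ℝ) :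
    ‖S c x‖ ≤ ∑' k, ‖c k‖ :=
  tsum_of_norm_bounded hc.hasSum fun k => (norm_term c k x).le

lemma continuous_S {c : ℤ × ℤ → ℂ} (hc : Summable fun k => ‖c k‖) : Continuous (S c) :=
  continuous_tsum (fun k => continuous_const.mul (continuous_e k)) hc
    fun k x => (norm_term c k x).le

lemma coef_S {c : ℤ × ℤ → ℂ} (hc : Summable fun k => ‖c k‖) : coef (S c) = c := by
  funext k
  have hF : ∀ l, Integrable (fun x => c l * e l x * e (-k) x) (volume.restrict unitSquare) :=
    fun l => integrable_sq ((continuous_const.mul (continuous_e l)).mul (continuous_e _))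
  have hn : ∀ l, ∫ x in unitSquare, ‖c l * e l x * e (-k) x‖ = ‖c l‖ := by
    intro l
    simp [norm_e]
  have h1 := (hasSum_integral_of_summable_integral_norm hF (by simpa only [hn] using hc))
  have h2 : ∀ l, ∫ x in unitSquare, c l * e l x * e (-k) x = if l = k then c k else 0 := by
    intro l
    simp only [mul_assoc, ← e_add]
    rw [integral_const_mul, integral_e]
    by_cases h : l = k
    · simp [h]
    · have : l + -k ≠ 0 := by rwa [← sub_eq_add_neg, sub_ne_zero]
      simp [h, this]
  simp only [h2] at h1
  have h3 := h1.unique (hasSum_ite_eq k (c k))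
  rw [← h3]
  unfold coef S
  simp only [tsum_mul_right]

/-- `f` is the sum of its Fourier series, with `s`-weighted absolutely summable coefficients. -/
def InA (s : ℕ) (f : ℝ × ℝ → ℂ) : Prop :=
  (Summable fun k => jp k ^ s * ‖coef f k‖) ∧ f = S (coef f)

/-- The weighted Wiener norm. -/
def An (s : ℕ) (f : ℝ × ℝ → ℂ) : ℝ := ∑' k, jp k ^ s * ‖coef f k‖

/-- `f` has weighted Wiener norm at most `C`. -/
def Bd (s : ℕ) (f : ℝ × ℝ → ℂ) (C : ℝ) : Prop := InA s f ∧ An s f ≤ C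

lemma one_le_jp_pow (s : ℕ) (k : ℤ × ℤ) : 1 ≤ jp k ^ s := one_le_pow₀ (one_le_jp k)

lemma summable_norm_of_weight {s : ℕ} {c : ℤ × ℤ → ℂ} (h : Summable fun k => jp k ^ s * ‖c k‖) :
    Summable fun k => ‖c k‖ :=
  Summable.of_nonneg_of_le (fun _ => norm_nonneg _)
    (fun k => le_mul_of_one_le_left (norm_nonneg _) (one_le_jp_pow s k)) h

lemma summable_weight_mono {s t : ℕ} (hst : t ≤ s) {c : ℤ × ℤ → ℂ}
    (h : Summable fun k => jp k ^ s * ‖c k‖) : Summable fun k => jp k ^ t * ‖c k‖ :=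
  Summable.of_nonneg_of_le (fun k => mul_nonneg (pow_nonneg (jp_pos k).le _) (norm_nonneg _))
    (fun k => mul_le_mul_of_nonneg_right (pow_le_pow_right₀ (one_le_jp k) hst) (norm_nonneg _)) h

lemma Bd_S {s : ℕ} {c : ℤ × ℤ → ℂ} {C : ℝ} (h : Summable fun k => jp k ^ s * ‖c k‖)
    (hC : ∑' k, jp k ^ s * ‖c k‖ ≤ C) : Bd s (S c) C := by
  have h1 := coef_S (summable_norm_of_weight h)
  refine ⟨⟨?_, ?_⟩, ?_⟩
  · rwa [h1]
  · rw [h1]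
  · rwa [An, h1]

lemma InA.summable {s : ℕ} {f : ℝ × ℝ → ℂ} (h : InA s f) : Summable fun k => ‖coef f k‖ :=
  summable_norm_of_weight h.1

lemma InA.mono {s t : ℕ} {f : ℝ × ℝ → ℂ} (h : InA s f) (hst : t ≤ s) : InA t f :=
  ⟨summable_weight_mono hst h.1, h.2⟩

lemma Bd.mono {s : ℕ} {f : ℝ × ℝ → ℂ} {C D : ℝ} (h : Bd s f C) (hCD : C ≤ D) : Bd s f D :=
  ⟨h.1, h.2.trans hCD⟩

lemma Bd.anti {s t : ℕ} {f : ℝ × ℝ → ℂ} {C : ℝ} (h : Bd s f C) (hst : t ≤ s) : Bd t f C := by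
  refine ⟨h.1.mono hst, le_trans ?_ h.2⟩
  exact Summable.tsum_le_tsum (fun k => mul_le_mul_of_nonneg_right
    (pow_le_pow_right₀ (one_le_jp k) hst) (norm_nonneg _)) (h.1.mono hst).1 h.1.1

lemma An_nonneg (s : ℕ) (f : ℝ × ℝ → ℂ) : 0 ≤ An s f :=
  tsum_nonneg fun k => mul_nonneg (pow_nonneg (jp_pos k).le _) (norm_nonneg _)

lemma InA.bd {s : ℕ} {f : ℝ × ℝ → ℂ} (h : InA s f) : Bd s f (An s f) := ⟨h, le_rfl⟩

lemma Bd.nonneg {s : ℕ} {f : ℝ × ℝ → ℂ} {C : ℝ} (h : Bd s f C) : 0 ≤ C :=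
  (An_nonneg s f).trans h.2

lemma Bd.norm_le {s : ℕ} {f : ℝ × ℝ → ℂ} {C : ℝ} (h : Bd s f C) (x : ℝ × ℝ) : ‖f x‖ ≤ C := by
  have h0 := h.anti (Nat.zero_le s)
  have h1 := norm_S_le h0.1.summable x
  rw [← h0.1.2] at h1
  refine h1.trans (le_trans (le_of_eq ?_) h0.2)
  simp [An]

lemma Bd_of_eq {s : ℕ} {f : ℝ × ℝ → ℂ} {c : ℤ × ℤ → ℂ} {C : ℝ} (hf : ∀ x, f x = S c x)
    (h : Summable fun k => jp k ^ s * ‖c k‖) (hC : ∑' k, jp k ^ s * ‖c k‖ ≤ C) : Bd s f C := by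
  have : f = S c := funext hf
  rw [this]
  exact Bd_S h hC

lemma Bd.add {s : ℕ} {f g : ℝ × ℝ → ℂ} {C D : ℝ} (hf : Bd s f C) (hg : Bd s g D) :
    Bd s (fun x => f x + g x) (C + D) := by
  have hle : ∀ k, jp k ^ s * ‖coef f k + coef g k‖ ≤
      jp k ^ s * ‖coef f k‖ + jp k ^ s * ‖coef g k‖ := fun k => by
    rw [← mul_add]
    exact mul_le_mul_of_nonneg_left (norm_add_le _ _) (pow_nonneg (jp_pos k).le _)
  have hs := Summable.of_nonneg_of_le
    (fun k => mul_nonneg (pow_nonneg (jp_pos k).le _) (norm_nonneg _)) hle (hf.1.1.add hg.1.1)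
  refine Bd_of_eq (c := fun k => coef f k + coef g k) (fun x => ?_) hs ?_
  · conv_lhs => rw [hf.1.2, hg.1.2]
    simp only [S, add_mul]
    exact ((summable_term hf.1.summable x).tsum_add (summable_term hg.1.summable x)).symm
  · refine (hs.tsum_le_tsum hle (hf.1.1.add hg.1.1)).trans ?_
    rw [hf.1.1.tsum_add hg.1.1]
    exact add_le_add hf.2 hg.2

lemma Bd.const_mul {s : ℕ} {f : ℝ × ℝ → ℂ} {C : ℝ} (hf : Bd s f C) (z : ℂ) :
    Bd s (fun x => z * f x) (‖z‖ * C) := by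
  have he : ∀ k, jp k ^ s * ‖z * coef f k‖ = ‖z‖ * (jp k ^ s * ‖coef f k‖) := fun k => by
    rw [norm_mul]; ring
  refine Bd_of_eq (c := fun k => z * coef f k) (fun x => ?_) ?_ ?_
  · conv_lhs => rw [hf.1.2]
    simp only [S, mul_assoc, tsum_mul_left]
  · simp only [he]
    exact hf.1.1.mul_left _
  · simp only [he, tsum_mul_left]
    exact mul_le_mul_of_nonneg_left hf.2 (norm_nonneg _)

lemma Bd.neg {s : ℕ} {f : ℝ × ℝ → ℂ} {C : ℝ} (hf : Bd s f C) : Bd s (fun x => -f x) C := by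
  simpa using hf.const_mul (-1)

lemma Bd_zero (s : ℕ) : Bd s (fun _ => 0) 0 :=
  Bd_of_eq (c := fun _ => 0) (fun x => by simp [S]) (by simp) (by simp)

lemma Bd.sum {s : ℕ} {ι : Type*} (t : Finset ι) {f : ι → ℝ × ℝ → ℂ} {C : ι → ℝ}
    (hf : ∀ i ∈ t, Bd s (f i) (C i)) : Bd s (fun x => ∑ i ∈ t, f i x) (∑ i ∈ t, C i) := by
  classical
  induction t using Finset.induction_on with
  | empty => simpa using Bd_zero s
  | insert a t ha ih =>
    simp only [Finset.sum_insert ha]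
    exact (hf a (Finset.mem_insert_self a t)).add
      (ih fun i hi => hf i (Finset.mem_insert_of_mem hi))

lemma Bd.conj {s : ℕ} {f : ℝ × ℝ → ℂ} {C : ℝ} (hf : Bd s f C) :
    Bd s (fun x => (starRingEnd ℂ) (f x)) C := by
  have he : (fun k => jp k ^ s * ‖(starRingEnd ℂ) (coef f (-k))‖) =
      (fun k => jp k ^ s * ‖coef f k‖) ∘ Equiv.neg (ℤ × ℤ) := by
    funext k
    simp [jp_neg]
  refine Bd_of_eq (c := fun k => (starRingEnd ℂ) (coef f (-k))) (fun x => ?_) ?_ ?_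
  · conv_lhs => rw [hf.1.2]
    unfold S
    rw [Complex.conj_tsum, ← (Equiv.neg (ℤ × ℤ)).tsum_eq]
    simp [conj_e]
  · rw [he]
    exact (Equiv.summable_iff _).2 hf.1.1
  · rw [he]
    exact ((Equiv.neg (ℤ × ℤ)).tsum_eq (fun k => jp k ^ s * ‖coef f k‖)).le.trans hf.2

/-- Convolution of coefficient families. -/
def conv (c d : ℤ × ℤ → ℂ) (k : ℤ × ℤ) : ℂ := ∑' l, c l * d (k - l)

/-- Change of variables `(k, l) ↦ (l, k - l)`. -/
def convEquiv : (ℤ × ℤ) × (ℤ × ℤ) ≃ (ℤ × ℤ) × (ℤ × ℤ) where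
  toFun p := (p.2, p.1 - p.2)
  invFun q := (q.1 + q.2, q.1)
  left_inv _ := Prod.ext (add_sub_cancel _ _) rfl
  right_inv _ := Prod.ext rfl (add_sub_cancel_left _ _)

lemma S_mul_S {c d : ℤ × ℤ → ℂ} (hc : Summable fun k => ‖c k‖) (hd : Summable fun k => ‖d k‖)
    (x : ℝ × ℝ) : S c x * S d x = S (conv c d) x := by
  have h1 : Summable fun p : (ℤ × ℤ) × (ℤ × ℤ) => (c p.1 * e p.1 x) * (d p.2 * e p.2 x) :=
    summable_mul_of_summable_norm (f := fun k => c k * e k x) (g := fun k => d k * e k x)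
      (by simpa only [norm_term] using hc) (by simpa only [norm_term] using hd)
  unfold S
  rw [(summable_term hc x).tsum_mul_tsum (summable_term hd x) h1, ← convEquiv.tsum_eq]
  have h2 := (Equiv.summable_iff convEquiv).2 h1
  have h3 : Summable (fun p : (ℤ × ℤ) × (ℤ × ℤ) =>
      c (convEquiv p).1 * e (convEquiv p).1 x * (d (convEquiv p).2 * e (convEquiv p).2 x)) := h2
  rw [h3.tsum_prod]
  refine tsum_congr fun k => ?_
  rw [conv, ← tsum_mul_right]
  refine tsum_congr fun l => ?_
  have : e k x = e l x * e (k - l) x := by rw [← e_add]; congr 1; abel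
  rw [this]
  simp only [convEquiv, Equiv.coe_fn_mk]
  ring

lemma conv_weight {c d : ℤ × ℤ → ℂ} {W : ℤ × ℤ → ℝ} (hW : ∀ k, 0 ≤ W k)
    {a : (ℤ × ℤ) × (ℤ × ℤ) → ℝ} (ha : Summable a)
    (hcd : Summable fun p : (ℤ × ℤ) × (ℤ × ℤ) => ‖c p.1‖ * ‖d p.2‖)
    (hle : ∀ l m, W (l + m) * (‖c l‖ * ‖d m‖) ≤ a (l, m)) :
    (Summable fun k => W k * ‖conv c d k‖) ∧ ∑' k, W k * ‖conv c d k‖ ≤ ∑' p, a p := by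
  have h2 : Summable (a ∘ convEquiv) := (Equiv.summable_iff convEquiv).2 ha
  have h3 : Summable ((fun p : (ℤ × ℤ) × (ℤ × ℤ) => ‖c p.1‖ * ‖d p.2‖) ∘ convEquiv) :=
    (Equiv.summable_iff convEquiv).2 hcd
  have hk : ∀ k, W k * ‖conv c d k‖ ≤ ∑' l, (a ∘ convEquiv) (k, l) := by
    intro k
    have h4 : Summable fun l => ‖c l * d (k - l)‖ :=
      (h3.prod_factor k).congr fun l => by simp [convEquiv]
    calc W k * ‖conv c d k‖ ≤ W k * ∑' l, ‖c l * d (k - l)‖ :=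
          mul_le_mul_of_nonneg_left (norm_tsum_le_tsum_norm h4) (hW k)
      _ = ∑' l, W k * ‖c l * d (k - l)‖ := tsum_mul_left.symm
      _ ≤ _ := by
          refine (h4.mul_left _).tsum_le_tsum (fun l => ?_) (h2.prod_factor k)
          have := hle l (k - l)
          rw [add_sub_cancel] at this
          rw [norm_mul]
          exact this
  have hs : Summable fun k => W k * ‖conv c d k‖ :=
    Summable.of_nonneg_of_le (fun k => mul_nonneg (hW k) (norm_nonneg _)) hk h2.prod
  refine ⟨hs, (hs.tsum_le_tsum hk h2.prod).trans (le_of_eq ?_)⟩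
  rw [← h2.tsum_prod]
  exact convEquiv.tsum_eq a

lemma weight_nonneg (s : ℕ) (c : ℤ × ℤ → ℂ) (k : ℤ × ℤ) : 0 ≤ jp k ^ s * ‖c k‖ :=
  mul_nonneg (pow_nonneg (jp_pos k).le _) (norm_nonneg _)

lemma Bd.mul {s : ℕ} {f g : ℝ × ℝ → ℂ} {C D : ℝ} (hf : Bd s f C) (hg : Bd s g D) :
    Bd s (fun x => f x * g x) (C * D) := by
  have h1 := hf.1.1.mul_of_nonneg hg.1.1 (weight_nonneg _ _) (weight_nonneg _ _)
  have h0 := hf.1.summable.mul_of_nonneg hg.1.summable (fun _ => norm_nonneg _)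
    (fun _ => norm_nonneg _)
  have h := conv_weight (W := fun k => jp k ^ s) (fun k => pow_nonneg (jp_pos k).le _) h1 h0
    (fun l m => by
      have : jp (l + m) ^ s ≤ jp l ^ s * jp m ^ s := by
        rw [← mul_pow]
        exact pow_le_pow_left₀ (jp_pos _).le (jp_add_le_mul l m) s
      calc jp (l + m) ^ s * (‖coef f l‖ * ‖coef g m‖)
          ≤ (jp l ^ s * jp m ^ s) * (‖coef f l‖ * ‖coef g m‖) :=
            mul_le_mul_of_nonneg_right this (by positivity)
        _ = _ := by ring)
  refine Bd_of_eq (fun x => ?_) h.1 (h.2.trans ?_)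
  · rw [← S_mul_S hf.1.summable hg.1.summable, ← hf.1.2, ← hg.1.2]
  · rw [← hf.1.1.tsum_mul_tsum hg.1.1 h1]
    exact mul_le_mul hf.2 hg.2 (An_nonneg _ _) hf.nonneg

lemma Bd.mul_tame {s : ℕ} {f g : ℝ × ℝ → ℂ} {C D C' D' : ℝ} (hf : Bd s f C) (hg : Bd s g D)
    (hf' : Bd (s + 1) f C') (hg' : Bd (s + 1) g D') :
    Bd (s + 1) (fun x => f x * g x) (C' * D + C * D') := by
  have h1 := hf'.1.1.mul_of_nonneg hg.1.1 (weight_nonneg _ _) (weight_nonneg _ _)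
  have h2 := hf.1.1.mul_of_nonneg hg'.1.1 (weight_nonneg _ _) (weight_nonneg _ _)
  have h0 := hf.1.summable.mul_of_nonneg hg.1.summable (fun _ => norm_nonneg _)
    (fun _ => norm_nonneg _)
  have h := conv_weight (W := fun k => jp k ^ (s + 1)) (fun k => pow_nonneg (jp_pos k).le _)
    (h1.add h2) h0 (fun l m => by
      have h3 : jp (l + m) ^ s ≤ jp l ^ s * jp m ^ s := by
        rw [← mul_pow]
        exact pow_le_pow_left₀ (jp_pos _).le (jp_add_le_mul l m) s
      have : jp (l + m) ^ (s + 1) ≤ jp l ^ s * jp m ^ s * (jp l + jp m) := by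
        rw [pow_succ]
        exact mul_le_mul h3 (jp_add_le_add l m) (jp_pos _).le
          (mul_nonneg (pow_nonneg (jp_pos _).le _) (pow_nonneg (jp_pos _).le _))
      calc jp (l + m) ^ (s + 1) * (‖coef f l‖ * ‖coef g m‖)
          ≤ (jp l ^ s * jp m ^ s * (jp l + jp m)) * (‖coef f l‖ * ‖coef g m‖) :=
            mul_le_mul_of_nonneg_right this (by positivity)
        _ = _ := by ring)
  refine Bd_of_eq (fun x => ?_) h.1 (h.2.trans ?_)
  · rw [← S_mul_S hf.1.summable hg.1.summable, ← hf.1.2, ← hg.1.2]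
  · rw [h1.tsum_add h2, ← hf'.1.1.tsum_mul_tsum hg.1.1 h1, ← hf.1.1.tsum_mul_tsum hg'.1.1 h2]
    exact add_le_add (mul_le_mul hf'.2 hg.2 (An_nonneg _ _) hf'.nonneg)
      (mul_le_mul hf.2 hg'.2 (An_nonneg _ _) hf.nonneg)

/-- Smooth `ℤ²`-periodic maps. -/
structure SP {E : Type*} [NormedAddCommGroup E] [NormedSpace ℝ E] (f : ℝ × ℝ → E) : Prop where
  smooth : ContDiff ℝ (⊤ : ℕ∞) f
  per1 : ∀ x : ℝ × ℝ, f (x.1 + 1, x.2) = f x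
  per2 : ∀ x : ℝ × ℝ, f (x.1, x.2 + 1) = f x

section general

variable {E : Type*} [NormedAddCommGroup E] [NormedSpace ℝ E]

lemma contDiff_pd1 {f : ℝ × ℝ → E} (hf : ContDiff ℝ (⊤ : ℕ∞) f) :
    ContDiff ℝ (⊤ : ℕ∞) (pd1 f) :=
  (hf.fderiv_right (m := (⊤ : ℕ∞)) le_rfl).clm_apply contDiff_const

lemma contDiff_pd2 {f : ℝ × ℝ → E} (hf : ContDiff ℝ (⊤ : ℕ∞) f) :
    ContDiff ℝ (⊤ : ℕ∞) (pd2 f) :=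
  (hf.fderiv_right (m := (⊤ : ℕ∞)) le_rfl).clm_apply contDiff_const

lemma smooth_differentiable {f : ℝ × ℝ → E} (hf : ContDiff ℝ (⊤ : ℕ∞) f) (x : ℝ × ℝ) :
    DifferentiableAt ℝ f x :=
  hf.differentiable (by simp) x

lemma fderiv_shift {f : ℝ × ℝ → E} (v x : ℝ × ℝ) (h : ∀ y, f (y + v) = f y) :
    fderiv ℝ f (x + v) = fderiv ℝ f x := by
  rw [← fderiv_comp_add_right v]
  congr 1
  exact funext h

lemma SP.shift1 {f : ℝ × ℝ → E} (hf : SP f) (x : ℝ × ℝ) : f (x + (1, 0)) = f x := by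
  have := hf.per1 x
  rwa [show ((x.1 + 1, x.2) : ℝ × ℝ) = x + (1, 0) by ext <;> simp] at this

lemma SP.shift2 {f : ℝ × ℝ → E} (hf : SP f) (x : ℝ × ℝ) : f (x + (0, 1)) = f x := by
  have := hf.per2 x
  rwa [show ((x.1, x.2 + 1) : ℝ × ℝ) = x + (0, 1) by ext <;> simp] at this

lemma SP.pd1 {f : ℝ × ℝ → E} (hf : SP f) : SP (pd1 f) where
  smooth := contDiff_pd1 hf.smooth
  per1 x := by
    rw [show ((x.1 + 1, x.2) : ℝ × ℝ) = x + (1, 0) by ext <;> simp]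
    simp only [_root_.pd1, fderiv_shift _ _ hf.shift1]
  per2 x := by
    rw [show ((x.1, x.2 + 1) : ℝ × ℝ) = x + (0, 1) by ext <;> simp]
    simp only [_root_.pd1, fderiv_shift _ _ hf.shift2]

lemma SP.pd2 {f : ℝ × ℝ → E} (hf : SP f) : SP (pd2 f) where
  smooth := contDiff_pd2 hf.smooth
  per1 x := by
    rw [show ((x.1 + 1, x.2) : ℝ × ℝ) = x + (1, 0) by ext <;> simp]
    simp only [_root_.pd2, fderiv_shift _ _ hf.shift1]
  per2 x := by
    rw [show ((x.1, x.2 + 1) : ℝ × ℝ) = x + (0, 1) by ext <;> simp]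
    simp only [_root_.pd2, fderiv_shift _ _ hf.shift2]

lemma SP.continuous {f : ℝ × ℝ → E} (hf : SP f) : Continuous f := hf.smooth.continuous

lemma SP.comp {F : Type*} [NormedAddCommGroup F] [NormedSpace ℝ F] {f : ℝ × ℝ → E} (hf : SP f)
    {g : E → F} (hg : ContDiff ℝ (⊤ : ℕ∞) g) : SP (fun x => g (f x)) :=
  ⟨hg.comp hf.smooth, fun x => by rw [hf.per1], fun x => by rw [hf.per2]⟩

lemma SP_const (c : E) : SP (fun _ => c) := ⟨contDiff_const, fun _ => rfl, fun _ => rfl⟩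

lemma SP.add {f g : ℝ × ℝ → E} (hf : SP f) (hg : SP g) : SP (fun x => f x + g x) :=
  ⟨hf.smooth.add hg.smooth, fun x => by rw [hf.per1, hg.per1], fun x => by rw [hf.per2, hg.per2]⟩

lemma SP.sub {f g : ℝ × ℝ → E} (hf : SP f) (hg : SP g) : SP (fun x => f x - g x) :=
  ⟨hf.smooth.sub hg.smooth, fun x => by rw [hf.per1, hg.per1], fun x => by rw [hf.per2, hg.per2]⟩

lemma SP.neg {f : ℝ × ℝ → E} (hf : SP f) : SP (fun x => -f x) :=
  ⟨hf.smooth.neg, fun x => by rw [hf.per1], fun x => by rw [hf.per2]⟩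

lemma SP.mul {A : Type*} [NormedRing A] [NormedAlgebra ℝ A] {f g : ℝ × ℝ → A}
    (hf : SP f) (hg : SP g) : SP (fun x => f x * g x) :=
  ⟨hf.smooth.mul hg.smooth, fun x => by rw [hf.per1, hg.per1], fun x => by rw [hf.per2, hg.per2]⟩

lemma SP.re {f : ℝ × ℝ → ℂ} (hf : SP f) : SP (fun x => (f x).re) :=
  hf.comp Complex.reCLM.contDiff

lemma SP.im {f : ℝ × ℝ → ℂ} (hf : SP f) : SP (fun x => (f x).im) :=
  hf.comp Complex.imCLM.contDiff

lemma SP.ofReal {f : ℝ × ℝ → ℝ} (hf : SP f) : SP (fun x => (f x : ℂ)) :=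
  hf.comp Complex.ofRealCLM.contDiff

lemma SP_e (k : ℤ × ℤ) : SP (e k) where
  smooth := contDiff_e k
  per1 x := by
    simp only [e]
    rw [show (2 * Real.pi * I * (k.1 * ((x.1 + 1 : ℝ) : ℂ) + k.2 * x.2) : ℂ) =
      2 * Real.pi * I * (k.1 * x.1 + k.2 * x.2) + k.1 * (2 * Real.pi * I) by push_cast; ring,
      Complex.exp_add, Complex.exp_int_mul_two_pi_mul_I, mul_one]
  per2 x := by
    simp only [e]
    rw [show (2 * Real.pi * I * (k.1 * x.1 + k.2 * ((x.2 + 1 : ℝ) : ℂ)) : ℂ) =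
      2 * Real.pi * I * (k.1 * x.1 + k.2 * x.2) + k.2 * (2 * Real.pi * I) by push_cast; ring,
      Complex.exp_add, Complex.exp_int_mul_two_pi_mul_I, mul_one]

lemma hasDerivAt_fst {f : ℝ × ℝ → E} (hf : ContDiff ℝ (⊤ : ℕ∞) f) (s t : ℝ) :
    HasDerivAt (fun s => f (s, t)) (pd1 f (s, t)) s := by
  have h1 : HasDerivAt (fun s : ℝ => (s, t)) (1, 0) s := (hasDerivAt_id s).prodMk (hasDerivAt_const s t)
  exact (smooth_differentiable hf (s, t)).hasFDerivAt.comp_hasDerivAt s h1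

lemma hasDerivAt_snd {f : ℝ × ℝ → E} (hf : ContDiff ℝ (⊤ : ℕ∞) f) (s t : ℝ) :
    HasDerivAt (fun t => f (s, t)) (pd2 f (s, t)) t := by
  have h1 : HasDerivAt (fun t : ℝ => (s, t)) (0, 1) t := (hasDerivAt_const t s).prodMk (hasDerivAt_id t)
  exact (smooth_differentiable hf (s, t)).hasFDerivAt.comp_hasDerivAt t h1

lemma SP.integral_pd1 [CompleteSpace E] {f : ℝ × ℝ → E} (hf : SP f) :
    ∫ x in unitSquare, _root_.pd1 f x = 0 := by
  have hc := hf.pd1.continuous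
  rw [integral_sq_swap hc]
  have : ∀ t : ℝ, ∫ s in (0 : ℝ)..1, _root_.pd1 f (s, t) = 0 := by
    intro t
    rw [intervalIntegral.integral_eq_sub_of_hasDerivAt
      (fun s _ => hasDerivAt_fst hf.smooth s t)
      ((hc.comp (by fun_prop : Continuous fun s : ℝ => (s, t))).intervalIntegrable _ _)]
    have := hf.per1 (0, t)
    simp only [zero_add] at this
    rw [this, sub_self]
  simp [this]

lemma SP.integral_pd2 [CompleteSpace E] {f : ℝ × ℝ → E} (hf : SP f) :
    ∫ x in unitSquare, _root_.pd2 f x = 0 := by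
  have hc := hf.pd2.continuous
  rw [integral_sq hc]
  have : ∀ s : ℝ, ∫ t in (0 : ℝ)..1, _root_.pd2 f (s, t) = 0 := by
    intro s
    rw [intervalIntegral.integral_eq_sub_of_hasDerivAt
      (fun t _ => hasDerivAt_snd hf.smooth s t)
      ((hc.comp (by fun_prop : Continuous fun t : ℝ => (s, t))).intervalIntegrable _ _)]
    have := hf.per2 (s, 0)
    simp only [zero_add] at this
    rw [this, sub_self]
  simp [this]

end general

lemma pd1_e (k : ℤ × ℤ) (x : ℝ × ℝ) : pd1 (e k) x = 2 * Real.pi * I * k.1 * e k x := by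
  rw [pd1, (hasFDerivAt_e k x).fderiv]
  simp; ring

lemma pd2_e (k : ℤ × ℤ) (x : ℝ × ℝ) : pd2 (e k) x = 2 * Real.pi * I * k.2 * e k x := by
  rw [pd2, (hasFDerivAt_e k x).fderiv]
  simp; ring

lemma pd1_mul {f g : ℝ × ℝ → ℂ} {x : ℝ × ℝ} (hf : DifferentiableAt ℝ f x)
    (hg : DifferentiableAt ℝ g x) :
    pd1 (fun y => f y * g y) x = pd1 f x * g x + f x * pd1 g x := by
  simp only [pd1, fderiv_fun_mul hf hg]
  simp; ring

lemma pd2_mul {f g : ℝ × ℝ → ℂ} {x : ℝ × ℝ} (hf : DifferentiableAt ℝ f x)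
    (hg : DifferentiableAt ℝ g x) :
    pd2 (fun y => f y * g y) x = pd2 f x * g x + f x * pd2 g x := by
  simp only [pd2, fderiv_fun_mul hf hg]
  simp; ring

lemma integrable_coef {f : ℝ × ℝ → ℂ} (hf : Continuous f) (k : ℤ × ℤ) :
    Integrable (fun x => f x * e (-k) x) (volume.restrict unitSquare) :=
  integrable_sq (hf.mul (continuous_e _))

lemma coef_pd1 {f : ℝ × ℝ → ℂ} (hf : SP f) (k : ℤ × ℤ) :
    coef (pd1 f) k = 2 * Real.pi * I * k.1 * coef f k := by
  have h := (hf.mul (SP_e (-k))).integral_pd1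
  have h1 : ∀ x, pd1 (fun y => f y * e (-k) y) x =
      pd1 f x * e (-k) x - (2 * Real.pi * I * k.1) * (f x * e (-k) x) := by
    intro x
    rw [pd1_mul (smooth_differentiable hf.smooth x) (smooth_differentiable (contDiff_e _) x), pd1_e]
    simp; ring
  simp only [h1] at h
  rw [integral_sub (integrable_coef hf.pd1.continuous k)
    ((integrable_coef hf.continuous k).const_mul _), integral_const_mul, sub_eq_zero] at h
  exact h

lemma coef_pd2 {f : ℝ × ℝ → ℂ} (hf : SP f) (k : ℤ × ℤ) :
    coef (pd2 f) k = 2 * Real.pi * I * k.2 * coef f k := by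
  have h := (hf.mul (SP_e (-k))).integral_pd2
  have h1 : ∀ x, pd2 (fun y => f y * e (-k) y) x =
      pd2 f x * e (-k) x - (2 * Real.pi * I * k.2) * (f x * e (-k) x) := by
    intro x
    rw [pd2_mul (smooth_differentiable hf.smooth x) (smooth_differentiable (contDiff_e _) x), pd2_e]
    simp; ring
  simp only [h1] at h
  rw [integral_sub (integrable_coef hf.pd2.continuous k)
    ((integrable_coef hf.continuous k).const_mul _), integral_const_mul, sub_eq_zero] at h
  exact h

lemma norm_coef_le {f : ℝ × ℝ → ℂ} (k : ℤ × ℤ) :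
    ‖coef f k‖ ≤ ∫ x in unitSquare, ‖f x‖ := by
  refine (norm_integral_le_integral_norm _).trans (le_of_eq ?_)
  simp [norm_e]

lemma coef_decay {f : ℝ × ℝ → ℂ} (hf : SP f) (m : ℕ) : ∃ C, ∀ k, jp k ^ m * ‖coef f k‖ ≤ C := by
  induction m generalizing f with
  | zero => exact ⟨_, fun k => by simpa using norm_coef_le k⟩
  | succ m ih =>
    obtain ⟨C0, h0⟩ := ih hf
    obtain ⟨C1, h1⟩ := ih hf.pd1
    obtain ⟨C2, h2⟩ := ih hf.pd2
    refine ⟨C0 + C1 + C2, fun k => ?_⟩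
    have hpi : (1 : ℝ) ≤ 2 * Real.pi := by linarith [Real.pi_gt_three]
    have hn := norm_nonneg (coef f k)
    have e1 : |(k.1 : ℝ)| * ‖coef f k‖ ≤ ‖coef (pd1 f) k‖ := by
      rw [coef_pd1 hf]
      simp only [norm_mul, Complex.norm_I, Complex.norm_real, Complex.norm_intCast,
        Complex.norm_ofNat, mul_one, Real.norm_eq_abs, abs_of_pos Real.pi_pos]
      rw [mul_assoc]
      exact le_mul_of_one_le_left (mul_nonneg (abs_nonneg _) hn) hpi
    have e2 : |(k.2 : ℝ)| * ‖coef f k‖ ≤ ‖coef (pd2 f) k‖ := by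
      rw [coef_pd2 hf]
      simp only [norm_mul, Complex.norm_I, Complex.norm_real, Complex.norm_intCast,
        Complex.norm_ofNat, mul_one, Real.norm_eq_abs, abs_of_pos Real.pi_pos]
      rw [mul_assoc]
      exact le_mul_of_one_le_left (mul_nonneg (abs_nonneg _) hn) hpi
    have hj : 0 ≤ jp k ^ m := pow_nonneg (jp_pos k).le _
    calc jp k ^ (m + 1) * ‖coef f k‖
        = jp k ^ m * ‖coef f k‖ + jp k ^ m * (|(k.1 : ℝ)| * ‖coef f k‖)
          + jp k ^ m * (|(k.2 : ℝ)| * ‖coef f k‖) := by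
          rw [pow_succ]; simp only [jp]; ring
      _ ≤ _ := add_le_add (add_le_add (h0 k)
          ((mul_le_mul_of_nonneg_left e1 hj).trans (h1 k)))
          ((mul_le_mul_of_nonneg_left e2 hj).trans (h2 k))

lemma summable_of_decay {c : ℤ × ℤ → ℂ} {s : ℕ} {C : ℝ}
    (h : ∀ k, jp k ^ (s + 3) * ‖c k‖ ≤ C) : Summable fun k => jp k ^ s * ‖c k‖ := by
  refine Summable.of_nonneg_of_le (weight_nonneg s c) (fun k => ?_)
    (summable_jp_inv_cube.mul_left C)
  rw [← div_eq_mul_inv, le_div_iff₀ (pow_pos (jp_pos k) 3)]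
  calc jp k ^ s * ‖c k‖ * jp k ^ 3 = jp k ^ (s + 3) * ‖c k‖ := by ring
    _ ≤ C := h k

lemma eq_zero_of_fourier_1d {h : ℝ → ℂ} (hc : Continuous h) (hp : ∀ t, h (t + 1) = h t)
    (h0 : ∀ n : ℤ, ∫ t in (0 : ℝ)..1, h t * cexp (-(2 * Real.pi * I * n * t)) = 0) (t : ℝ) :
    h t = 0 := by
  have hper : Function.Periodic h 1 := hp
  let g : C(AddCircle (1 : ℝ), ℂ) := ⟨hper.lift, continuous_coinduced_dom.mpr hc⟩
  have hg : ∀ n, fourierCoeff g n = 0 := by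
    intro n
    rw [fourierCoeff_eq_intervalIntegral g n 0]
    have h2 : ∀ x : ℝ, (fourier (-n) (x : AddCircle (1 : ℝ))) • g (x : AddCircle (1 : ℝ)) =
        h x * cexp (-(2 * Real.pi * I * n * x)) := by
      intro x
      rw [fourier_coe_apply]
      change _ • h x = _
      rw [smul_eq_mul, mul_comm]
      congr 2
      push_cast
      ring
    simp only [h2, zero_add, h0, smul_zero]
  have hs : Summable (fourierCoeff g) := by
    rw [show fourierCoeff g = fun _ => 0 from funext hg]; exact summable_zero
  have := has_pointwise_sum_fourier_series_of_summable hs (t : AddCircle (1 : ℝ))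
  simp only [hg, zero_smul] at this
  exact (this.unique hasSum_zero)

lemma eq_zero_of_coef {g : ℝ × ℝ → ℂ} (hc : Continuous g)
    (h1 : ∀ x : ℝ × ℝ, g (x.1 + 1, x.2) = g x) (h2 : ∀ x : ℝ × ℝ, g (x.1, x.2 + 1) = g x)
    (h0 : ∀ k, coef g k = 0) (x : ℝ × ℝ) : g x = 0 := by
  have key : ∀ (n : ℤ) (t : ℝ), ∫ s in (0 : ℝ)..1, g (s, t) * cexp (-(2 * Real.pi * I * n * s)) = 0 := by
    intro n t
    refine eq_zero_of_fourier_1d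
      (h := fun t => ∫ s in (0 : ℝ)..1, g (s, t) * cexp (-(2 * Real.pi * I * n * s))) ?_ ?_ ?_ t
    · apply intervalIntegral.continuous_parametric_intervalIntegral_of_continuous'
      have : Continuous fun p : ℝ × ℝ => g (p.2, p.1) := hc.comp (by fun_prop)
      exact this.mul (by fun_prop)
    · intro t
      congr 1
      funext s
      rw [h2 (s, t)]
    · intro m
      have h3 := h0 (n, m)
      rw [coef, integral_sq_swap (f := fun x => g x * e (-(n, m)) x) (hc.mul (continuous_e _))] at h3
      rw [← h3]
      congr 1
      funext t
      rw [← intervalIntegral.integral_mul_const]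
      congr 1
      funext s
      rw [mul_assoc, ← Complex.exp_add, e]
      congr 2
      simp
      ring
  exact eq_zero_of_fourier_1d (h := fun s => g (s, x.2)) (hc.comp (by fun_prop))
    (fun s => h1 (s, x.2)) (fun n => key n x.2) x.1

lemma S_per1 (c : ℤ × ℤ → ℂ) (x : ℝ × ℝ) : S c (x.1 + 1, x.2) = S c x := by
  simp only [S, (SP_e _).per1]

lemma S_per2 (c : ℤ × ℤ → ℂ) (x : ℝ × ℝ) : S c (x.1, x.2 + 1) = S c x := by
  simp only [S, (SP_e _).per2]

lemma coef_sub {f g : ℝ × ℝ → ℂ} (hf : Continuous f) (hg : Continuous g) (k : ℤ × ℤ) :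
    coef (fun x => f x - g x) k = coef f k - coef g k := by
  simp only [coef, sub_mul]
  exact integral_sub (integrable_coef hf k) (integrable_coef hg k)

lemma coef_add {f g : ℝ × ℝ → ℂ} (hf : Continuous f) (hg : Continuous g) (k : ℤ × ℤ) :
    coef (fun x => f x + g x) k = coef f k + coef g k := by
  simp only [coef, add_mul]
  exact integral_add (integrable_coef hf k) (integrable_coef hg k)

lemma coef_const_mul (z : ℂ) (f : ℝ × ℝ → ℂ) (k : ℤ × ℤ) :
    coef (fun x => z * f x) k = z * coef f k := by
  simp only [coef, mul_assoc]
  exact integral_const_mul _ _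

lemma SP.inA {f : ℝ × ℝ → ℂ} (hf : SP f) (s : ℕ) : InA s f := by
  have hs : ∀ s : ℕ, Summable fun k => jp k ^ s * ‖coef f k‖ := fun s => by
    obtain ⟨C, hC⟩ := coef_decay hf (s + 3)
    exact summable_of_decay hC
  have h0 : Summable fun k => ‖coef f k‖ := summable_norm_of_weight (hs 0)
  refine ⟨hs s, funext fun x => ?_⟩
  have := eq_zero_of_coef (hf.continuous.sub (continuous_S h0))
    (fun x => by simp only [Pi.sub_apply, hf.per1, S_per1])
    (fun x => by simp only [Pi.sub_apply, hf.per2, S_per2])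
    (fun k => by
      have h := coef_sub hf.continuous (continuous_S h0) k
      rw [coef_S h0, sub_self] at h
      exact h) x
  exact sub_eq_zero.1 this

/-- Coefficients of the partial derivatives of `S c`. -/
def dc1 (c : ℤ × ℤ → ℂ) (k : ℤ × ℤ) : ℂ := 2 * Real.pi * I * k.1 * c k

/-- Coefficients of the partial derivatives of `S c`. -/
def dc2 (c : ℤ × ℤ → ℂ) (k : ℤ × ℤ) : ℂ := 2 * Real.pi * I * k.2 * c k

lemma abs_fst_le_jp (k : ℤ × ℤ) : |(k.1 : ℝ)| ≤ jp k := by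
  unfold jp; linarith [abs_nonneg (k.2 : ℝ)]

lemma abs_snd_le_jp (k : ℤ × ℤ) : |(k.2 : ℝ)| ≤ jp k := by
  unfold jp; linarith [abs_nonneg (k.1 : ℝ)]

lemma norm_dc1 (c : ℤ × ℤ → ℂ) (k : ℤ × ℤ) : ‖dc1 c k‖ = 2 * Real.pi * |(k.1 : ℝ)| * ‖c k‖ := by
  simp only [dc1, norm_mul, Complex.norm_I, Complex.norm_real, Complex.norm_intCast,
        Complex.norm_ofNat, mul_one, Real.norm_eq_abs, abs_of_pos Real.pi_pos]

lemma norm_dc2 (c : ℤ × ℤ → ℂ) (k : ℤ × ℤ) : ‖dc2 c k‖ = 2 * Real.pi * |(k.2 : ℝ)| * ‖c k‖ := by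
  simp only [dc2, norm_mul, Complex.norm_I, Complex.norm_real, Complex.norm_intCast,
        Complex.norm_ofNat, mul_one, Real.norm_eq_abs, abs_of_pos Real.pi_pos]

lemma norm_dc1_le (c : ℤ × ℤ → ℂ) (k : ℤ × ℤ) : ‖dc1 c k‖ ≤ 2 * Real.pi * (jp k * ‖c k‖) := by
  rw [norm_dc1, mul_assoc]
  have := Real.pi_pos
  gcongr
  exact abs_fst_le_jp k

lemma norm_dc2_le (c : ℤ × ℤ → ℂ) (k : ℤ × ℤ) : ‖dc2 c k‖ ≤ 2 * Real.pi * (jp k * ‖c k‖) := by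
  rw [norm_dc2, mul_assoc]
  have := Real.pi_pos
  gcongr
  exact abs_snd_le_jp k

lemma weight_dc1_le (s : ℕ) (c : ℤ × ℤ → ℂ) (k : ℤ × ℤ) :
    jp k ^ s * ‖dc1 c k‖ ≤ 2 * Real.pi * (jp k ^ (s + 1) * ‖c k‖) := by
  calc jp k ^ s * ‖dc1 c k‖ ≤ jp k ^ s * (2 * Real.pi * (jp k * ‖c k‖)) :=
        mul_le_mul_of_nonneg_left (norm_dc1_le c k) (pow_nonneg (jp_pos k).le _)
    _ = _ := by ring

lemma weight_dc2_le (s : ℕ) (c : ℤ × ℤ → ℂ) (k : ℤ × ℤ) :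
    jp k ^ s * ‖dc2 c k‖ ≤ 2 * Real.pi * (jp k ^ (s + 1) * ‖c k‖) := by
  calc jp k ^ s * ‖dc2 c k‖ ≤ jp k ^ s * (2 * Real.pi * (jp k * ‖c k‖)) :=
        mul_le_mul_of_nonneg_left (norm_dc2_le c k) (pow_nonneg (jp_pos k).le _)
    _ = _ := by ring

lemma summable_dc1 {s : ℕ} {c : ℤ × ℤ → ℂ} (h : Summable fun k => jp k ^ (s + 1) * ‖c k‖) :
    Summable fun k => jp k ^ s * ‖dc1 c k‖ :=
  Summable.of_nonneg_of_le (weight_nonneg s _) (weight_dc1_le s c) (h.mul_left _)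

lemma summable_dc2 {s : ℕ} {c : ℤ × ℤ → ℂ} (h : Summable fun k => jp k ^ (s + 1) * ‖c k‖) :
    Summable fun k => jp k ^ s * ‖dc2 c k‖ :=
  Summable.of_nonneg_of_le (weight_nonneg s _) (weight_dc2_le s c) (h.mul_left _)

lemma Bd_dc1 {s : ℕ} {c : ℤ × ℤ → ℂ} {C : ℝ} (h : Bd (s + 1) (S c) C)
    (hc : Summable fun k => ‖c k‖) : Bd s (S (dc1 c)) (2 * Real.pi * C) := by
  have h1 := h.1.1
  have h2 := h.2
  rw [An] at h2
  rw [coef_S hc] at h1 h2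
  refine Bd_S (summable_dc1 h1) (((summable_dc1 h1).tsum_le_tsum (weight_dc1_le s c)
    (h1.mul_left _)).trans ?_)
  rw [tsum_mul_left]
  exact mul_le_mul_of_nonneg_left h2 (by positivity)

lemma Bd_dc2 {s : ℕ} {c : ℤ × ℤ → ℂ} {C : ℝ} (h : Bd (s + 1) (S c) C)
    (hc : Summable fun k => ‖c k‖) : Bd s (S (dc2 c)) (2 * Real.pi * C) := by
  have h1 := h.1.1
  have h2 := h.2
  rw [An] at h2
  rw [coef_S hc] at h1 h2
  refine Bd_S (summable_dc2 h1) (((summable_dc2 h1).tsum_le_tsum (weight_dc2_le s c)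
    (h1.mul_left _)).trans ?_)
  rw [tsum_mul_left]
  exact mul_le_mul_of_nonneg_left h2 (by positivity)

/-- The inclusion of the first coordinate into `ℂ`. -/
def L1 : ℝ × ℝ →L[ℝ] ℂ := Complex.ofRealCLM ∘L ContinuousLinearMap.fst ℝ ℝ ℝ

/-- The inclusion of the second coordinate into `ℂ`. -/
def L2 : ℝ × ℝ →L[ℝ] ℂ := Complex.ofRealCLM ∘L ContinuousLinearMap.snd ℝ ℝ ℝ

lemma norm_L1_le : ‖L1‖ ≤ 1 := by
  refine ContinuousLinearMap.opNorm_le_bound _ zero_le_one fun x => ?_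
  simpa [L1] using norm_fst_le x

lemma norm_L2_le : ‖L2‖ ≤ 1 := by
  refine ContinuousLinearMap.opNorm_le_bound _ zero_le_one fun x => ?_
  simpa [L2] using norm_snd_le x

lemma hasFDerivAt_S {c : ℤ × ℤ → ℂ} (h : Summable fun k => jp k ^ 1 * ‖c k‖) (x : ℝ × ℝ) :
    HasFDerivAt (S c) (S (dc1 c) x • L1 + S (dc2 c) x • L2) x := by
  have hd1 : Summable fun k => ‖dc1 c k‖ := summable_norm_of_weight (summable_dc1 (s := 0) h)
  have hd2 : Summable fun k => ‖dc2 c k‖ := summable_norm_of_weight (summable_dc2 (s := 0) h)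
  have hf : ∀ (k : ℤ × ℤ) (x : ℝ × ℝ), HasFDerivAt (fun x => c k * e k x)
      ((dc1 c k * e k x) • L1 + (dc2 c k * e k x) • L2) x := by
    intro k x
    refine ((hasFDerivAt_e k x).const_mul (c k)).congr_fderiv ?_
    ext <;> simp [L1, L2, dc1, dc2] <;> ring
  have hb : ∀ (k : ℤ × ℤ) (x : ℝ × ℝ), ‖(dc1 c k * e k x) • L1 + (dc2 c k * e k x) • L2‖ ≤
      ‖dc1 c k‖ + ‖dc2 c k‖ := by
    intro k x
    refine (norm_add_le _ _).trans (add_le_add ?_ ?_)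
    · rw [norm_smul, norm_term]
      exact mul_le_of_le_one_right (norm_nonneg _) norm_L1_le
    · rw [norm_smul, norm_term]
      exact mul_le_of_le_one_right (norm_nonneg _) norm_L2_le
  have := hasFDerivAt_tsum (hd1.add hd2) hf hb
    (summable_term (summable_norm_of_weight h) x) x
  refine this.congr_fderiv ?_
  have s1 := summable_term hd1 x
  have s2 := summable_term hd2 x
  rw [(s1.smul_const L1).tsum_add (s2.smul_const L2), s1.tsum_smul_const, s2.tsum_smul_const]
  rfl

lemma pd1_S {c : ℤ × ℤ → ℂ} (h : Summable fun k => jp k ^ 1 * ‖c k‖) : pd1 (S c) = S (dc1 c) := by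
  funext x
  rw [pd1, (hasFDerivAt_S h x).fderiv]
  simp [L1, L2]

lemma pd2_S {c : ℤ × ℤ → ℂ} (h : Summable fun k => jp k ^ 1 * ‖c k‖) : pd2 (S c) = S (dc2 c) := by
  funext x
  rw [pd2, (hasFDerivAt_S h x).fderiv]
  simp [L1, L2]

lemma contDiff_S (n : ℕ) {c : ℤ × ℤ → ℂ} (h : ∀ s : ℕ, Summable fun k => jp k ^ s * ‖c k‖) :
    ContDiff ℝ n (S c) := by
  induction n generalizing c with
  | zero => exact contDiff_zero.2 (continuous_S (summable_norm_of_weight (h 0)))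
  | succ n ih =>
    have h1 := ih (c := dc1 c) fun s => summable_dc1 (h (s + 1))
    have h2 := ih (c := dc2 c) fun s => summable_dc2 (h (s + 1))
    push_cast
    rw [contDiff_succ_iff_hasFDerivAt]
    exact ⟨fun x => S (dc1 c) x • L1 + S (dc2 c) x • L2,
      (h1.smul contDiff_const).add (h2.smul contDiff_const), hasFDerivAt_S (h 1)⟩

lemma SP_S {c : ℤ × ℤ → ℂ} (h : ∀ s : ℕ, Summable fun k => jp k ^ s * ‖c k‖) : SP (S c) where
  smooth := contDiff_infty.2 fun n => contDiff_S n h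
  per1 := S_per1 c
  per2 := S_per2 c

lemma hasSum_integral_mul_S {c : ℤ × ℤ → ℂ} (hc : Summable fun k => ‖c k‖) {f : ℝ × ℝ → ℂ}
    (hf : Continuous f) :
    HasSum (fun k => c k * ∫ x in unitSquare, f x * e k x) (∫ x in unitSquare, f x * S c x) := by
  have hF : ∀ l, Integrable (fun x => f x * (c l * e l x)) (volume.restrict unitSquare) :=
    fun l => integrable_sq (hf.mul (continuous_const.mul (continuous_e l)))
  have hn : ∀ l, ∫ x in unitSquare, ‖f x * (c l * e l x)‖ =
      (∫ x in unitSquare, ‖f x‖) * ‖c l‖ := by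
    intro l
    simp only [norm_mul, norm_e, mul_one]
    rw [integral_mul_const]
  have h1 := hasSum_integral_of_summable_integral_norm hF (by simpa only [hn] using hc.mul_left _)
  simp only [tsum_mul_left] at h1
  have h2 : ∀ l, ∫ x in unitSquare, f x * (c l * e l x) = c l * ∫ x in unitSquare, f x * e l x := by
    intro l
    rw [← integral_const_mul]
    congr 1
    funext x
    ring
  simp only [h2] at h1
  exact h1

lemma integral_conj_e (f : ℝ × ℝ → ℂ) (k : ℤ × ℤ) :
    ∫ x in unitSquare, (starRingEnd ℂ) (f x) * e k x = (starRingEnd ℂ) (coef f k) := by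
  rw [coef, ← integral_conj]
  simp [conj_e]

lemma parseval {c : ℤ × ℤ → ℂ} (hc : Summable fun k => ‖c k‖) :
    HasSum (fun k => ‖c k‖ ^ 2) (∫ x in unitSquare, ‖S c x‖ ^ 2) := by
  have h := hasSum_integral_mul_S hc (Complex.continuous_conj.comp (continuous_S hc))
  simp only [Function.comp_apply, integral_conj_e, coef_S hc, Complex.mul_conj', Complex.conj_mul']
    at h
  have h2 : (∫ x in unitSquare, ((‖S c x‖ : ℂ)) ^ 2) = ((∫ x in unitSquare, ‖S c x‖ ^ 2 : ℝ) : ℂ) := by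
    rw [← integral_complex_ofReal]
    simp
  rw [h2] at h
  exact_mod_cast h

/-- `p` is a polynomial of degree at most four in `t`, with continuous coefficients and linear
coefficient `p1`. -/
def Q (p : ℝ → ℝ × ℝ → ℝ) (p1 : ℝ × ℝ → ℝ) : Prop :=
  ∃ p0 d2 d3 d4 : ℝ × ℝ → ℝ, Continuous p0 ∧ Continuous p1 ∧ Continuous d2 ∧ Continuous d3 ∧
    Continuous d4 ∧ ∀ t x, p t x = p0 x + t * p1 x + t ^ 2 * d2 x + t ^ 3 * d3 x + t ^ 4 * d4 x

lemma Q.add {p q : ℝ → ℝ × ℝ → ℝ} {p1 q1 : ℝ × ℝ → ℝ} (hp : Q p p1) (hq : Q q q1) :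
    Q (fun t x => p t x + q t x) (fun x => p1 x + q1 x) := by
  obtain ⟨a0, a2, a3, a4, h0, h1, h2, h3, h4, h⟩ := hp
  obtain ⟨b0, b2, b3, b4, g0, g1, g2, g3, g4, g⟩ := hq
  exact ⟨_, _, _, _, h0.add g0, h1.add g1, h2.add g2, h3.add g3, h4.add g4,
    fun t x => by simp only [h, g, Pi.add_apply]; ring⟩

lemma Q.const_mul {p : ℝ → ℝ × ℝ → ℝ} {p1 : ℝ × ℝ → ℝ} (hp : Q p p1) (c : ℝ) :
    Q (fun t x => c * p t x) (fun x => c * p1 x) := by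
  obtain ⟨a0, a2, a3, a4, h0, h1, h2, h3, h4, h⟩ := hp
  exact ⟨fun x => c * a0 x, fun x => c * a2 x, fun x => c * a3 x, fun x => c * a4 x, by fun_prop,
    by fun_prop, by fun_prop, by fun_prop, by fun_prop, fun t x => by simp only [h]; ring⟩

lemma Q.sub {p q : ℝ → ℝ × ℝ → ℝ} {p1 q1 : ℝ × ℝ → ℝ} (hp : Q p p1) (hq : Q q q1) :
    Q (fun t x => p t x - q t x) (fun x => p1 x - q1 x) := by
  have := hp.add (hq.const_mul (-1))
  simpa only [neg_one_mul, ← sub_eq_add_neg] using this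

lemma Q.sum {ι : Type*} (s : Finset ι) {p : ι → ℝ → ℝ × ℝ → ℝ} {p1 : ι → ℝ × ℝ → ℝ}
    (hp : ∀ i, Q (p i) (p1 i)) :
    Q (fun t x => ∑ i ∈ s, p i t x) (fun x => ∑ i ∈ s, p1 i x) := by
  choose p0 d2 d3 d4 h0 h1 h2 h3 h4 h using hp
  exact ⟨fun x => ∑ i ∈ s, p0 i x, fun x => ∑ i ∈ s, d2 i x, fun x => ∑ i ∈ s, d3 i x,
    fun x => ∑ i ∈ s, d4 i x, by fun_prop, by fun_prop, by fun_prop, by fun_prop, by fun_prop,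
    fun t x => by simp only [h, Finset.sum_add_distrib, Finset.mul_sum]⟩

lemma Q_quad_sq {a b c : ℝ × ℝ → ℝ} (ha : Continuous a) (hb : Continuous b) (hc : Continuous c) :
    Q (fun t x => (a x + t * b x + t ^ 2 * c x) ^ 2) (fun x => 2 * (a x * b x)) :=
  ⟨fun x => a x ^ 2, fun x => b x ^ 2 + 2 * (a x * c x), fun x => 2 * (b x * c x), fun x => c x ^ 2,
    by fun_prop, by fun_prop, by fun_prop, by fun_prop, by fun_prop, fun t x => by ring⟩

lemma norm_sq_eq (z : ℂ) : ‖z‖ ^ 2 = z.re ^ 2 + z.im ^ 2 := by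
  rw [Complex.sq_norm, Complex.normSq_apply]; ring

lemma Q_norm_sq {a b c : ℝ × ℝ → ℂ} (ha : Continuous a) (hb : Continuous b) (hc : Continuous c) :
    Q (fun t x => ‖a x + t * b x + t ^ 2 * c x‖ ^ 2)
      (fun x => 2 * ((starRingEnd ℂ) (a x) * b x).re) := by
  have h1 := (Q_quad_sq (Complex.continuous_re.comp ha) (Complex.continuous_re.comp hb)
    (Complex.continuous_re.comp hc)).add
    (Q_quad_sq (Complex.continuous_im.comp ha) (Complex.continuous_im.comp hb)
    (Complex.continuous_im.comp hc))
  convert h1 using 1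
  · funext t x
    rw [norm_sq_eq]
    simp [← Complex.ofReal_pow]
  · funext x
    simp
    ring

lemma nonneg_of_quartic {I0 I1 I2 I3 I4 : ℝ}
    (h : ∀ t ∈ Set.Ioc (0 : ℝ) 1, I0 ≤ I0 + t * I1 + t ^ 2 * I2 + t ^ 3 * I3 + t ^ 4 * I4) :
    0 ≤ I1 := by
  have h1 : Filter.Tendsto (fun t : ℝ => I1 + t * I2 + t ^ 2 * I3 + t ^ 3 * I4)
      (nhdsWithin 0 (Set.Ioi 0)) (nhds (I1 + 0 * I2 + 0 ^ 2 * I3 + 0 ^ 3 * I4)) :=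
    (Continuous.tendsto (by fun_prop) 0).mono_left nhdsWithin_le_nhds
  have h2 : ∀ᶠ t in nhdsWithin (0 : ℝ) (Set.Ioi 0), 0 ≤ I1 + t * I2 + t ^ 2 * I3 + t ^ 3 * I4 := by
    filter_upwards [Ioc_mem_nhdsGT (zero_lt_one (α := ℝ))] with t ht
    have h3 := h t ht
    have h4 : 0 ≤ t * (I1 + t * I2 + t ^ 2 * I3 + t ^ 3 * I4) := by linarith
    exact nonneg_of_mul_nonneg_right h4 ht.1
  have := ge_of_tendsto h1 h2
  simpa using this

lemma Q.nonneg {p : ℝ → ℝ × ℝ → ℝ} {p1 : ℝ × ℝ → ℝ} (hp : Q p p1)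
    (hmin : ∀ t ∈ Set.Ioc (0 : ℝ) 1, ∫ x in unitSquare, p 0 x ≤ ∫ x in unitSquare, p t x) :
    0 ≤ ∫ x in unitSquare, p1 x := by
  obtain ⟨p0, d2, d3, d4, h0, h1, h2, h3, h4, h⟩ := hp
  have hi : ∀ t, ∫ x in unitSquare, p t x = (∫ x in unitSquare, p0 x)
      + t * (∫ x in unitSquare, p1 x) + t ^ 2 * (∫ x in unitSquare, d2 x)
      + t ^ 3 * (∫ x in unitSquare, d3 x) + t ^ 4 * (∫ x in unitSquare, d4 x) := by
    intro t
    simp only [h]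
    have i0 := integrable_sq h0
    have i1 := (integrable_sq h1).const_mul t
    have i2 := (integrable_sq h2).const_mul (t ^ 2)
    have i3 := (integrable_sq h3).const_mul (t ^ 3)
    have i4 := (integrable_sq h4).const_mul (t ^ 4)
    have j1 : Integrable (fun x => p0 x + t * p1 x) (volume.restrict unitSquare) := i0.add i1
    have j2 : Integrable (fun x => p0 x + t * p1 x + t ^ 2 * d2 x) (volume.restrict unitSquare) :=
      j1.add i2
    have j3 : Integrable (fun x => p0 x + t * p1 x + t ^ 2 * d2 x + t ^ 3 * d3 x)
      (volume.restrict unitSquare) := j2.add i3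
    rw [integral_add j3 i4, integral_add j2 i3, integral_add j1 i2, integral_add i0 i1]
    simp only [integral_const_mul]
  refine nonneg_of_quartic (I0 := ∫ x in unitSquare, p0 x) (I2 := ∫ x in unitSquare, d2 x)
    (I3 := ∫ x in unitSquare, d3 x) (I4 := ∫ x in unitSquare, d4 x) fun t ht => ?_
  have h5 := hmin t ht
  rw [hi 0, hi t] at h5
  simpa using h5

/-- A pair of sections without common zeros (normalised), with the matrix of one-forms of the
induced covariant derivative on `ℂ²`-valued functions. -/
structure Frame where
  s : Fin 2 → ℝ × ℝ → ℂ
  Γ : Fin 2 → Fin 2 → Fin 2 → ℝ × ℝ → ℂ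
  smooth_s : ∀ j, ContDiff ℝ (⊤ : ℕ∞) (s j)
  periodic_s : ∀ j l, SP (fun x => (starRingEnd ℂ) (s j x) * s l x)
  periodic_Γ : ∀ i j m, SP (Γ i j m)
  unit_s : ∀ x, ‖s 0 x‖ ^ 2 + ‖s 1 x‖ ^ 2 = 1

/-- Real part for `i = 0`, imaginary part for `i = 1`. -/
def bb (i : Fin 2) (z : ℂ) : ℝ := if i = 0 then z.re else z.im

lemma bb_add_mul (i : Fin 2) (z w : ℂ) (t : ℝ) : bb i (z + t * w) = bb i z + t * bb i w := by
  unfold bb; split_ifs <;> simp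

lemma continuous_bb (i : Fin 2) : Continuous (bb i) := by
  unfold bb
  split_ifs
  exacts [Complex.continuous_re, Complex.continuous_im]

namespace Frame

variable (Φ : Frame) (α β : ℝ)

lemma cont_s (j : Fin 2) : Continuous (Φ.s j) := (Φ.smooth_s j).continuous

/-- The terms of the covariant derivative without derivatives. -/
def q (x : ℝ × ℝ) (W : Fin 3 → ℂ) (i j : Fin 2) : ℂ :=
  ∑ m, Φ.Γ i j m x * W m.succ + I * (bb i (W 0) : ℂ) * W j.succ

/-- The covariant derivative of `u` with respect to the connection perturbed by `w`, where
`W = (w, u₁, u₂)` and `DW` are the values of the partial derivatives. -/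
def nab (x : ℝ × ℝ) (W : Fin 3 → ℂ) (DW : Fin 2 → Fin 3 → ℂ) (i j : Fin 2) : ℂ :=
  DW i j.succ + Φ.q x W i j

/-- The section `s₁ u₁ + s₂ u₂`. -/
def sec (x : ℝ × ℝ) (W : Fin 3 → ℂ) : ℂ := ∑ j, Φ.s j x * W j.succ

/-- Energy density. -/
def dens (x : ℝ × ℝ) (W : Fin 3 → ℂ) (DW : Fin 2 → Fin 3 → ℂ) : ℝ :=
  ‖DW 0 0 - I * DW 1 0‖ ^ 2 + ∑ i, ∑ j, ‖Φ.nab x W DW i j‖ ^ 2 - α * ‖Φ.sec x W‖ ^ 2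
    + β / 2 * (∑ j : Fin 2, ‖W j.succ‖ ^ 2) ^ 2

/-- First variation of the covariant derivative. -/
def nabvar (x : ℝ × ℝ) (W W' : Fin 3 → ℂ) (DW' : Fin 2 → Fin 3 → ℂ) (i j : Fin 2) : ℂ :=
  DW' i j.succ + ∑ m, Φ.Γ i j m x * W' m.succ + I * (bb i (W 0) : ℂ) * W' j.succ
    + I * (bb i (W' 0) : ℂ) * W j.succ

/-- First variation of the energy density. -/
def densvar (x : ℝ × ℝ) (W W' : Fin 3 → ℂ) (DW DW' : Fin 2 → Fin 3 → ℂ) : ℝ :=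
  2 * ((starRingEnd ℂ) (DW 0 0 - I * DW 1 0) * (DW' 0 0 - I * DW' 1 0)).re
    + ∑ i, ∑ j, 2 * ((starRingEnd ℂ) (Φ.nab x W DW i j) * Φ.nabvar x W W' DW' i j).re
    - α * (2 * ((starRingEnd ℂ) (Φ.sec x W) * Φ.sec x W').re)
    + β / 2 * (2 * ((∑ j : Fin 2, ‖W j.succ‖ ^ 2) *
        ∑ j : Fin 2, 2 * ((starRingEnd ℂ) (W j.succ) * W' j.succ).re))

lemma nab_add_mul (x : ℝ × ℝ) (W W' : Fin 3 → ℂ) (DW DW' : Fin 2 → Fin 3 → ℂ) (i j : Fin 2)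
    (t : ℝ) : Φ.nab x (fun n => W n + t * W' n) (fun i n => DW i n + t * DW' i n) i j =
      Φ.nab x W DW i j + t * Φ.nabvar x W W' DW' i j
        + t ^ 2 * (I * (bb i (W' 0) : ℂ) * W' j.succ) := by
  simp only [nab, q, nabvar, bb_add_mul, Fin.sum_univ_two]
  push_cast
  ring

lemma sec_add_mul (x : ℝ × ℝ) (W W' : Fin 3 → ℂ) (t : ℝ) :
    Φ.sec x (fun n => W n + t * W' n) = Φ.sec x W + t * Φ.sec x W' := by
  simp only [sec, Fin.sum_univ_two]
  ring

variable {V V' : Fin 3 → ℝ × ℝ → ℂ} {DV DV' : Fin 2 → Fin 3 → ℝ × ℝ → ℂ}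

lemma continuous_bb_comp {f : ℝ × ℝ → ℂ} (hf : Continuous f) (i : Fin 2) :
    Continuous fun x => ((bb i (f x) : ℝ) : ℂ) :=
  Complex.continuous_ofReal.comp ((continuous_bb i).comp hf)

lemma continuous_q (hV : ∀ n, Continuous (V n)) (i j : Fin 2) :
    Continuous fun x => Φ.q x (fun n => V n x) i j := by
  have h1 := fun m => (Φ.periodic_Γ i j m).continuous
  have h2 := continuous_bb_comp (hV 0) i
  unfold q
  fun_prop

lemma continuous_nab (hV : ∀ n, Continuous (V n)) (hDV : ∀ i n, Continuous (DV i n)) (i j : Fin 2) :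
    Continuous fun x => Φ.nab x (fun n => V n x) (fun i n => DV i n x) i j :=
  (hDV i j.succ).add (Φ.continuous_q hV i j)

lemma continuous_nabvar (hV : ∀ n, Continuous (V n)) (hV' : ∀ n, Continuous (V' n))
    (hDV' : ∀ i n, Continuous (DV' i n)) (i j : Fin 2) :
    Continuous fun x => Φ.nabvar x (fun n => V n x) (fun n => V' n x) (fun i n => DV' i n x) i j := by
  have h1 := fun m => (Φ.periodic_Γ i j m).continuous
  have h2 := continuous_bb_comp (hV 0) i
  have h3 := continuous_bb_comp (hV' 0) i
  unfold nabvar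
  fun_prop

lemma continuous_sec (hV : ∀ n, Continuous (V n)) : Continuous fun x => Φ.sec x (fun n => V n x) := by
  have h1 := Φ.cont_s
  unfold sec
  fun_prop

lemma continuous_dens (hV : ∀ n, Continuous (V n)) (hDV : ∀ i n, Continuous (DV i n)) :
    Continuous fun x => Φ.dens α β x (fun n => V n x) (fun i n => DV i n x) := by
  have h1 := Φ.continuous_nab hV hDV
  have h2 := Φ.continuous_sec hV
  unfold dens
  fun_prop

lemma Q_dens (hV : ∀ n, Continuous (V n)) (hDV : ∀ i n, Continuous (DV i n))
    (hV' : ∀ n, Continuous (V' n)) (hDV' : ∀ i n, Continuous (DV' i n)) :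
    Q (fun t x => Φ.dens α β x (fun n => V n x + t * V' n x) (fun i n => DV i n x + t * DV' i n x))
      (fun x => Φ.densvar α β x (fun n => V n x) (fun n => V' n x) (fun i n => DV i n x)
        (fun i n => DV' i n x)) := by
  have h3 := fun i => continuous_bb_comp (hV' 0) i
  have q1 := Q_norm_sq (a := fun x => DV 0 0 x - I * DV 1 0 x)
    (b := fun x => DV' 0 0 x - I * DV' 1 0 x) (c := fun _ => 0)
    (by fun_prop) (by fun_prop) (by fun_prop)
  have q2 := fun i j => Q_norm_sq (Φ.continuous_nab hV hDV i j)
    (Φ.continuous_nabvar hV hV' hDV' i j)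
    (c := fun x => I * (bb i (V' 0 x) : ℂ) * V' j.succ x) (by fun_prop)
  have q3 := Q_norm_sq (Φ.continuous_sec hV) (Φ.continuous_sec hV') (c := fun _ => 0) (by fun_prop)
  have q4 := Q_quad_sq (a := fun x => ∑ j : Fin 2, ‖V j.succ x‖ ^ 2)
    (b := fun x => ∑ j : Fin 2, 2 * ((starRingEnd ℂ) (V j.succ x) * V' j.succ x).re)
    (c := fun x => ∑ j : Fin 2, ‖V' j.succ x‖ ^ 2) (by fun_prop) (by fun_prop) (by fun_prop)
  have := ((q1.add (Q.sum Finset.univ fun i => Q.sum Finset.univ fun j => q2 i j)).sub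
    (q3.const_mul α)).add (q4.const_mul (β / 2))
  convert this using 1
  · funext t x
    have e1 : DV 0 0 x + t * DV' 0 0 x - I * (DV 1 0 x + t * DV' 1 0 x) =
        DV 0 0 x - I * DV 1 0 x + t * (DV' 0 0 x - I * DV' 1 0 x) + t ^ 2 * 0 := by ring
    have e2 : ∑ j : Fin 2, ‖V j.succ x + t * V' j.succ x‖ ^ 2 =
        ∑ j : Fin 2, ‖V j.succ x‖ ^ 2
          + t * ∑ j : Fin 2, 2 * ((starRingEnd ℂ) (V j.succ x) * V' j.succ x).re
          + t ^ 2 * ∑ j : Fin 2, ‖V' j.succ x‖ ^ 2 := by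
      simp only [norm_sq_eq, Fin.sum_univ_two]
      simp
      ring
    simp only [dens, nab_add_mul, sec_add_mul, e1, e2, mul_zero, add_zero]
  · rfl

end Frame

/-- The component of the frequency `k`. -/
def fr (i : Fin 2) (k : ℤ × ℤ) : ℤ := if i = 0 then k.1 else k.2

/-- Coefficients of the partial derivatives of `S c`. -/
def dc (i : Fin 2) (c : ℤ × ℤ → ℂ) (k : ℤ × ℤ) : ℂ := 2 * Real.pi * I * fr i k * c k

lemma dc_zero (c : ℤ × ℤ → ℂ) : dc 0 c = dc1 c := rfl

lemma dc_one (c : ℤ × ℤ → ℂ) : dc 1 c = dc2 c := rfl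

lemma summable_dc {s : ℕ} {c : ℤ × ℤ → ℂ} (h : Summable fun k => jp k ^ (s + 1) * ‖c k‖)
    (i : Fin 2) : Summable fun k => jp k ^ s * ‖dc i c k‖ := by
  fin_cases i
  exacts [summable_dc1 h, summable_dc2 h]

lemma Bd_dc {s : ℕ} {c : ℤ × ℤ → ℂ} {C : ℝ} (h : Bd (s + 1) (S c) C)
    (hc : Summable fun k => ‖c k‖) (i : Fin 2) : Bd s (S (dc i c)) (2 * Real.pi * C) := by
  fin_cases i
  exacts [Bd_dc1 h hc, Bd_dc2 h hc]

/-- The coefficient family supported at `k` with value `z`. -/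
def mode (k : ℤ × ℤ) (z : ℂ) (l : ℤ × ℤ) : ℂ := if l = k then z else 0

lemma summable_mode (s : ℕ) (k : ℤ × ℤ) (z : ℂ) : Summable fun l => jp l ^ s * ‖mode k z l‖ :=
  summable_of_ne_finset_zero (s := {k}) fun l hl => by
    simp [mode, Finset.notMem_singleton.1 hl]

lemma S_mode (k : ℤ × ℤ) (z : ℂ) (x : ℝ × ℝ) : S (mode k z) x = z * e k x := by
  unfold S mode
  rw [tsum_eq_single k fun l hl => by simp [hl]]
  simp

lemma dc_mode (i : Fin 2) (k : ℤ × ℤ) (z : ℂ) :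
    dc i (mode k z) = mode k (2 * Real.pi * I * fr i k * z) := by
  funext l
  unfold dc mode
  split_ifs with h
  · rw [h]
  · simp

lemma S_add_mul {c d : ℤ × ℤ → ℂ} (hc : Summable fun k => ‖c k‖) (hd : Summable fun k => ‖d k‖)
    (t : ℂ) (x : ℝ × ℝ) : S (fun k => c k + t * d k) x = S c x + t * S d x := by
  simp only [S, add_mul, mul_assoc]
  rw [(summable_term hc x).tsum_add ((summable_term hd x).mul_left t), tsum_mul_left]

lemma dc_add_mul (i : Fin 2) (c d : ℤ × ℤ → ℂ) (t : ℂ) :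
    dc i (fun k => c k + t * d k) = fun k => dc i c k + t * dc i d k := by
  funext k; unfold dc; ring

/-- Coefficient families of `(w, u₁, u₂)`. -/
abbrev St := Fin 3 → ℤ × ℤ → ℂ

/-- Values of the fields with coefficients `v`. -/
def val (v : St) (x : ℝ × ℝ) (n : Fin 3) : ℂ := S (v n) x

/-- Values of the derivatives of the fields with coefficients `v`. -/
def dval (v : St) (x : ℝ × ℝ) (i : Fin 2) (n : Fin 3) : ℂ := S (dc i (v n)) x

/-- `s`-weighted absolute summability of all components. -/
def Reg (s : ℕ) (v : St) : Prop := ∀ n, Summable fun k => jp k ^ s * ‖v n k‖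

lemma Reg.mono {s t : ℕ} {v : St} (h : Reg s v) (hst : t ≤ s) : Reg t v :=
  fun n => summable_weight_mono hst (h n)

lemma Reg.summable {s : ℕ} {v : St} (h : Reg s v) (n : Fin 3) : Summable fun k => ‖v n k‖ :=
  summable_norm_of_weight (h n)

lemma Reg.continuous_val {s : ℕ} {v : St} (h : Reg s v) (n : Fin 3) :
    Continuous fun x => val v x n := continuous_S (h.summable n)

lemma Reg.continuous_dval {v : St} (h : Reg 1 v) (i : Fin 2) (n : Fin 3) :
    Continuous fun x => dval v x i n :=
  continuous_S (summable_norm_of_weight (summable_dc (s := 0) (h n) i))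

namespace Frame

variable (Φ : Frame) (α β : ℝ)

/-- The energy as a function of the coefficients. -/
def G (v : St) : ℝ := (1 / 2) * ∫ x in unitSquare, Φ.dens α β x (val v x) (dval v x)

/-- The non-derivative part of the covariant derivative. -/
def qf (v : St) (i j : Fin 2) (x : ℝ × ℝ) : ℂ := Φ.q x (val v x) i j

/-- The covariant derivative. -/
def pf (v : St) (i j : Fin 2) (x : ℝ × ℝ) : ℂ := Φ.nab x (val v x) (dval v x) i j

/-- The lower order terms in the equation for `u`. -/
def Hf (v : St) (j : Fin 2) (x : ℝ × ℝ) : ℂ :=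
  ∑ i, ∑ l, (starRingEnd ℂ) (Φ.Γ i l j x) * Φ.pf v i l x
    + ∑ i, -I * (bb i (val v x 0) : ℂ) * Φ.pf v i j x
    - α * ∑ l, ((starRingEnd ℂ) (Φ.s j x) * Φ.s l x) * val v x l.succ
    + β * ((∑ l : Fin 2, (starRingEnd ℂ) (val v x l.succ) * val v x l.succ) * val v x j.succ)

/-- The components of the current. -/
def Jc (v : St) (i : Fin 2) (x : ℝ × ℝ) : ℝ :=
  ∑ l, ((starRingEnd ℂ) (Φ.pf v i l x) * (I * val v x l.succ)).re

/-- The current as a complex function. -/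
def Jf (v : St) (x : ℝ × ℝ) : ℂ := Φ.Jc v 0 x + I * Φ.Jc v 1 x

variable {Φ α β} {v : St}

lemma continuous_qf (hv : Reg 1 v) (i j : Fin 2) : Continuous (Φ.qf v i j) :=
  Φ.continuous_q hv.continuous_val i j

lemma continuous_pf (hv : Reg 1 v) (i j : Fin 2) : Continuous (Φ.pf v i j) :=
  Φ.continuous_nab hv.continuous_val hv.continuous_dval i j

lemma continuous_Hf (hv : Reg 1 v) (j : Fin 2) : Continuous (Φ.Hf α β v j) := by
  have h1 := fun i j => continuous_pf (Φ := Φ) hv i j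
  have h2 := fun i => continuous_bb_comp (hv.continuous_val 0) i
  have h3 := hv.continuous_val
  have h4 := Φ.cont_s
  have h5 := fun i j m => (Φ.periodic_Γ i j m).continuous
  unfold Hf
  fun_prop

lemma continuous_Jc (hv : Reg 1 v) (i : Fin 2) : Continuous (Φ.Jc v i) := by
  have h1 := fun i j => continuous_pf (Φ := Φ) hv i j
  have h3 := hv.continuous_val
  unfold Jc
  exact continuous_finsetSum _ fun l _ => Complex.continuous_re.comp
    ((Complex.continuous_conj.comp (h1 i l)).mul (continuous_const.mul (h3 l.succ)))

lemma continuous_Jf (hv : Reg 1 v) : Continuous (Φ.Jf v) := by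
  have h1 := fun i => continuous_Jc (Φ := Φ) hv i
  unfold Jf
  fun_prop

/-- First variation along a single mode. -/
lemma densvar_nonneg (hv : Reg 1 v) (n0 : Fin 3) (k : ℤ × ℤ)
    (hmin : ∀ t : ℝ, t ∈ Set.Ioc (0 : ℝ) 1 →
      Φ.G α β v ≤ Φ.G α β (fun n l => v n l + t * if n = n0 then mode k (-v n0 k) l else 0)) :
    0 ≤ ∫ x in unitSquare, Φ.densvar α β x (val v x)
      (fun n => if n = n0 then -v n0 k * e k x else 0) (dval v x)
      (fun i n => if n = n0 then 2 * Real.pi * I * fr i k * (-v n0 k) * e k x else 0) := by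
  have hV' : ∀ n : Fin 3, Continuous fun x => if n = n0 then -v n0 k * e k x else 0 := by
    intro n
    split_ifs
    exacts [continuous_const.mul (continuous_e k), continuous_const]
  have hDV' : ∀ (i : Fin 2) (n : Fin 3), Continuous fun x => if n = n0 then
      2 * Real.pi * I * fr i k * (-v n0 k) * e k x else 0 := by
    intro i n
    split_ifs
    exacts [continuous_const.mul (continuous_e k), continuous_const]
  refine (Φ.Q_dens α β hv.continuous_val hv.continuous_dval hV' hDV').nonneg fun t ht => ?_
  have h := hmin t ht
  unfold G at h
  have h2 : ∀ x, val (fun n l => v n l + t * if n = n0 then mode k (-v n0 k) l else 0) x =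
      fun n => val v x n + t * if n = n0 then -v n0 k * e k x else 0 := by
    intro x
    funext n
    by_cases hn : n = n0
    · simp only [val, hn, if_true]
      rw [S_add_mul (hv.summable n0) (summable_norm_of_weight (summable_mode 0 k _)), S_mode]
    · simp only [val, hn, if_false, mul_zero, add_zero]
  have h3 : ∀ x, dval (fun n l => v n l + t * if n = n0 then mode k (-v n0 k) l else 0) x =
      fun i n => dval v x i n + t * if n = n0 then 2 * Real.pi * I * fr i k * (-v n0 k) * e k x
        else 0 := by
    intro x
    funext i n
    by_cases hn : n = n0
    · simp only [dval, hn, if_true]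
      rw [dc_add_mul, S_add_mul (summable_norm_of_weight (summable_dc (s := 0) (hv n0) i))
        (summable_norm_of_weight (summable_dc (s := 0) (summable_mode 1 k _) i)), dc_mode, S_mode]
    · simp only [dval, hn, if_false, mul_zero, add_zero]
  simp only [h2, h3] at h
  simp only [Complex.ofReal_zero, zero_mul, add_zero]
  linarith

lemma integral_re_mul {f : ℝ × ℝ → ℂ} (hf : Continuous f) (k : ℤ × ℤ) (z : ℂ) :
    ∫ x in unitSquare, (z * ((starRingEnd ℂ) (f x) * e k x)).re =
      (z * (starRingEnd ℂ) (coef f k)).re := by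
  rw [← integral_conj_e, ← integral_const_mul]
  exact integral_re (𝕜 := ℂ) (integrable_sq
    (continuous_const.mul ((Complex.continuous_conj.comp hf).mul (continuous_e k))))

lemma coef_S_add_mul {v : St} (hv : Reg 1 v) (i j : Fin 2) (k : ℤ × ℤ) :
    coef (Φ.pf v i j) k = 2 * Real.pi * I * fr i k * v j.succ k + coef (Φ.qf v i j) k := by
  have := coef_add (hv.continuous_dval i j.succ) (continuous_qf (Φ := Φ) hv i j) k
  have h2 : coef (fun x => dval v x i j.succ) k = dc i (v j.succ) k :=
    congrFun (coef_S (summable_norm_of_weight (summable_dc (s := 0) (hv j.succ) i))) k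
  rw [h2] at this
  exact this

lemma re_mul_conj_add (z q : ℂ) : ‖z‖ ^ 2 - ‖z‖ * ‖q‖ ≤ (z * (starRingEnd ℂ) (z + q)).re := by
  have h1 : (z * (starRingEnd ℂ) (z + q)).re = ‖z‖ ^ 2 + (z * (starRingEnd ℂ) q).re := by
    rw [norm_sq_eq]; simp; ring
  have h2 := Complex.abs_re_le_norm (z * (starRingEnd ℂ) q)
  rw [norm_mul, RCLike.norm_conj] at h2
  linarith [neg_abs_le (z * (starRingEnd ℂ) q).re]

lemma norm_fr (n : ℤ) (c : ℂ) : ‖2 * Real.pi * I * n * c‖ = 2 * Real.pi * |(n : ℝ)| * ‖c‖ := by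
  simp only [norm_mul, Complex.norm_I, Complex.norm_real, Complex.norm_intCast,
        Complex.norm_ofNat, mul_one, Real.norm_eq_abs, abs_of_pos Real.pi_pos]

lemma neg_norm_le_re (c z : ℂ) : -(‖c‖ * ‖z‖) ≤ (c * (starRingEnd ℂ) z).re := by
  have h2 := Complex.abs_re_le_norm (c * (starRingEnd ℂ) z)
  rw [norm_mul, RCLike.norm_conj] at h2
  linarith [neg_abs_le (c * (starRingEnd ℂ) z).re]

lemma mode_u (hv : Reg 1 v) (j : Fin 2) (k : ℤ × ℤ)
    (hmin : ∀ t : ℝ, t ∈ Set.Ioc (0 : ℝ) 1 →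
      Φ.G α β v ≤ Φ.G α β (fun n l => v n l + t * if n = j.succ then mode k (-v j.succ k) l else 0)) :
    4 * Real.pi ^ 2 * ((k.1 : ℝ) ^ 2 + (k.2 : ℝ) ^ 2) * ‖v j.succ k‖ ≤
      2 * Real.pi * |(k.1 : ℝ)| * ‖coef (Φ.qf v 0 j) k‖
        + 2 * Real.pi * |(k.2 : ℝ)| * ‖coef (Φ.qf v 1 j) k‖ + ‖coef (Φ.Hf α β v j) k‖ := by
  have h := densvar_nonneg hv j.succ k hmin
  set c := v j.succ k with hc
  have hd : ∀ x, Φ.densvar α β x (val v x)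
      (fun n => if n = j.succ then -c * e k x else 0) (dval v x)
      (fun i n => if n = j.succ then 2 * Real.pi * I * fr i k * (-c) * e k x else 0) =
      -2 * ((2 * Real.pi * I * k.1 * c * ((starRingEnd ℂ) (Φ.pf v 0 j x) * e k x)).re
      + (2 * Real.pi * I * k.2 * c * ((starRingEnd ℂ) (Φ.pf v 1 j x) * e k x)).re
      + (c * ((starRingEnd ℂ) (Φ.Hf α β v j x) * e k x)).re) := by
    intro x
    have hp : ∀ i l, Φ.nab x (val v x) (dval v x) i l = Φ.pf v i l x := fun _ _ => rfl
    have e0 : ∀ z : ℂ, bb 0 z = z.re := fun _ => rfl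
    have e1 : ∀ z : ℂ, bb 1 z = z.im := fun _ => rfl
    fin_cases j
    · simp only [Frame.densvar, Frame.nabvar, Frame.Hf, hp, Frame.sec, fr, Fin.sum_univ_two]
      simp [norm_sq_eq, e0, e1]
      ring
    · simp only [Frame.densvar, Frame.nabvar, Frame.Hf, hp, Frame.sec, fr, Fin.sum_univ_two]
      simp [norm_sq_eq, e0, e1]
      ring
  simp only [hd] at h
  have c0 := continuous_pf (Φ := Φ) hv 0 j
  have c1 := continuous_pf (Φ := Φ) hv 1 j
  have c2 := continuous_Hf (Φ := Φ) (α := α) (β := β) hv j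
  have hint : ∀ (f : ℝ × ℝ → ℂ) (z : ℂ), Continuous f →
      Integrable (fun x => (z * ((starRingEnd ℂ) (f x) * e k x)).re) (volume.restrict unitSquare) :=
    fun f z hf => integrable_sq (Complex.continuous_re.comp
      (continuous_const.mul ((Complex.continuous_conj.comp hf).mul (continuous_e k))))
  have i01 : Integrable (fun x => (2 * Real.pi * I * k.1 * c *
      ((starRingEnd ℂ) (Φ.pf v 0 j x) * e k x)).re + (2 * Real.pi * I * k.2 * c *
      ((starRingEnd ℂ) (Φ.pf v 1 j x) * e k x)).re) (volume.restrict unitSquare) :=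
    (hint _ _ c0).add (hint _ _ c1)
  rw [integral_const_mul, integral_add i01 (hint _ _ c2), integral_add (hint _ _ c0) (hint _ _ c1),
    integral_re_mul c0, integral_re_mul c1, integral_re_mul c2, coef_S_add_mul hv,
    coef_S_add_mul hv] at h
  have r0 := re_mul_conj_add (2 * Real.pi * I * k.1 * c) (coef (Φ.qf v 0 j) k)
  have r1 := re_mul_conj_add (2 * Real.pi * I * k.2 * c) (coef (Φ.qf v 1 j) k)
  have r2 := neg_norm_le_re c (coef (Φ.Hf α β v j) k)
  rw [norm_fr] at r0 r1
  have f0 : fr 0 k = k.1 := rfl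
  have f1 : fr 1 k = k.2 := rfl
  rw [f0, f1] at h
  have hpi := Real.pi_pos
  rcases eq_or_ne c 0 with h0 | h0
  · rw [h0, norm_zero, mul_zero]
    positivity
  · refine le_of_mul_le_mul_right ?_ (norm_pos_iff.2 h0)
    have s0 := sq_abs (k.1 : ℝ)
    have s1 := sq_abs (k.2 : ℝ)
    rw [← s0, ← s1]
    linarith

lemma mode_w (hv : Reg 1 v) (k : ℤ × ℤ)
    (hmin : ∀ t : ℝ, t ∈ Set.Ioc (0 : ℝ) 1 →
      Φ.G α β v ≤ Φ.G α β (fun n l => v n l + t * if n = 0 then mode k (-v 0 k) l else 0)) :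
    4 * Real.pi ^ 2 * ((k.1 : ℝ) ^ 2 + (k.2 : ℝ) ^ 2) * ‖v 0 k‖ ≤ ‖coef (Φ.Jf v) k‖ := by
  have h := densvar_nonneg hv 0 k hmin
  set c := v 0 k with hc
  have hd : ∀ x, Φ.densvar α β x (val v x)
      (fun n => if n = 0 then -c * e k x else 0) (dval v x)
      (fun i n => if n = 0 then 2 * Real.pi * I * fr i k * (-c) * e k x else 0) =
      -2 * (((2 * Real.pi * I * (k.1 - I * k.2)) * c *
        ((starRingEnd ℂ) (dval v x 0 0 - I * dval v x 1 0) * e k x)).re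
      + (c * ((starRingEnd ℂ) (Φ.Jf v x) * e k x)).re) := by
    intro x
    have hp : ∀ i l, Φ.nab x (val v x) (dval v x) i l = Φ.pf v i l x := fun _ _ => rfl
    have e0 : ∀ z : ℂ, bb 0 z = z.re := fun _ => rfl
    have e1 : ∀ z : ℂ, bb 1 z = z.im := fun _ => rfl
    simp only [Frame.densvar, Frame.nabvar, Frame.Jf, Frame.Jc, hp, Frame.sec, fr,
      Fin.sum_univ_two]
    simp [e0, e1]
    ring
  simp only [hd] at h
  have cd : Continuous fun x => dval v x 0 0 - I * dval v x 1 0 :=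
    (hv.continuous_dval 0 0).sub (continuous_const.mul (hv.continuous_dval 1 0))
  have cJ := continuous_Jf (Φ := Φ) hv
  have hint : ∀ (f : ℝ × ℝ → ℂ) (z : ℂ), Continuous f →
      Integrable (fun x => (z * ((starRingEnd ℂ) (f x) * e k x)).re) (volume.restrict unitSquare) :=
    fun f z hf => integrable_sq (Complex.continuous_re.comp
      (continuous_const.mul ((Complex.continuous_conj.comp hf).mul (continuous_e k))))
  have hco : coef (fun x => dval v x 0 0 - I * dval v x 1 0) k =
      2 * Real.pi * I * (k.1 - I * k.2) * c := by
    have h1 := coef_sub (f := fun x => dval v x 0 0) (g := fun x => I * dval v x 1 0)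
      (hv.continuous_dval 0 0) (continuous_const.mul (hv.continuous_dval 1 0)) k
    rw [h1, coef_const_mul I (fun x => dval v x 1 0)]
    have h2 : ∀ i, coef (fun x => dval v x i 0) k = dc i (v 0) k := fun i =>
      congrFun (coef_S (summable_norm_of_weight (summable_dc (s := 0) (hv 0) i))) k
    rw [h2, h2, dc_zero, dc_one, dc1, dc2]
    ring
  rw [integral_const_mul, integral_add (hint _ _ cd) (hint _ _ cJ), integral_re_mul cd,
    integral_re_mul cJ, hco, Complex.mul_conj, Complex.ofReal_re, ← Complex.sq_norm] at h
  have r2 := neg_norm_le_re c (coef (Φ.Jf v) k)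
  have hn : ‖2 * Real.pi * I * (k.1 - I * k.2) * c‖ ^ 2 =
      4 * Real.pi ^ 2 * ((k.1 : ℝ) ^ 2 + (k.2 : ℝ) ^ 2) * ‖c‖ ^ 2 := by
    rw [norm_mul, mul_pow, norm_sq_eq]
    congr 1
    simp
    ring
  rw [hn] at h
  rcases eq_or_ne c 0 with h0 | h0
  · rw [h0, norm_zero, mul_zero]
    positivity
  · refine le_of_mul_le_mul_right ?_ (norm_pos_iff.2 h0)
    linarith

/-- The coefficient inequalities satisfied by constrained minimisers. -/
structure ModeIneq (Φ : Frame) (α β : ℝ) (v : St) : Prop where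
  u : ∀ (j : Fin 2) (k : ℤ × ℤ),
    4 * Real.pi ^ 2 * ((k.1 : ℝ) ^ 2 + (k.2 : ℝ) ^ 2) * ‖v j.succ k‖ ≤
      2 * Real.pi * |(k.1 : ℝ)| * ‖coef (Φ.qf v 0 j) k‖
        + 2 * Real.pi * |(k.2 : ℝ)| * ‖coef (Φ.qf v 1 j) k‖ + ‖coef (Φ.Hf α β v j) k‖
  w : ∀ k : ℤ × ℤ,
    4 * Real.pi ^ 2 * ((k.1 : ℝ) ^ 2 + (k.2 : ℝ) ^ 2) * ‖v 0 k‖ ≤ ‖coef (Φ.Jf v) k‖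

/-- The compact sets of coefficient families over which the energy is minimised. -/
def box (R : ℝ) : Set St :=
  Set.pi Set.univ fun n => Set.pi Set.univ fun k =>
    if n = 0 ∧ k = 0 then Set.Icc (-Real.pi) Real.pi ×ℂ Set.Icc (-Real.pi) Real.pi
    else Metric.closedBall 0 (R * (jp k ^ 5)⁻¹)

lemma isCompact_box (R : ℝ) : IsCompact (box R) := by
  refine isCompact_univ_pi fun n => isCompact_univ_pi fun k => ?_
  split_ifs
  exacts [isCompact_Icc.reProdIm isCompact_Icc, isCompact_closedBall _ _]

lemma mem_box {R : ℝ} {v : St} : v ∈ box R ↔ (|(v 0 0).re| ≤ Real.pi ∧ |(v 0 0).im| ≤ Real.pi) ∧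
    ∀ n k, ¬ (n = 0 ∧ k = 0) → jp k ^ 5 * ‖v n k‖ ≤ R := by
  have key : ∀ n k, (v n k ∈ Metric.closedBall (0 : ℂ) (R * (jp k ^ 5)⁻¹)) ↔
      jp k ^ 5 * ‖v n k‖ ≤ R := by
    intro n k
    rw [mem_closedBall_zero_iff, ← div_eq_mul_inv, le_div_iff₀ (pow_pos (jp_pos k) 5), mul_comm]
  constructor
  · intro h
    refine ⟨?_, fun n k hnk => ?_⟩
    · have := h 0 (Set.mem_univ _) 0 (Set.mem_univ _)
      simp only [and_self, if_true, Complex.mem_reProdIm, Set.mem_Icc] at this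
      exact ⟨abs_le.2 this.1, abs_le.2 this.2⟩
    · have := h n (Set.mem_univ _) k (Set.mem_univ _)
      simp only [hnk, if_false] at this
      exact (key n k).1 this
  · rintro ⟨⟨h1, h2⟩, h⟩ n - k -
    beta_reduce
    split_ifs with hnk
    · rw [hnk.1, hnk.2]
      exact ⟨abs_le.1 h1, abs_le.1 h2⟩
    · exact (key n k).2 (h n k hnk)

lemma zero_mem_box {R : ℝ} (hR : 0 ≤ R) : (0 : St) ∈ box R := by
  rw [mem_box]
  simp [Real.pi_pos.le, hR]

lemma box_bound {R : ℝ} (hR : 2 * Real.pi ≤ R) {v : St} (hv : v ∈ box R) (n : Fin 3) (k : ℤ × ℤ) :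
    jp k ^ 5 * ‖v n k‖ ≤ R := by
  rw [mem_box] at hv
  by_cases h : n = 0 ∧ k = 0
  · rw [h.1, h.2, jp_zero, one_pow, one_mul]
    have := Complex.norm_le_abs_re_add_abs_im (v 0 0)
    linarith [hv.1.1, hv.1.2]
  · exact hv.2 n k h

lemma box_reg {R : ℝ} (hR : 2 * Real.pi ≤ R) {v : St} (hv : v ∈ box R) : Reg 2 v :=
  fun n => summable_of_decay (C := R) fun k => box_bound hR hv n k

lemma continuousOn_S_box {R : ℝ} (hR : 2 * Real.pi ≤ R) (n : Fin 3) :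
    Continuous fun p : box R × (ℝ × ℝ) => S (p.1.1 n) p.2 := by
  have hb : Summable fun k : ℤ × ℤ => R * (jp k ^ 3)⁻¹ := summable_jp_inv_cube.mul_left R
  refine continuous_tsum (u := fun k : ℤ × ℤ => R * (jp k ^ 3)⁻¹) (fun k => ?_) hb fun k p => ?_
  · have h1 : Continuous fun p : box R × (ℝ × ℝ) => p.1.1 n k :=
      (continuous_apply k).comp ((continuous_apply n).comp (continuous_subtype_val.comp
        continuous_fst))
    exact h1.mul ((continuous_e k).comp continuous_snd)
  · rw [norm_term, ← div_eq_mul_inv, le_div_iff₀ (pow_pos (jp_pos k) 3), mul_comm]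
    refine le_trans ?_ (box_bound hR p.1.2 n k)
    exact mul_le_mul_of_nonneg_right (pow_le_pow_right₀ (one_le_jp k) (by norm_num))
      (norm_nonneg _)

lemma norm_dc_le (i : Fin 2) (c : ℤ × ℤ → ℂ) (k : ℤ × ℤ) :
    ‖dc i c k‖ ≤ 2 * Real.pi * (jp k * ‖c k‖) := by
  fin_cases i
  exacts [norm_dc1_le c k, norm_dc2_le c k]

lemma continuousOn_dS_box {R : ℝ} (hR : 2 * Real.pi ≤ R) (i : Fin 2) (n : Fin 3) :
    Continuous fun p : box R × (ℝ × ℝ) => S (dc i (p.1.1 n)) p.2 := by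
  have hb : Summable fun k : ℤ × ℤ => 2 * Real.pi * R * (jp k ^ 3)⁻¹ :=
    summable_jp_inv_cube.mul_left _
  refine continuous_tsum (u := fun k : ℤ × ℤ => 2 * Real.pi * R * (jp k ^ 3)⁻¹) (fun k => ?_) hb
    fun k p => ?_
  · have h1 : Continuous fun p : box R × (ℝ × ℝ) => p.1.1 n k :=
      (continuous_apply k).comp ((continuous_apply n).comp (continuous_subtype_val.comp
        continuous_fst))
    exact (continuous_const.mul h1).mul ((continuous_e k).comp continuous_snd)
  · rw [norm_term]
    refine (norm_dc_le i _ k).trans ?_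
    rw [mul_assoc (2 * Real.pi)]
    refine mul_le_mul_of_nonneg_left ?_ (by positivity)
    rw [← div_eq_mul_inv, le_div_iff₀ (pow_pos (jp_pos k) 3)]
    calc jp k * ‖p.1.1 n k‖ * jp k ^ 3 = jp k ^ 4 * ‖p.1.1 n k‖ := by ring
      _ ≤ jp k ^ 5 * ‖p.1.1 n k‖ :=
        mul_le_mul_of_nonneg_right (pow_le_pow_right₀ (one_le_jp k) (by norm_num)) (norm_nonneg _)
      _ ≤ R := box_bound hR p.1.2 n k

lemma continuousOn_G {R : ℝ} (hR : 2 * Real.pi ≤ R) : ContinuousOn (Φ.G α β) (box R) := by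
  rw [continuousOn_iff_continuous_domRestrict]
  have : CompactSpace (box R) := isCompact_iff_compactSpace.1 (isCompact_box R)
  have h1 : ∀ n, Continuous fun p : box R × (ℝ × ℝ) => val p.1.1 p.2 n := continuousOn_S_box hR
  have h2 : ∀ i n, Continuous fun p : box R × (ℝ × ℝ) => dval p.1.1 p.2 i n :=
    continuousOn_dS_box hR
  have hb : ∀ i, Continuous fun p : box R × (ℝ × ℝ) => ((bb i (val p.1.1 p.2 0) : ℝ) : ℂ) :=
    fun i => Complex.continuous_ofReal.comp ((continuous_bb i).comp (h1 0))
  have hs : ∀ j, Continuous fun p : box R × (ℝ × ℝ) => Φ.s j p.2 := fun j =>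
    (Φ.cont_s j).comp continuous_snd
  have hΓ : ∀ i j m, Continuous fun p : box R × (ℝ × ℝ) => Φ.Γ i j m p.2 := fun i j m =>
    (Φ.periodic_Γ i j m).continuous.comp continuous_snd
  have h3 : Continuous (Function.uncurry fun (v : box R) (x : ℝ × ℝ) =>
      Φ.dens α β x (val v.1 x) (dval v.1 x)) := by
    unfold Function.uncurry Frame.dens Frame.nab Frame.sec Frame.q
    simp only [Fin.sum_univ_two]
    fun_prop
  exact continuous_const.mul (continuous_parametric_integral_of_continuous h3 isCompact_unitSquare)

lemma exists_min_box {R : ℝ} (hR : 2 * Real.pi ≤ R) :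
    ∃ v ∈ box R, ∀ v' ∈ box R, Φ.G α β v ≤ Φ.G α β v' :=
  (isCompact_box R).exists_isMinOn ⟨0, zero_mem_box (by linarith [Real.pi_pos])⟩
    (continuousOn_G hR)

lemma modeIneq_of_min {R : ℝ} (hR : 2 * Real.pi ≤ R) {v : St} (hv : v ∈ box R)
    (hmin : ∀ v' ∈ box R, Φ.G α β v ≤ Φ.G α β v') : ModeIneq Φ α β v := by
  have hr : Reg 1 v := (box_reg hR hv).mono (by norm_num)
  have key : ∀ (n0 : Fin 3) (k : ℤ × ℤ), ¬ (n0 = 0 ∧ k = 0) → ∀ t : ℝ, t ∈ Set.Ioc (0 : ℝ) 1 →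
      (fun n l => v n l + t * if n = n0 then mode k (-v n0 k) l else 0) ∈ box R := by
    intro n0 k hk t ht
    have h0 := mem_box.1 hv
    have hval : ∀ n l, (v n l + t * if n = n0 then mode k (-v n0 k) l else 0) = v n l ∨
        (n = n0 ∧ l = k ∧ (v n l + t * if n = n0 then mode k (-v n0 k) l else 0) =
          ((1 - t : ℝ) : ℂ) * v n l) := by
      intro n l
      by_cases h1 : n = n0
      · by_cases h2 : l = k
        · right
          refine ⟨h1, h2, ?_⟩
          simp only [h1, h2, mode, if_true]
          push_cast
          ring
        · left; simp [h2, mode]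
      · left; simp [h1]
    rw [mem_box]
    constructor
    · rcases hval 0 0 with h | ⟨h1, h2, -⟩
      · rw [h]; exact h0.1
      · exact absurd ⟨h1.symm, h2.symm⟩ hk
    · intro n l hnl
      refine le_trans (mul_le_mul_of_nonneg_left ?_ (pow_nonneg (jp_pos l).le 5)) (h0.2 n l hnl)
      rcases hval n l with h | ⟨-, -, h⟩
      · rw [h]
      · rw [h, norm_mul, Complex.norm_real, Real.norm_eq_abs, abs_of_nonneg (by linarith [ht.2])]
        exact mul_le_of_le_one_left (norm_nonneg _) (by linarith [ht.1])
  constructor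
  · intro j k
    exact mode_u hr j k fun t ht => hmin _ (key _ k (fun h => Fin.succ_ne_zero j h.1) t ht)
  · intro k
    by_cases hk : k = 0
    · simp [hk]
    · exact mode_w hr k fun t ht => hmin _ (key _ k (fun h => hk h.2) t ht)

end Frame

/-- `s`-weighted absolute summability of all components, with a bound. -/
def Nb (s : ℕ) (v : St) (m : ℝ) : Prop :=
  ∀ n, (Summable fun k => jp k ^ s * ‖v n k‖) ∧ ∑' k, jp k ^ s * ‖v n k‖ ≤ m

lemma Nb.reg {s : ℕ} {v : St} {m : ℝ} (h : Nb s v m) : Reg s v := fun n => (h n).1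

lemma Nb.bd {s : ℕ} {v : St} {m : ℝ} (h : Nb s v m) (n : Fin 3) : Bd s (S (v n)) m :=
  Bd_S (h n).1 (h n).2

lemma Nb.mono {s : ℕ} {v : St} {m m' : ℝ} (h : Nb s v m) (hm : m ≤ m') : Nb s v m' :=
  fun n => ⟨(h n).1, (h n).2.trans hm⟩

lemma Bd.congr {s : ℕ} {f g : ℝ × ℝ → ℂ} {C : ℝ} (h : Bd s f C) (hfg : ∀ x, g x = f x) :
    Bd s g C := by
  rwa [funext hfg]

lemma Bd.ofReal_re {s : ℕ} {f : ℝ × ℝ → ℂ} {C : ℝ} (h : Bd s f C) :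
    Bd s (fun x => ((f x).re : ℂ)) C := by
  have h1 := (h.add h.conj).const_mul (1 / 2)
  have e1 : (fun x => (1 / 2 : ℂ) * (f x + (starRingEnd ℂ) (f x))) = fun x => ((f x).re : ℂ) := by
    funext x
    rw [Complex.re_eq_add_conj]
    ring
  rw [e1] at h1
  refine h1.mono (le_of_eq ?_)
  norm_num
  ring

lemma Bd.ofReal_bb {s : ℕ} {f : ℝ × ℝ → ℂ} {C : ℝ} (h : Bd s f C) (i : Fin 2) :
    Bd s (fun x => ((bb i (f x) : ℝ) : ℂ)) C := by
  fin_cases i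
  · exact h.ofReal_re
  · have h1 := (h.const_mul (-I)).ofReal_re
    have e1 : (fun x => ((-I * f x).re : ℂ)) = fun x => ((bb 1 (f x) : ℝ) : ℂ) := by
      funext x
      simp [bb]
    rw [e1] at h1
    refine h1.mono (le_of_eq ?_)
    simp

lemma four_pi_sq_jp {k : ℤ × ℤ} (hk : k ≠ 0) :
    jp k ^ 2 ≤ 4 * Real.pi ^ 2 * ((k.1 : ℝ) ^ 2 + (k.2 : ℝ) ^ 2) := by
  refine (jp_sq_le hk).trans (mul_le_mul_of_nonneg_right ?_ (by positivity))
  nlinarith [Real.pi_gt_three]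

namespace Frame

variable (Φ : Frame) (α β : ℝ)

/-- A common bound for the coefficients of the frame. -/
lemma exists_bound (s : ℕ) : ∃ K : ℝ, 1 ≤ K ∧ (∀ i j m, Bd s (Φ.Γ i j m) K) ∧
    ∀ j l, Bd s (fun x => (starRingEnd ℂ) (Φ.s j x) * Φ.s l x) K := by
  refine ⟨1 + ∑ i, ∑ j, ∑ m, An s (Φ.Γ i j m)
    + ∑ j, ∑ l, An s (fun x => (starRingEnd ℂ) (Φ.s j x) * Φ.s l x), ?_, ?_, ?_⟩
  · have h1 : 0 ≤ ∑ i, ∑ j, ∑ m, An s (Φ.Γ i j m) := Finset.sum_nonneg fun i _ =>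
      Finset.sum_nonneg fun j _ => Finset.sum_nonneg fun m _ => An_nonneg s _
    have h2 : 0 ≤ ∑ j, ∑ l, An s (fun x => (starRingEnd ℂ) (Φ.s j x) * Φ.s l x) :=
      Finset.sum_nonneg fun i _ => Finset.sum_nonneg fun j _ => An_nonneg s _
    linarith
  · intro i j m
    refine ((Φ.periodic_Γ i j m).inA s).bd.mono ?_
    have h2 : 0 ≤ ∑ j, ∑ l, An s (fun x => (starRingEnd ℂ) (Φ.s j x) * Φ.s l x) :=
      Finset.sum_nonneg fun i _ => Finset.sum_nonneg fun j _ => An_nonneg s _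
    have h3 : An s (Φ.Γ i j m) ≤ ∑ m, An s (Φ.Γ i j m) :=
      Finset.single_le_sum (f := fun m => An s (Φ.Γ i j m)) (fun m _ => An_nonneg s _)
        (Finset.mem_univ m)
    have h4 : ∑ m, An s (Φ.Γ i j m) ≤ ∑ j, ∑ m, An s (Φ.Γ i j m) :=
      Finset.single_le_sum (f := fun j => ∑ m, An s (Φ.Γ i j m))
        (fun j _ => Finset.sum_nonneg fun m _ => An_nonneg s _) (Finset.mem_univ j)
    have h5 : ∑ j, ∑ m, An s (Φ.Γ i j m) ≤ ∑ i, ∑ j, ∑ m, An s (Φ.Γ i j m) :=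
      Finset.single_le_sum (f := fun i => ∑ j, ∑ m, An s (Φ.Γ i j m))
        (fun i _ => Finset.sum_nonneg fun j _ => Finset.sum_nonneg fun m _ => An_nonneg s _)
        (Finset.mem_univ i)
    linarith
  · intro j l
    refine ((Φ.periodic_s j l).inA s).bd.mono ?_
    have h1 : 0 ≤ ∑ i, ∑ j, ∑ m, An s (Φ.Γ i j m) := Finset.sum_nonneg fun i _ =>
      Finset.sum_nonneg fun j _ => Finset.sum_nonneg fun m _ => An_nonneg s _
    have h3 := Finset.single_le_sum
      (f := fun l => An s (fun x => (starRingEnd ℂ) (Φ.s j x) * Φ.s l x))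
      (fun m _ => An_nonneg s _) (Finset.mem_univ l)
    have h4 := Finset.single_le_sum
      (f := fun j => ∑ l, An s (fun x => (starRingEnd ℂ) (Φ.s j x) * Φ.s l x))
      (fun j _ => Finset.sum_nonneg fun m _ => An_nonneg s _) (Finset.mem_univ j)
    linarith

variable {Φ α β} {v : St} {s : ℕ} {K m0 m1 : ℝ}

lemma Bd_qf_low (hK : 1 ≤ K) (hΓ : ∀ i j m, Bd s (Φ.Γ i j m) K) (h1 : 1 ≤ m0) (h0 : Nb s v m0)
    (i j : Fin 2) : Bd s (Φ.qf v i j) (3 * K * m0 ^ 2) := by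
  have a1 := Bd.sum Finset.univ fun m (_ : m ∈ Finset.univ) => (hΓ i j m).mul (h0.bd m.succ)
  have a2 := (((h0.bd 0).ofReal_bb i).const_mul I).mul (h0.bd j.succ)
  refine (a1.add a2).mono ?_
  simp only [Fin.sum_univ_two, Complex.norm_I, one_mul]
  nlinarith [mul_nonneg (sub_nonneg.2 hK) (sq_nonneg m0),
    mul_nonneg (mul_nonneg (by linarith : 0 ≤ K) (by linarith : 0 ≤ m0)) (sub_nonneg.2 h1)]

lemma Bd_qf_high (hK : 1 ≤ K) (hΓ : ∀ i j m, Bd (s + 1) (Φ.Γ i j m) K) (h1 : 1 ≤ m0)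
    (h01 : m0 ≤ m1) (h0 : Nb s v m0) (h2 : Nb (s + 1) v m1) (i j : Fin 2) :
    Bd (s + 1) (Φ.qf v i j) (4 * K * (m0 * m1)) := by
  have a1 := Bd.sum Finset.univ fun m (_ : m ∈ Finset.univ) => (hΓ i j m).mul (h2.bd m.succ)
  have a2 := (((h0.bd 0).ofReal_bb i).const_mul I).mul_tame (h0.bd j.succ)
    (((h2.bd 0).ofReal_bb i).const_mul I) (h2.bd j.succ)
  refine (a1.add a2).mono ?_
  simp only [Fin.sum_univ_two, Complex.norm_I, one_mul]
  have b1 : 0 ≤ m0 * m1 := mul_nonneg (by linarith) (by linarith)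
  nlinarith [mul_nonneg (sub_nonneg.2 hK) b1,
    mul_nonneg (mul_nonneg (by linarith : 0 ≤ K) (by linarith : 0 ≤ m1)) (sub_nonneg.2 h1)]

lemma Bd_pf (hK : 1 ≤ K) (hΓ : ∀ i j m, Bd s (Φ.Γ i j m) K) (h1 : 1 ≤ m0)
    (h01 : m0 ≤ m1) (h0 : Nb s v m0) (h2 : Nb (s + 1) v m1) (i j : Fin 2) :
    Bd s (Φ.pf v i j) (10 * K * (m0 * m1)) := by
  have a1 := Bd_dc (h2.bd j.succ) (h2.reg.summable j.succ) i
  have a2 := Bd_qf_low hK hΓ h1 h0 i j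
  refine (a1.add a2).mono ?_
  have b1 : m0 ^ 2 ≤ m0 * m1 := by nlinarith
  have b2 : m1 ≤ m0 * m1 := by nlinarith
  have b3 : m0 * m1 ≤ K * (m0 * m1) := by nlinarith
  have b4 : 2 * Real.pi * m1 ≤ 7 * m1 := by nlinarith [Real.pi_lt_d2]
  have b5 : K * m0 ^ 2 ≤ K * (m0 * m1) := mul_le_mul_of_nonneg_left b1 (by linarith)
  linarith

lemma Bd_Hf (hα : 0 < α) (hβ : 0 < β) (hK : 1 ≤ K) (hΓ : ∀ i j m, Bd s (Φ.Γ i j m) K)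
    (hs : ∀ j l, Bd s (fun x => (starRingEnd ℂ) (Φ.s j x) * Φ.s l x) K) (h1 : 1 ≤ m0)
    (h01 : m0 ≤ m1) (h0 : Nb s v m0) (h2 : Nb (s + 1) v m1) (j : Fin 2) :
    Bd s (Φ.Hf α β v j) ((60 * K ^ 2 + 2 * α * K + 2 * β) * (m0 ^ 2 * m1)) := by
  have hp := Bd_pf hK hΓ h1 h01 h0 h2
  have a1 := Bd.sum Finset.univ fun i (_ : i ∈ Finset.univ) =>
    Bd.sum Finset.univ fun l (_ : l ∈ Finset.univ) => (hΓ i l j).conj.mul (hp i l)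
  have a2 := Bd.sum Finset.univ fun i (_ : i ∈ Finset.univ) =>
    (((h0.bd 0).ofReal_bb i).const_mul (-I)).mul (hp i j)
  have a3 := (Bd.sum Finset.univ fun l (_ : l ∈ Finset.univ) =>
    (hs j l).mul (h0.bd l.succ)).const_mul (α : ℂ)
  have a4 := ((Bd.sum Finset.univ fun (l : Fin 2) (_ : l ∈ Finset.univ) =>
    (h0.bd l.succ).conj.mul (h0.bd l.succ)).mul (h0.bd j.succ)).const_mul (β : ℂ)
  have a5 := ((a1.add a2).add a3.neg).add a4
  refine (a5.congr fun x => ?_).mono ?_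
  · simp only [Hf, sub_eq_add_neg]
    rfl
  · simp only [Fin.sum_univ_two, norm_neg, Complex.norm_I, one_mul, Complex.norm_real,
      Real.norm_eq_abs, abs_of_pos hα, abs_of_pos hβ]
    have b0 : 1 ≤ m0 * m1 := by nlinarith
    have b1 : m0 * m1 ≤ m0 ^ 2 * m1 := by nlinarith
    have b2 : m0 ^ 3 ≤ m0 ^ 2 * m1 := by nlinarith [sq_nonneg m0]
    have b3 : m0 ≤ m0 ^ 2 * m1 := by nlinarith
    have b4 : K ^ 2 * (m0 * m1) ≤ K ^ 2 * (m0 ^ 2 * m1) :=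
      mul_le_mul_of_nonneg_left b1 (sq_nonneg K)
    have b5 : K * (m0 ^ 2 * m1) ≤ K ^ 2 * (m0 ^ 2 * m1) :=
      mul_le_mul_of_nonneg_right (by nlinarith) (by linarith)
    have b6 : α * (K * m0) ≤ α * (K * (m0 ^ 2 * m1)) :=
      mul_le_mul_of_nonneg_left (mul_le_mul_of_nonneg_left b3 (by linarith)) hα.le
    have b7 : β * m0 ^ 3 ≤ β * (m0 ^ 2 * m1) := mul_le_mul_of_nonneg_left b2 hβ.le
    linarith

lemma Bd_Jf (hK : 1 ≤ K) (hΓ : ∀ i j m, Bd s (Φ.Γ i j m) K) (h1 : 1 ≤ m0)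
    (h01 : m0 ≤ m1) (h0 : Nb s v m0) (h2 : Nb (s + 1) v m1) :
    Bd s (Φ.Jf v) (40 * K * (m0 ^ 2 * m1)) := by
  have hp := Bd_pf hK hΓ h1 h01 h0 h2
  have a1 := fun i => (Bd.sum Finset.univ fun l (_ : l ∈ Finset.univ) =>
    (hp i l).conj.mul ((h0.bd l.succ).const_mul I)).ofReal_re
  have a2 := (a1 0).add ((a1 1).const_mul I)
  refine (a2.congr fun x => ?_).mono ?_
  · simp only [Jf, Jc, Complex.re_sum]
    rfl
  · simp only [Fin.sum_univ_two, Complex.norm_I, one_mul]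
    nlinarith

/-- The elliptic estimate for solutions of the coefficient inequalities. -/
lemma elliptic (Φ : Frame) (hα : 0 < α) (hβ : 0 < β) (s : ℕ) : ∃ C : ℝ, 0 < C ∧
    ∀ (v : St) (m0 m1 : ℝ), ModeIneq Φ α β v → 1 ≤ m0 → m0 ≤ m1 → Nb s v m0 → Nb (s + 1) v m1 →
      Nb (s + 2) v (C * (m0 ^ 2 * m1)) := by
  obtain ⟨K, hK, hΓ, hs⟩ := Φ.exists_bound (s + 1)
  have hΓ' := fun i j m => (hΓ i j m).anti (Nat.le_succ s)
  have hs' := fun j l => (hs j l).anti (Nat.le_succ s)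
  set C := 1 + 56 * K + (60 * K ^ 2 + 2 * α * K + 2 * β) + 40 * K with hC
  have hKp : 0 < K := by linarith
  refine ⟨C, by positivity, fun v m0 m1 hv h1 h01 h0 h2 => ?_⟩
  have hq := Bd_qf_high hK hΓ h1 h01 h0 h2
  have hH := Bd_Hf hα hβ hK hΓ' hs' h1 h01 h0 h2
  have hJ := Bd_Jf hK hΓ' h1 h01 h0 h2
  have hjp : ∀ k, 0 ≤ jp k ^ s := fun k => pow_nonneg (jp_pos k).le s
  have b0 : 1 ≤ m0 * m1 := by nlinarith
  have b1 : m0 * m1 ≤ m0 ^ 2 * m1 := by nlinarith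
  have b3 : m0 ≤ m0 ^ 2 * m1 := by nlinarith
  have hB : 0 ≤ m0 ^ 2 * m1 := by linarith
  have key : ∀ (n : Fin 3) (a : ℤ × ℤ → ℝ), Summable a → ∑' k, a k ≤ (C - 1) * (m0 ^ 2 * m1) →
      (∀ k, 0 ≤ a k) →
      (∀ k, jp k ^ s * (4 * Real.pi ^ 2 * ((k.1 : ℝ) ^ 2 + (k.2 : ℝ) ^ 2) * ‖v n k‖) ≤ a k) →
      (Summable fun k => jp k ^ (s + 2) * ‖v n k‖) ∧
        ∑' k, jp k ^ (s + 2) * ‖v n k‖ ≤ C * (m0 ^ 2 * m1) := by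
    intro n a ha hsum ha0 hle
    have hle' : ∀ k, jp k ^ (s + 2) * ‖v n k‖ ≤ jp k ^ s * ‖v n k‖ + a k := by
      intro k
      rcases eq_or_ne k 0 with rfl | hk
      · rw [jp_zero, one_pow, one_pow]
        linarith [ha0 0]
      · have h5 := mul_le_mul_of_nonneg_left (mul_le_mul_of_nonneg_right (four_pi_sq_jp hk)
          (norm_nonneg (v n k))) (hjp k)
        have h6 := weight_nonneg s (v n) k
        calc jp k ^ (s + 2) * ‖v n k‖ = jp k ^ s * (jp k ^ 2 * ‖v n k‖) := by ring
          _ ≤ _ := h5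
          _ ≤ a k := hle k
          _ ≤ _ := by linarith
    have hadd := (h0 n).1.add ha
    have hsm := Summable.of_nonneg_of_le (weight_nonneg (s + 2) (v n)) hle' hadd
    refine ⟨hsm, (hsm.tsum_le_tsum hle' hadd).trans ?_⟩
    rw [(h0 n).1.tsum_add ha]
    linarith [(h0 n).2]
  intro n
  refine Fin.cases ?_ (fun j => ?_) n
  · refine key 0 _ hJ.1.1 ?_ (weight_nonneg _ _) fun k => mul_le_mul_of_nonneg_left (hv.w k) (hjp k)
    refine hJ.2.trans (mul_le_mul_of_nonneg_right ?_ hB)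
    have : 0 < α * K := by positivity
    nlinarith
  · have hab := fun (k : ℤ × ℤ) => abs_fst_le_jp k
    refine key j.succ (fun k => 2 * Real.pi * (jp k ^ (s + 1) * ‖coef (Φ.qf v 0 j) k‖)
      + 2 * Real.pi * (jp k ^ (s + 1) * ‖coef (Φ.qf v 1 j) k‖)
      + jp k ^ s * ‖coef (Φ.Hf α β v j) k‖) ?_ ?_ (fun k => ?_) fun k => ?_
    · exact (((hq 0 j).1.1.mul_left _).add ((hq 1 j).1.1.mul_left _)).add (hH j).1.1
    · rw [(((hq 0 j).1.1.mul_left _).add ((hq 1 j).1.1.mul_left _)).tsum_add (hH j).1.1,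
        ((hq 0 j).1.1.mul_left _).tsum_add ((hq 1 j).1.1.mul_left _), tsum_mul_left, tsum_mul_left]
      have c0 := (hq 0 j).2
      have c1 := (hq 1 j).2
      have c2 := (hH j).2
      unfold An at c0 c1 c2
      have hpi : 2 * Real.pi ≤ 7 := by linarith [Real.pi_lt_d2]
      have hpi0 := Real.pi_pos
      have d0 := mul_le_mul hpi c0 (An_nonneg (s + 1) (Φ.qf v 0 j)) (by norm_num)
      have d1 := mul_le_mul hpi c1 (An_nonneg (s + 1) (Φ.qf v 1 j)) (by norm_num)
      have d2 := mul_le_mul_of_nonneg_left b1 hKp.le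
      have d3 : 0 ≤ K * (m0 ^ 2 * m1) := by positivity
      have d4 : (C - 1) * (m0 ^ 2 * m1) = 56 * (K * (m0 ^ 2 * m1)) +
        (60 * K ^ 2 + 2 * α * K + 2 * β) * (m0 ^ 2 * m1) + 40 * (K * (m0 ^ 2 * m1)) := by
          rw [hC]; ring
      rw [d4]
      linarith
    · have := Real.pi_pos
      have := jp_pos k
      positivity
    · have hpi0 := Real.pi_pos
      refine (mul_le_mul_of_nonneg_left (hv.u j k) (hjp k)).trans ?_
      have f1 := mul_le_mul_of_nonneg_left (mul_le_mul_of_nonneg_right (abs_fst_le_jp k)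
        (norm_nonneg (coef (Φ.qf v 0 j) k))) (hjp k)
      have f2 := mul_le_mul_of_nonneg_left (mul_le_mul_of_nonneg_right (abs_snd_le_jp k)
        (norm_nonneg (coef (Φ.qf v 1 j) k))) (hjp k)
      have g1 := mul_le_mul_of_nonneg_left f1 (by positivity : 0 ≤ 2 * Real.pi)
      have g2 := mul_le_mul_of_nonneg_left f2 (by positivity : 0 ≤ 2 * Real.pi)
      rw [pow_succ]
      linarith

end Frame

/-- Interpolation between a weighted `ℓ²` bound and a weighted `ℓ¹` bound. -/
lemma exists_interpolation : ∃ Z : ℝ, 0 ≤ Z ∧ ∀ (c : ℤ × ℤ → ℂ) (T N μ : ℝ), 1 ≤ T → 0 < μ →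
    (Summable fun k => jp k ^ 2 * ‖c k‖) → ∑' k, jp k ^ 2 * ‖c k‖ ≤ T ^ 24 →
    (Summable fun k => jp k ^ 2 * ‖c k‖ ^ 2) → ∑' k, jp k ^ 2 * ‖c k‖ ^ 2 ≤ N →
    ∑' k, ‖c k‖ ≤ μ * N + T ^ 2 / μ * Z + 1 := by
  have hZ := summable_jp_rpow (p := 13 / 6) (by norm_num)
  refine ⟨∑' k, jp k ^ (-(13 / 6 : ℝ)), tsum_nonneg fun k => Real.rpow_nonneg (jp_pos k).le _,
    fun c T N μ hT hμ h1 h1' h2 h2' => ?_⟩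
  have hT0 : 0 < T := by linarith
  have hle : ∀ k, ‖c k‖ ≤ μ * (jp k ^ 2 * ‖c k‖ ^ 2) + T ^ 2 / μ * jp k ^ (-(13 / 6 : ℝ))
      + (T ^ 24)⁻¹ * (jp k ^ 2 * ‖c k‖) := by
    intro k
    have hj := jp_pos k
    have n0 : 0 ≤ μ * (jp k ^ 2 * ‖c k‖ ^ 2) := by positivity
    have n1 : 0 ≤ T ^ 2 / μ * jp k ^ (-(13 / 6 : ℝ)) := by
      have := Real.rpow_nonneg hj.le (-(13 / 6 : ℝ)); positivity
    have n2 : 0 ≤ (T ^ 24)⁻¹ * (jp k ^ 2 * ‖c k‖) := by positivity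
    rcases le_total (T ^ 12) (jp k) with h | h
    · have h3 : T ^ 24 ≤ jp k ^ 2 := by
        calc T ^ 24 = (T ^ 12) ^ 2 := by ring
          _ ≤ jp k ^ 2 := pow_le_pow_left₀ (by positivity) h 2
      have h4 : ‖c k‖ ≤ (T ^ 24)⁻¹ * (jp k ^ 2 * ‖c k‖) := by
        rw [← mul_assoc]
        refine le_mul_of_one_le_left (norm_nonneg _) ?_
        rwa [inv_mul_eq_div, one_le_div (by positivity)]
      linarith
    · have h3 : jp k ^ (1 / 6 : ℝ) ≤ T ^ 2 := by
        calc jp k ^ (1 / 6 : ℝ) ≤ (T ^ 12) ^ (1 / 6 : ℝ) :=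
              Real.rpow_le_rpow hj.le h (by norm_num)
          _ = T ^ 2 := by
            rw [← Real.rpow_natCast, ← Real.rpow_mul hT0.le, ← Real.rpow_natCast]
            norm_num
      have h4 : (jp k ^ 2)⁻¹ ≤ T ^ 2 * jp k ^ (-(13 / 6 : ℝ)) := by
        calc (jp k ^ 2)⁻¹ = jp k ^ (1 / 6 : ℝ) * jp k ^ (-(13 / 6 : ℝ)) := by
              rw [← Real.rpow_add hj, ← Real.rpow_natCast, ← Real.rpow_neg hj.le]
              norm_num
          _ ≤ _ := mul_le_mul_of_nonneg_right h3 (Real.rpow_nonneg hj.le _)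
      have h5 : (μ * jp k ^ 2)⁻¹ ≤ T ^ 2 / μ * jp k ^ (-(13 / 6 : ℝ)) := by
        calc (μ * jp k ^ 2)⁻¹ = (jp k ^ 2)⁻¹ / μ := by rw [mul_inv]; ring
          _ ≤ T ^ 2 * jp k ^ (-(13 / 6 : ℝ)) / μ := by gcongr
          _ = _ := by ring
      have h6 : ‖c k‖ ≤ μ * (jp k ^ 2 * ‖c k‖ ^ 2) + (μ * jp k ^ 2)⁻¹ := by
        have hA : 0 < μ * jp k ^ 2 := by positivity
        rcases le_total ‖c k‖ (μ * jp k ^ 2)⁻¹ with h7 | h7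
        · linarith
        · have h8 : 1 ≤ μ * jp k ^ 2 * ‖c k‖ := by
            rw [← mul_inv_cancel₀ hA.ne']
            exact mul_le_mul_of_nonneg_left h7 hA.le
          have h9 := mul_le_mul_of_nonneg_right h8 (norm_nonneg (c k))
          have h10 : 0 < (μ * jp k ^ 2)⁻¹ := inv_pos.2 hA
          linarith
      linarith
  have i1 := h2.mul_left μ
  have i2 := hZ.mul_left (T ^ 2 / μ)
  have i3 := h1.mul_left (T ^ 24)⁻¹
  have h := (summable_norm_of_weight h1).tsum_le_tsum hle ((i1.add i2).add i3)
  rw [(i1.add i2).tsum_add i3, i1.tsum_add i2, tsum_mul_left, tsum_mul_left, tsum_mul_left] at h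
  have h3 : (T ^ 24)⁻¹ * ∑' k, jp k ^ 2 * ‖c k‖ ≤ 1 := by
    rw [inv_mul_eq_div]
    exact (div_le_one (by positivity)).2 h1'
  have h4 := mul_le_mul_of_nonneg_left h2' hμ.le
  linarith

namespace Frame

variable {Φ : Frame} {α β : ℝ} {v : St}

lemma norm_sec_sq_le (Φ : Frame) (x : ℝ × ℝ) (W : Fin 3 → ℂ) :
    ‖Φ.sec x W‖ ^ 2 ≤ ∑ j : Fin 2, ‖W j.succ‖ ^ 2 := by
  have h := norm_add_le (Φ.s 0 x * W (Fin.succ 0)) (Φ.s 1 x * W (Fin.succ 1))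
  rw [norm_mul, norm_mul] at h
  have h1 := Φ.unit_s x
  simp only [sec, Fin.sum_univ_two]
  refine (pow_le_pow_left₀ (norm_nonneg _) h 2).trans ?_
  set a := ‖Φ.s 0 x‖
  set b := ‖Φ.s 1 x‖
  set c := ‖W (Fin.succ 0)‖
  set d := ‖W (Fin.succ 1)‖
  calc (a * c + b * d) ^ 2 ≤ (a ^ 2 + b ^ 2) * (c ^ 2 + d ^ 2) := by
        nlinarith [sq_nonneg (a * d - b * c)]
    _ = c ^ 2 + d ^ 2 := by rw [h1, one_mul]

lemma dens_lower (Φ : Frame) (hα : 0 < α) (hβ : 0 < β) (x : ℝ × ℝ) (W : Fin 3 → ℂ)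
    (DW : Fin 2 → Fin 3 → ℂ) :
    ‖DW 0 0 - I * DW 1 0‖ ^ 2 + ∑ i, ∑ j, ‖Φ.nab x W DW i j‖ ^ 2 + ∑ j : Fin 2, ‖W j.succ‖ ^ 2 ≤
      Φ.dens α β x W DW + (α + 1) ^ 2 / (2 * β) := by
  have h1 := mul_le_mul_of_nonneg_left (Φ.norm_sec_sq_le x W) hα.le
  unfold dens
  set t := ∑ j : Fin 2, ‖W j.succ‖ ^ 2
  have h2 : (α + 1) * t ≤ β / 2 * t ^ 2 + (α + 1) ^ 2 / (2 * β) := by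
    have h3 : β / 2 * t ^ 2 + (α + 1) ^ 2 / (2 * β) - (α + 1) * t =
        (β * t - (α + 1)) ^ 2 / (2 * β) := by
      field_simp
      ring
    have h4 : 0 ≤ (β * t - (α + 1)) ^ 2 / (2 * β) := by positivity
    linarith
  linarith

lemma integral_le_of_le_dens (hv : Reg 1 v) (hG : Φ.G α β v ≤ 0) {f : ℝ × ℝ → ℝ}
    (hf : Continuous f) {E : ℝ} (hle : ∀ x, f x ≤ Φ.dens α β x (val v x) (dval v x) + E) :
    ∫ x in unitSquare, f x ≤ E := by
  have hd := integrable_sq (Φ.continuous_dens α β hv.continuous_val hv.continuous_dval)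
  have h := integral_mono (integrable_sq hf) (hd.add (integrable_const E)) hle
  have h2 : ∫ x in unitSquare, (Φ.dens α β x (val v x) (dval v x) + E) =
      (∫ x in unitSquare, Φ.dens α β x (val v x) (dval v x)) + E := by
    rw [integral_add hd (integrable_const E)]
    simp
  have h3 : ∫ x in unitSquare, Φ.dens α β x (val v x) (dval v x) ≤ 0 := by
    unfold G at hG
    linarith
  exact (h.trans h2.le).trans (by linarith)

lemma sum_le_of_norm_le {c d1 d2 : ℤ × ℤ → ℂ} {A B0 B1 : ℝ}
    (hd1 : HasSum (fun k => ‖d1 k‖ ^ 2) B0) (hd2 : HasSum (fun k => ‖d2 k‖ ^ 2) B1)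
    (hd : ∀ k, ‖d1 k‖ ^ 2 + ‖d2 k‖ ^ 2 =
      4 * Real.pi ^ 2 * ((k.1 : ℝ) ^ 2 + (k.2 : ℝ) ^ 2) * ‖c k‖ ^ 2)
    (h0 : ‖c 0‖ ^ 2 ≤ A) :
    (Summable fun k => jp k ^ 2 * ‖c k‖ ^ 2) ∧ ∑' k, jp k ^ 2 * ‖c k‖ ^ 2 ≤ A + B0 + B1 := by
  have hle : ∀ k, jp k ^ 2 * ‖c k‖ ^ 2 ≤
      (if k = 0 then A else 0) + (‖d1 k‖ ^ 2 + ‖d2 k‖ ^ 2) := by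
    intro k
    split_ifs with hk
    · rw [hk, jp_zero, one_pow, one_mul]
      nlinarith [sq_nonneg ‖d1 0‖, sq_nonneg ‖d2 0‖]
    · rw [hd, zero_add]
      exact mul_le_mul_of_nonneg_right (four_pi_sq_jp hk) (sq_nonneg _)
  have hs := (hasSum_ite_eq (0 : ℤ × ℤ) A).add (hd1.add hd2)
  have hsm := Summable.of_nonneg_of_le (fun k => by positivity) hle hs.summable
  refine ⟨hsm, (hsm.tsum_le_tsum hle hs.summable).trans ?_⟩
  rw [hs.tsum_eq]
  linarith

lemma w_sq_bound (hα : 0 < α) (hβ : 0 < β) (hv : Reg 1 v) (hG : Φ.G α β v ≤ 0)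
    (h0 : ‖v 0 0‖ ≤ 2 * Real.pi) :
    (Summable fun k => jp k ^ 2 * ‖v 0 k‖ ^ 2) ∧
      ∑' k, jp k ^ 2 * ‖v 0 k‖ ^ 2 ≤ (2 * Real.pi) ^ 2 + (α + 1) ^ 2 / (2 * β) := by
  have hd : ∀ i, Summable fun k => ‖dc i (v 0) k‖ := fun i =>
    summable_norm_of_weight (summable_dc (s := 0) (hv 0) i)
  have hc : Summable fun k => ‖dc 0 (v 0) k + -I * dc 1 (v 0) k‖ :=
    Summable.of_nonneg_of_le (fun _ => norm_nonneg _)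
      (fun k => (norm_add_le _ _).trans (by rw [norm_mul]; simp)) ((hd 0).add (hd 1))
  have hp := parseval hc
  have hi : ∫ x in unitSquare, ‖S (fun k => dc 0 (v 0) k + -I * dc 1 (v 0) k) x‖ ^ 2 ≤
      (α + 1) ^ 2 / (2 * β) := by
    refine integral_le_of_le_dens hv hG ((continuous_S hc).norm.pow 2) fun x => ?_
    refine le_trans ?_ (Φ.dens_lower hα hβ x (val v x) (dval v x))
    rw [Pi.pow_apply, S_add_mul (hd 0) (hd 1)]
    have e1 : S (dc 0 (v 0)) x + -I * S (dc 1 (v 0)) x = dval v x 0 0 - I * dval v x 1 0 := by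
      unfold dval; ring
    rw [e1]
    have h1 : 0 ≤ ∑ i, ∑ j, ‖Φ.nab x (val v x) (dval v x) i j‖ ^ 2 :=
      Finset.sum_nonneg fun _ _ => Finset.sum_nonneg fun _ _ => sq_nonneg _
    have h2 : 0 ≤ ∑ j : Fin 2, ‖val v x j.succ‖ ^ 2 := Finset.sum_nonneg fun _ _ => sq_nonneg _
    linarith
  have h := sum_le_of_norm_le (c := v 0) (A := (2 * Real.pi) ^ 2) (B1 := 0) (d2 := fun _ => 0) hp
    (by simp) (fun k => ?_)
    (pow_le_pow_left₀ (norm_nonneg _) h0 2)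
  · exact ⟨h.1, h.2.trans (by linarith)⟩
  · have e1 : dc 0 (v 0) k + -I * dc 1 (v 0) k = (2 * Real.pi * I * (k.1 - I * k.2)) * v 0 k := by
      unfold dc fr
      simp
      ring
    rw [e1, norm_mul, mul_pow, norm_sq_eq (2 * Real.pi * I * (k.1 - I * k.2)), norm_zero, zero_pow two_ne_zero, add_zero]
    congr 1
    simp
    ring

lemma norm_bb_le (i : Fin 2) (z : ℂ) : ‖((bb i z : ℝ) : ℂ)‖ ≤ ‖z‖ := by
  rw [Complex.norm_real, Real.norm_eq_abs]
  unfold bb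
  split_ifs
  exacts [Complex.abs_re_le_norm z, Complex.abs_im_le_norm z]

lemma norm_q_sq_le (Φ : Frame) {K M : ℝ} (x : ℝ × ℝ) (W : Fin 3 → ℂ)
    (hΓ : ∀ i j m, ‖Φ.Γ i j m x‖ ≤ K) (hM : ‖W 0‖ ≤ M) (i j : Fin 2) :
    ‖Φ.q x W i j‖ ^ 2 ≤ 2 * (K + M) ^ 2 * ∑ j : Fin 2, ‖W j.succ‖ ^ 2 := by
  have hM0 := (norm_nonneg _).trans hM
  have h1 : ‖Φ.q x W i j‖ ≤ K * ‖W (Fin.succ 0)‖ + K * ‖W (Fin.succ 1)‖ + M * ‖W j.succ‖ := by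
    unfold q
    rw [Fin.sum_univ_two]
    refine (norm_add_le _ _).trans (add_le_add ((norm_add_le _ _).trans (add_le_add ?_ ?_)) ?_)
    · rw [norm_mul]; exact mul_le_mul_of_nonneg_right (hΓ _ _ _) (norm_nonneg _)
    · rw [norm_mul]; exact mul_le_mul_of_nonneg_right (hΓ _ _ _) (norm_nonneg _)
    · rw [norm_mul, norm_mul, Complex.norm_I, one_mul]
      exact mul_le_mul_of_nonneg_right ((norm_bb_le _ _).trans hM) (norm_nonneg _)
  rw [Fin.sum_univ_two]
  have ha := norm_nonneg (W (Fin.succ 0))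
  have hb := norm_nonneg (W (Fin.succ 1))
  have hj : ‖W j.succ‖ ≤ ‖W (Fin.succ 0)‖ + ‖W (Fin.succ 1)‖ := by
    fin_cases j
    exacts [le_add_of_nonneg_right hb, le_add_of_nonneg_left ha]
  set a := ‖W (Fin.succ 0)‖
  set b := ‖W (Fin.succ 1)‖
  have h2 : ‖Φ.q x W i j‖ ≤ (K + M) * (a + b) := by
    nlinarith [mul_le_mul_of_nonneg_left hj hM0]
  calc ‖Φ.q x W i j‖ ^ 2 ≤ ((K + M) * (a + b)) ^ 2 := pow_le_pow_left₀ (norm_nonneg _) h2 2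
    _ ≤ 2 * (K + M) ^ 2 * (a ^ 2 + b ^ 2) := by
      nlinarith [mul_nonneg (sq_nonneg (K + M)) (sq_nonneg (a - b))]

lemma u_sq_bound (hα : 0 < α) (hβ : 0 < β) (hv : Reg 1 v) (hG : Φ.G α β v ≤ 0) {K M : ℝ}
    (hK : 1 ≤ K) (hΓ : ∀ i j m x, ‖Φ.Γ i j m x‖ ≤ K) (hM : ∀ x, ‖val v x 0‖ ≤ M) (j : Fin 2) :
    (Summable fun k => jp k ^ 2 * ‖v j.succ k‖ ^ 2) ∧
      ∑' k, jp k ^ 2 * ‖v j.succ k‖ ^ 2 ≤ 13 * (K + M) ^ 2 * ((α + 1) ^ 2 / (2 * β)) := by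
  set E := (α + 1) ^ 2 / (2 * β) with hE
  have hE0 : 0 ≤ E := by positivity
  have hM0 : 0 ≤ M := (norm_nonneg _).trans (hM 0)
  have low := fun x => Φ.dens_lower hα hβ x (val v x) (dval v x)
  have hz : ∀ x, 0 ≤ ‖dval v x 0 0 - I * dval v x 1 0‖ ^ 2 := fun x => sq_nonneg _
  have hu : ∀ x, 0 ≤ ∑ j : Fin 2, ‖val v x j.succ‖ ^ 2 := fun x =>
    Finset.sum_nonneg fun _ _ => sq_nonneg _
  have hn : ∀ x, 0 ≤ ∑ i, ∑ j, ‖Φ.nab x (val v x) (dval v x) i j‖ ^ 2 := fun x =>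
    Finset.sum_nonneg fun _ _ => Finset.sum_nonneg fun _ _ => sq_nonneg _
  have hcv := hv.continuous_val
  have i1 : ∫ x in unitSquare, ∑ j : Fin 2, ‖val v x j.succ‖ ^ 2 ≤ E :=
    integral_le_of_le_dens hv hG (by fun_prop) fun x => by linarith [low x, hz x, hn x]
  have i2 : ∫ x in unitSquare, ‖val v x j.succ‖ ^ 2 ≤ E :=
    integral_le_of_le_dens hv hG (by fun_prop) fun x => by
      have := Finset.single_le_sum (f := fun j : Fin 2 => ‖val v x j.succ‖ ^ 2)
        (fun _ _ => sq_nonneg _) (Finset.mem_univ j)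
      linarith [low x, hz x, hn x]
  have i3 : ∀ i, ∫ x in unitSquare, ‖Φ.pf v i j x‖ ^ 2 ≤ E := fun i =>
    integral_le_of_le_dens hv hG ((continuous_pf hv i j).norm.pow 2) fun x => by
      have h1 := Finset.single_le_sum (f := fun j => ‖Φ.nab x (val v x) (dval v x) i j‖ ^ 2)
        (fun _ _ => sq_nonneg _) (Finset.mem_univ j)
      have h2 := Finset.single_le_sum
        (f := fun i => ∑ j, ‖Φ.nab x (val v x) (dval v x) i j‖ ^ 2)
        (fun _ _ => Finset.sum_nonneg fun _ _ => sq_nonneg _) (Finset.mem_univ i)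
      have h3 : ‖Φ.pf v i j x‖ ^ 2 ≤ ∑ i, ∑ j, ‖Φ.nab x (val v x) (dval v x) i j‖ ^ 2 :=
        h1.trans h2
      rw [Pi.pow_apply]
      linarith [low x, hz x, hu x]
  have hKM : 1 ≤ (K + M) ^ 2 := one_le_pow₀ (by linarith)
  have i4 : ∀ i, ∫ x in unitSquare, ‖dval v x i j.succ‖ ^ 2 ≤ 6 * (K + M) ^ 2 * E := by
    intro i
    have cp := (continuous_pf (Φ := Φ) hv i j).norm.pow 2
    have j1 := (integrable_sq cp).const_mul 2
    have j2 : Integrable (fun x => 4 * (K + M) ^ 2 * ∑ j : Fin 2, ‖val v x j.succ‖ ^ 2)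
      (volume.restrict unitSquare) := (integrable_sq (by fun_prop)).const_mul _
    have h := integral_mono (integrable_sq ((hv.continuous_dval i j.succ).norm.pow 2))
      (j1.add j2) fun x => by
        have h1 := Φ.norm_q_sq_le x (val v x) (fun i j m => hΓ i j m x) (hM x) i j
        have h2 : dval v x i j.succ = Φ.pf v i j x - Φ.q x (val v x) i j := by
          simp only [pf, nab]; ring
        have h3 : ‖dval v x i j.succ‖ ≤ ‖Φ.pf v i j x‖ + ‖Φ.q x (val v x) i j‖ := by
          rw [h2]; exact norm_sub_le _ _
        have h4 := pow_le_pow_left₀ (norm_nonneg _) h3 2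
        simp only [Pi.add_apply, Pi.pow_apply]
        nlinarith [sq_nonneg (‖Φ.pf v i j x‖ - ‖Φ.q x (val v x) i j‖)]
    rw [integral_add' j1 j2, integral_const_mul, integral_const_mul] at h
    have h5 := mul_le_mul_of_nonneg_left i1 (by positivity : 0 ≤ 4 * (K + M) ^ 2)
    have h6 := mul_le_mul_of_nonneg_right hKM hE0
    have h7 := i3 i
    simp only [Pi.pow_apply] at h
    linarith
  have hd : ∀ i, Summable fun k => ‖dc i (v j.succ) k‖ := fun i =>
    summable_norm_of_weight (summable_dc (s := 0) (hv j.succ) i)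
  have hp := parseval (hv.summable j.succ)
  have h0 : ‖v j.succ 0‖ ^ 2 ≤ E :=
    (hp.summable.le_tsum 0 fun _ _ => sq_nonneg _).trans (by rw [hp.tsum_eq]; exact i2)
  have h := sum_le_of_norm_le (c := v j.succ) (parseval (hd 0)) (parseval (hd 1)) (fun k => ?_) h0
  · refine ⟨h.1, h.2.trans ?_⟩
    have := i4 0
    have := i4 1
    have h6 := mul_le_mul_of_nonneg_right hKM hE0
    unfold dval at *
    linarith
  · rw [dc_zero, dc_one, norm_dc1, norm_dc2]
    simp only [mul_pow, sq_abs]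
    ring

end Frame

lemma Nb.zero_one {v : St} {T C : ℝ} (hT : 1 ≤ T) (hC : 1 ≤ C) (h0 : Nb 0 v (C * T ^ 2))
    (h2 : Nb 2 v (T ^ 24)) : Nb 1 v (2 * C * T ^ 13) := by
  intro n
  have hT0 : 0 < T := by linarith
  have hsm := h2.reg.mono (t := 1) (by norm_num) n
  refine ⟨hsm, ?_⟩
  have hle : ∀ k, jp k ^ 1 * ‖v n k‖ ≤ T ^ 11 * (jp k ^ 0 * ‖v n k‖)
      + (T ^ 11)⁻¹ * (jp k ^ 2 * ‖v n k‖) := by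
    intro k
    have h : jp k ≤ T ^ 11 + (T ^ 11)⁻¹ * jp k ^ 2 := by
      have hp : 0 < T ^ 11 := by positivity
      rw [← sub_nonneg]
      have e1 : T ^ 11 + (T ^ 11)⁻¹ * jp k ^ 2 - jp k =
          (T ^ 11)⁻¹ * ((T ^ 11 - jp k) ^ 2 + T ^ 11 * jp k) := by
        field_simp
        ring
      rw [e1]
      have := jp_pos k
      positivity
    have h3 := mul_le_mul_of_nonneg_right h (norm_nonneg (v n k))
    linarith
  have i1 := (h0 n).1.mul_left (T ^ 11)
  have i2 := (h2 n).1.mul_left (T ^ 11)⁻¹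
  refine (hsm.tsum_le_tsum hle (i1.add i2)).trans ?_
  rw [i1.tsum_add i2, tsum_mul_left, tsum_mul_left]
  have j1 := mul_le_mul_of_nonneg_left (h0 n).2 (by positivity : 0 ≤ T ^ 11)
  have j2 := mul_le_mul_of_nonneg_left (h2 n).2 (by positivity : 0 ≤ (T ^ 11)⁻¹)
  have e2 : (T ^ 11)⁻¹ * T ^ 24 = T ^ 13 := by
    field_simp
  have j3 := mul_le_mul_of_nonneg_right hC (by positivity : 0 ≤ T ^ 13)
  rw [e2] at j2
  nlinarith

namespace Frame

variable (Φ : Frame) {α β : ℝ}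

lemma exists_low_bound (hα : 0 < α) (hβ : 0 < β) : ∃ C : ℝ, 1 ≤ C ∧ ∀ (v : St) (T : ℝ), 1 ≤ T →
    Nb 2 v (T ^ 24) → Φ.G α β v ≤ 0 → ‖v 0 0‖ ≤ 2 * Real.pi → Nb 0 v (C * T ^ 2) := by
  obtain ⟨Z, hZ, hint⟩ := exists_interpolation
  obtain ⟨K, hK, hΓ, -⟩ := Φ.exists_bound 0
  set E := (α + 1) ^ 2 / (2 * β) with hE
  have hE0 : 0 ≤ E := by positivity
  set M := (2 * Real.pi) ^ 2 + E + Z + 1 with hM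
  have hM0 : 0 ≤ M := by positivity
  refine ⟨13 * (K + M) ^ 2 * E + Z + 1 + M, ?_, fun v T hT h2 hG h0 => ?_⟩
  · have : 0 ≤ 13 * (K + M) ^ 2 * E := by positivity
    linarith
  have hT0 : 0 < T := by linarith
  have hr : Reg 1 v := h2.reg.mono (by norm_num)
  have hw := w_sq_bound hα hβ hr hG h0
  have bw : ∑' k, ‖v 0 k‖ ≤ M * T := by
    refine (hint (v 0) T _ T hT hT0 (h2 0).1 (h2 0).2 hw.1 hw.2).trans ?_
    have : T ^ 2 / T = T := by field_simp
    rw [this]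
    nlinarith
  have hval : ∀ x, ‖val v x 0‖ ≤ M * T := fun x => (norm_S_le (hr.summable 0) x).trans bw
  have hTT : T ≤ T ^ 2 := by nlinarith
  have h1T : 1 ≤ T ^ 2 := by nlinarith
  have bu : ∀ j : Fin 2, ∑' k, ‖v j.succ k‖ ≤ (13 * (K + M) ^ 2 * E + Z + 1) * T ^ 2 := by
    intro j
    have hu := u_sq_bound hα hβ hr hG hK (fun i j m x => (hΓ i j m).norm_le x) hval j
    refine (hint (v j.succ) T _ 1 hT one_pos (h2 _).1 (h2 _).2 hu.1 hu.2).trans ?_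
    have h3 : (K + M * T) ^ 2 ≤ (K + M) ^ 2 * T ^ 2 := by
      rw [← mul_pow]
      exact pow_le_pow_left₀ (by positivity) (by nlinarith) 2
    have h4 := mul_le_mul_of_nonneg_right h3 hE0
    nlinarith
  have hp : 0 ≤ 13 * (K + M) ^ 2 * E + Z + 1 := by positivity
  intro n
  simp only [pow_zero, one_mul]
  refine ⟨hr.summable n, ?_⟩
  refine Fin.cases ?_ (fun j => ?_) n
  · nlinarith [mul_le_mul_of_nonneg_left hTT hM0, mul_nonneg hp (sq_nonneg T)]
  · nlinarith [bu j, mul_nonneg hM0 (sq_nonneg T)]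

lemma apriori_two (hα : 0 < α) (hβ : 0 < β) : ∃ C : ℝ, ∀ v : St, Reg 2 v → ModeIneq Φ α β v →
    Φ.G α β v ≤ 0 → ‖v 0 0‖ ≤ 2 * Real.pi → Nb 2 v C := by
  obtain ⟨C0, hC0, hlow⟩ := Φ.exists_low_bound hα hβ
  obtain ⟨C, hC, hell⟩ := Φ.elliptic hα hβ 0
  set B := 1 + 6 * C * C0 ^ 3 with hB
  refine ⟨B ^ 24, fun v hr hm hG h0 => ?_⟩
  set Y := ∑ n, ∑' k, jp k ^ 2 * ‖v n k‖ with hY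
  have hnn : ∀ n, 0 ≤ ∑' k, jp k ^ 2 * ‖v n k‖ := fun n => tsum_nonneg fun k => by positivity
  have hY0 : 0 ≤ Y := Finset.sum_nonneg fun n _ => hnn n
  set T := (1 + Y) ^ (1 / 24 : ℝ) with hT
  have hT1 : 1 ≤ T := Real.one_le_rpow (by linarith) (by norm_num)
  have hT24 : T ^ 24 = 1 + Y := by
    rw [hT, ← Real.rpow_natCast, ← Real.rpow_mul (by linarith)]
    norm_num
  have hT0 : 0 < T := by linarith
  have h2 : Nb 2 v (T ^ 24) := fun n => ⟨hr n, by
    rw [hT24]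
    have := Finset.single_le_sum (fun n _ => hnn n) (Finset.mem_univ n)
    linarith⟩
  have b0 := hlow v T hT1 h2 hG h0
  have b1 := b0.zero_one hT1 hC0 h2
  have p2 : 1 ≤ T ^ 2 := one_le_pow₀ hT1
  have b2 := hell v _ _ hm (by nlinarith) (by
    have : T ^ 2 ≤ T ^ 13 := pow_le_pow_right₀ hT1 (by norm_num)
    have h3 := mul_le_mul_of_nonneg_left this (by linarith : 0 ≤ C0)
    have : 0 ≤ C0 * T ^ 13 := by positivity
    linarith) b0 b1
  have e1 : C * ((C0 * T ^ 2) ^ 2 * (2 * C0 * T ^ 13)) = 2 * C * C0 ^ 3 * T ^ 17 := by ring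
  rw [e1] at b2
  have hYle : Y ≤ 6 * C * C0 ^ 3 * T ^ 17 := by
    rw [hY, Fin.sum_univ_three]
    linarith [(b2 0).2, (b2 1).2, (b2 2).2]
  have hT17 : 1 ≤ T ^ 17 := one_le_pow₀ hT1
  have h7 : T ^ 7 ≤ B := by
    refine le_of_mul_le_mul_right ?_ (by positivity : 0 < T ^ 17)
    rw [← pow_add, hT24, hB]
    linarith
  have hTB : T ≤ B := (le_self_pow₀ hT1 (by norm_num)).trans h7
  exact h2.mono (pow_le_pow_left₀ hT0.le hTB 24)

lemma apriori (hα : 0 < α) (hβ : 0 < β) (s : ℕ) : ∃ C : ℝ, ∀ v : St, Reg 2 v → ModeIneq Φ α β v →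
    Φ.G α β v ≤ 0 → ‖v 0 0‖ ≤ 2 * Real.pi → Nb (s + 2) v C := by
  induction s with
  | zero => exact Φ.apriori_two hα hβ
  | succ s ih =>
    obtain ⟨C1, h1⟩ := ih
    obtain ⟨C, -, hell⟩ := Φ.elliptic hα hβ (s + 1)
    refine ⟨C * (max 1 C1 ^ 2 * max 1 C1), fun v hr hm hG h0 => ?_⟩
    have hb := (h1 v hr hm hG h0).mono (le_max_right 1 C1)
    have hb' : Nb (s + 1) v (max 1 C1) := fun n => ⟨hb.reg.mono (by omega) n,
      (Summable.tsum_le_tsum (fun k => mul_le_mul_of_nonneg_right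
        (pow_le_pow_right₀ (one_le_jp k) (by omega)) (norm_nonneg _))
        (hb.reg.mono (by omega) n) (hb n).1).trans (hb n).2⟩
    exact hell v _ _ hm (le_max_left _ _) le_rfl hb' hb

lemma G_zero (α β : ℝ) : Φ.G α β 0 = 0 := by
  have h1 : ∀ x, Φ.dens α β x (val 0 x) (dval 0 x) = 0 := by
    intro x
    have hv : val 0 x = 0 := by ext n; simp [val, S]
    have hd : dval 0 x = 0 := by ext i n; simp [dval, S, dc]
    rw [hv, hd]
    simp [dens, nab, q, sec]
  simp [G, h1]

/-- Existence of a smooth minimiser. -/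
theorem exists_min (hα : 0 < α) (hβ : 0 < β) : ∃ v : St, (∀ s, Reg s v) ∧ ∀ v' : St,
    (∀ s, Reg s v') → |(v' 0 0).re| ≤ Real.pi → |(v' 0 0).im| ≤ Real.pi →
      Φ.G α β v ≤ Φ.G α β v' := by
  have key : ∀ {R : ℝ}, 2 * Real.pi ≤ R → ∀ {v : St}, v ∈ box R →
      (∀ v' ∈ box R, Φ.G α β v ≤ Φ.G α β v') →
      Reg 2 v ∧ ModeIneq Φ α β v ∧ Φ.G α β v ≤ 0 ∧ ‖v 0 0‖ ≤ 2 * Real.pi := by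
    intro R hR v hv hmin
    refine ⟨box_reg hR hv, modeIneq_of_min hR hv hmin, ?_, ?_⟩
    · rw [← Φ.G_zero α β]
      exact hmin 0 (zero_mem_box (by linarith [Real.pi_pos]))
    · have h1 := (mem_box.1 hv).1
      linarith [Complex.norm_le_abs_re_add_abs_im (v 0 0), h1.1, h1.2]
  obtain ⟨C, hC⟩ := Φ.apriori hα hβ 3
  set R0 := max (2 * Real.pi) C with hR0
  have hR : 2 * Real.pi ≤ R0 := le_max_left _ _
  obtain ⟨v, hv, hmin⟩ := exists_min_box (Φ := Φ) (α := α) (β := β) hR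
  obtain ⟨k1, k2, k3, k4⟩ := key hR hv hmin
  refine ⟨v, fun s => ?_, fun v' hr hre him => ?_⟩
  · obtain ⟨Cs, hs⟩ := Φ.apriori hα hβ s
    exact (hs v k1 k2 k3 k4).reg.mono (by omega)
  · set R := R0 + ∑ n, ∑' k, jp k ^ 5 * ‖v' n k‖ with hRdef
    have hnn : ∀ n, 0 ≤ ∑' k, jp k ^ 5 * ‖v' n k‖ := fun n => tsum_nonneg fun k => by
      have := jp_pos k; positivity
    have hR' : R0 ≤ R := le_add_of_nonneg_right (Finset.sum_nonneg fun n _ => hnn n)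
    have hv' : v' ∈ box R := by
      refine mem_box.2 ⟨⟨hre, him⟩, fun n k _ => ?_⟩
      have h1 := (hr 5 n).le_tsum k fun j _ => by have := jp_pos j; positivity
      have h2 := Finset.single_le_sum (fun n _ => hnn n) (Finset.mem_univ n)
      linarith [Real.pi_pos]
    obtain ⟨v1, hv1, hmin1⟩ := exists_min_box (Φ := Φ) (α := α) (β := β) (hR.trans hR')
    obtain ⟨l1, l2, l3, l4⟩ := key (hR.trans hR') hv1 hmin1
    have hb := hC v1 l1 l2 l3 l4
    have hv1' : v1 ∈ box R0 := by
      refine mem_box.2 ⟨(mem_box.1 hv1).1, fun n k _ => ?_⟩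
      have h1 := (hb n).1.le_tsum k fun j _ => by have := jp_pos j; positivity
      exact (h1.trans (hb n).2).trans (le_max_right _ _)
    exact (hmin v1 hv1').trans (hmin1 v' hv')

end Frame

section dd

variable {E F : Type*} [NormedAddCommGroup E] [NormedSpace ℝ E] [NormedAddCommGroup F]
  [NormedSpace ℝ F]

/-- Partial derivative in the direction `i`. -/
def dd (i : Fin 2) (f : ℝ × ℝ → E) (x : ℝ × ℝ) : E :=
  fderiv ℝ f x (if i = 0 then (1, 0) else (0, 1))

lemma contDiff_dd (i : Fin 2) {f : ℝ × ℝ → E} (hf : ContDiff ℝ (⊤ : ℕ∞) f) :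
    ContDiff ℝ (⊤ : ℕ∞) (dd i f) :=
  (hf.fderiv_right (m := (⊤ : ℕ∞)) le_rfl).clm_apply contDiff_const

lemma SP.dd {f : ℝ × ℝ → E} (hf : SP f) (i : Fin 2) : SP (dd i f) := by
  fin_cases i
  exacts [hf.pd1, hf.pd2]

lemma SP.integral_dd [CompleteSpace E] {f : ℝ × ℝ → E} (hf : SP f) (i : Fin 2) :
    ∫ x in unitSquare, GinzburgLandau.dd i f x = 0 := by
  fin_cases i
  exacts [hf.integral_pd1, hf.integral_pd2]

lemma dd_add {f g : ℝ × ℝ → E} (hf : ContDiff ℝ (⊤ : ℕ∞) f) (hg : ContDiff ℝ (⊤ : ℕ∞) g)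
    (i : Fin 2) (x : ℝ × ℝ) : dd i (fun y => f y + g y) x = dd i f x + dd i g x := by
  unfold dd
  rw [fderiv_fun_add (smooth_differentiable hf x) (smooth_differentiable hg x)]
  rfl

lemma dd_sub {f g : ℝ × ℝ → E} (hf : ContDiff ℝ (⊤ : ℕ∞) f) (hg : ContDiff ℝ (⊤ : ℕ∞) g)
    (i : Fin 2) (x : ℝ × ℝ) : dd i (fun y => f y - g y) x = dd i f x - dd i g x := by
  unfold dd
  rw [fderiv_fun_sub (smooth_differentiable hf x) (smooth_differentiable hg x)]
  rfl

lemma dd_const (c : E) (i : Fin 2) (x : ℝ × ℝ) : dd i (fun _ => c) x = 0 := by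
  simp [dd]

lemma dd_mul {A : Type*} [NormedCommRing A] [NormedAlgebra ℝ A] {f g : ℝ × ℝ → A}
    (hf : ContDiff ℝ (⊤ : ℕ∞) f) (hg : ContDiff ℝ (⊤ : ℕ∞) g) (i : Fin 2) (x : ℝ × ℝ) :
    dd i (fun y => f y * g y) x = dd i f x * g x + f x * dd i g x := by
  unfold dd
  rw [fderiv_fun_mul (smooth_differentiable hf x) (smooth_differentiable hg x)]
  simp only [add_apply, smul_apply, smul_eq_mul]
  ring

lemma dd_clm (L : E →L[ℝ] F) {f : ℝ × ℝ → E} (hf : ContDiff ℝ (⊤ : ℕ∞) f) (i : Fin 2)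
    (x : ℝ × ℝ) : dd i (fun y => L (f y)) x = L (dd i f x) := by
  unfold dd
  have h := L.hasFDerivAt.comp x (smooth_differentiable hf x).hasFDerivAt
  exact congrFun (congrArg DFunLike.coe h.fderiv) _

lemma dd_conj {f : ℝ × ℝ → ℂ} (hf : ContDiff ℝ (⊤ : ℕ∞) f) (i : Fin 2) (x : ℝ × ℝ) :
    dd i (fun y => (starRingEnd ℂ) (f y)) x = (starRingEnd ℂ) (dd i f x) :=
  dd_clm (Complex.conjCLE : ℂ →L[ℝ] ℂ) hf i x

lemma dd_re {f : ℝ × ℝ → ℂ} (hf : ContDiff ℝ (⊤ : ℕ∞) f) (i : Fin 2) (x : ℝ × ℝ) :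
    dd i (fun y => (f y).re) x = (dd i f x).re := dd_clm Complex.reCLM hf i x

lemma dd_im {f : ℝ × ℝ → ℂ} (hf : ContDiff ℝ (⊤ : ℕ∞) f) (i : Fin 2) (x : ℝ × ℝ) :
    dd i (fun y => (f y).im) x = (dd i f x).im := dd_clm Complex.imCLM hf i x

lemma dd_ofReal {f : ℝ × ℝ → ℝ} (hf : ContDiff ℝ (⊤ : ℕ∞) f) (i : Fin 2) (x : ℝ × ℝ) :
    dd i (fun y => (f y : ℂ)) x = dd i f x := dd_clm Complex.ofRealCLM hf i x

lemma dd_comm {f : ℝ × ℝ → E} (hf : ContDiff ℝ (⊤ : ℕ∞) f) (x : ℝ × ℝ) :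
    dd 0 (dd 1 f) x = dd 1 (dd 0 f) x := by
  have h1 : DifferentiableAt ℝ (fderiv ℝ f) x :=
    smooth_differentiable (hf.fderiv_right (m := (⊤ : ℕ∞)) le_rfl) x
  have h2 : ∀ v w : ℝ × ℝ, fderiv ℝ (fun y => fderiv ℝ f y v) x w = fderiv ℝ (fderiv ℝ f) x w v := by
    intro v w
    rw [fderiv_clm_apply h1 (differentiableAt_const v)]
    simp
  have h3 : IsSymmSndFDerivAt ℝ f x := hf.contDiffAt.isSymmSndFDerivAt (by
    rw [minSmoothness_of_isRCLikeNormedField]; exact WithTop.coe_le_coe.2 le_top)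
  have h4 := h3.eq (1, 0) (0, 1)
  rw [← h2, ← h2] at h4
  exact h4

lemma dd_S {c : ℤ × ℤ → ℂ} (h : Summable fun k => jp k ^ 1 * ‖c k‖) (i : Fin 2) :
    dd i (S c) = S (dc i c) := by
  fin_cases i
  exacts [pd1_S h, pd2_S h]

end dd

lemma dd_e (i : Fin 2) (k : ℤ × ℤ) (x : ℝ × ℝ) :
    dd i (e k) x = 2 * Real.pi * I * fr i k * e k x := by
  fin_cases i
  exacts [pd1_e k x, pd2_e k x]

/-- A continuous periodic function vanishing on the unit square vanishes. -/
lemma SP.eq_zero {E : Type*} [NormedAddCommGroup E] [NormedSpace ℝ E] {f : ℝ × ℝ → E} (hf : SP f)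
    (h : ∀ x ∈ unitSquare, f x = 0) (x : ℝ × ℝ) : f x = 0 := by
  have h1 : ∀ t, Function.Periodic (fun s => f (s, t)) 1 := fun t s => hf.per1 (s, t)
  have h2 : ∀ s, Function.Periodic (fun t => f (s, t)) 1 := fun s t => hf.per2 (s, t)
  have h3 : f (Int.fract x.1, Int.fract x.2) = f x := by
    rw [← Int.self_sub_floor, ← Int.self_sub_floor]
    have := (h1 (x.2 - ⌊x.2⌋)).sub_int_mul_eq (x := x.1) ⌊x.1⌋
    have := (h2 x.1).sub_int_mul_eq (x := x.2) ⌊x.2⌋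
    simp_all
  rw [← h3]
  exact h _ ⟨⟨Int.fract_nonneg _, Int.fract_nonneg _⟩,
    ⟨(Int.fract_lt_one _).le, (Int.fract_lt_one _).le⟩⟩

/-- Smooth sections of the line bundle of degree `d`. -/
structure QP (d : ℤ) (f : ℝ × ℝ → ℂ) : Prop where
  smooth : ContDiff ℝ (⊤ : ℕ∞) f
  per1 : ∀ x : ℝ × ℝ, f (x.1 + 1, x.2) = f x
  per2 : ∀ x : ℝ × ℝ, f (x.1, x.2 + 1) = e (d, 0) x * f x

namespace QP

variable {d : ℤ} {f g : ℝ × ℝ → ℂ}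

lemma conj_mul (hf : QP d f) (hg : QP d g) : SP (fun x => (starRingEnd ℂ) (f x) * g x) where
  smooth := (Complex.conjCLE.contDiff.comp hf.smooth).mul hg.smooth
  per1 x := by rw [hf.per1, hg.per1]
  per2 x := by
    rw [hf.per2, hg.per2, map_mul]
    have h : (starRingEnd ℂ) (e (d, 0) x) * e (d, 0) x = 1 := by
      rw [mul_comm, Complex.mul_conj, Complex.normSq_eq_norm_sq, norm_e]; simp
    linear_combination ((starRingEnd ℂ) (f x) * g x) * h

lemma add (hf : QP d f) (hg : QP d g) : QP d (fun x => f x + g x) where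
  smooth := hf.smooth.add hg.smooth
  per1 x := by rw [hf.per1, hg.per1]
  per2 x := by rw [hf.per2, hg.per2]; ring

lemma mul_SP (hf : QP d f) (hg : SP g) : QP d (fun x => f x * g x) where
  smooth := hf.smooth.mul hg.smooth
  per1 x := by rw [hf.per1, hg.per1]
  per2 x := by rw [hf.per2, hg.per2]; ring

lemma norm_sq (hf : QP d f) : SP (fun x => ‖f x‖ ^ 2) := by
  have h := (hf.conj_mul hf).re
  convert h using 2 with x
  rw [mul_comm, Complex.mul_conj, Complex.ofReal_re, Complex.normSq_eq_norm_sq]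

lemma dd_shift (hf : QP d f) (i : Fin 2) (x : ℝ × ℝ) :
    dd i f (x.1 + 1, x.2) = dd i f x ∧ dd i f (x.1, x.2 + 1) =
      e (d, 0) x * (dd i f x + 2 * Real.pi * I * fr i (d, 0) * f x) := by
  have s1 : ∀ y : ℝ × ℝ, ((y.1 + 1, y.2) : ℝ × ℝ) = y + (1, 0) := fun y => by ext <;> simp
  have s2 : ∀ y : ℝ × ℝ, ((y.1, y.2 + 1) : ℝ × ℝ) = y + (0, 1) := fun y => by ext <;> simp
  constructor
  · rw [s1]
    unfold dd
    rw [fderiv_shift _ _ fun y => by rw [← s1, hf.per1]]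
  · have h1 : (fun y => f (y + (0, 1))) = fun y => e (d, 0) y * f y := by
      funext y
      rw [← s2, hf.per2]
    have h2 : dd i f (x + (0, 1)) = dd i (fun y => e (d, 0) y * f y) x := by
      unfold dd
      rw [← h1, fderiv_comp_add_right]
    rw [s2, h2, dd_mul (contDiff_e _) hf.smooth, dd_e]
    ring

end QP

/-- The components of the connection form. -/
def conn {d : ℤ} (P : FieldPair d) (i : Fin 2) : ℝ × ℝ → ℝ := if i = 0 then P.a1 else P.a2

/-- The covariant derivative in the direction `i`. -/
def cov {d : ℤ} (P : FieldPair d) (i : Fin 2) (f : ℝ × ℝ → ℂ) (x : ℝ × ℝ) : ℂ :=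
  dd i f x + I * (conn P i x : ℂ) * f x

section FieldPair

variable {d : ℤ} (P P' : FieldPair d)

lemma cov_zero (f : ℝ × ℝ → ℂ) : cov P 0 f = D1 P.a1 f := rfl

lemma cov_one (f : ℝ × ℝ → ℂ) : cov P 1 f = D2 P.a2 f := rfl

lemma contDiff_conn (i : Fin 2) : ContDiff ℝ (⊤ : ℕ∞) (conn P i) := by
  fin_cases i
  exacts [P.smooth_a1, P.smooth_a2]

lemma conn_per1 (i : Fin 2) (x : ℝ × ℝ) : conn P i (x.1 + 1, x.2) = conn P i x := by
  fin_cases i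
  exacts [P.per1_a1 x, P.per1_a2 x]

lemma conn_per2 (i : Fin 2) (x : ℝ × ℝ) :
    conn P i (x.1, x.2 + 1) = conn P i x - 2 * Real.pi * fr i (d, 0) := by
  fin_cases i
  · exact P.per2_a1 x
  · have := P.per2_a2 x
    simpa [conn, fr] using this

lemma SP_conn_sub (i : Fin 2) : SP (fun x => conn P i x - conn P' i x) where
  smooth := (contDiff_conn P i).sub (contDiff_conn P' i)
  per1 x := by rw [conn_per1, conn_per1]
  per2 x := by rw [conn_per2, conn_per2]; ring

lemma QP_section : QP d P.φ where
  smooth := P.smooth_φ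
  per1 := P.per1_φ
  per2 x := by rw [P.per2_φ]; simp [e, mul_assoc]

lemma QP.cov {f : ℝ × ℝ → ℂ} (hf : QP d f) (i : Fin 2) : QP d (cov P i f) where
  smooth := (contDiff_dd i hf.smooth).add ((contDiff_const.mul
    (Complex.ofRealCLM.contDiff.comp (contDiff_conn P i))).mul hf.smooth)
  per1 x := by
    unfold GinzburgLandau.cov
    rw [(hf.dd_shift i x).1, conn_per1, hf.per1]
  per2 x := by
    unfold GinzburgLandau.cov
    rw [(hf.dd_shift i x).2, conn_per2, hf.per2]
    push_cast
    ring

/-- The field pair with given connection form and section. -/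
def mkPair (A : Fin 2 → ℝ × ℝ → ℝ) (hA : ∀ i, SP (fun x => A i x - conn P i x)) (f : ℝ × ℝ → ℂ)
    (hf : QP d f) : FieldPair d where
  a1 := A 0
  a2 := A 1
  φ := f
  smooth_a1 := by
    have := (hA 0).smooth.add (contDiff_conn P 0)
    simpa using this
  smooth_a2 := by
    have := (hA 1).smooth.add (contDiff_conn P 1)
    simpa using this
  smooth_φ := hf.smooth
  per1_a1 x := by
    have := (hA 0).per1 x
    rw [conn_per1] at this
    linarith
  per1_a2 x := by
    have := (hA 1).per1 x
    rw [conn_per1] at this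
    linarith
  per1_φ := hf.per1
  per2_a2 x := by
    have := (hA 1).per2 x
    rw [conn_per2] at this
    simp only [fr, one_ne_zero, if_false, Int.cast_zero, mul_zero, sub_zero] at this
    linarith
  per2_a1 x := by
    have := (hA 0).per2 x
    rw [conn_per2] at this
    simp only [fr, if_true] at this
    linarith
  per2_φ x := by
    rw [hf.per2]
    simp [e, mul_assoc]

end FieldPair

/-- The field pair with vanishing section and linear connection form. -/
def linearPair (d : ℤ) : FieldPair d where
  a1 x := -(2 * Real.pi * d) * x.2
  a2 _ := 0
  φ _ := 0
  smooth_a1 := contDiff_const.mul contDiff_snd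
  smooth_a2 := contDiff_const
  smooth_φ := contDiff_const
  per1_a1 _ := rfl
  per1_a2 _ := rfl
  per1_φ _ := rfl
  per2_a2 _ := rfl
  per2_a1 x := by simp only; ring
  per2_φ x := by simp

lemma curv_linearPair (d : ℤ) (x : ℝ × ℝ) :
    curv (linearPair d).a1 (linearPair d).a2 x = 2 * Real.pi * d := by
  have h : HasFDerivAt (linearPair d).a1 ((-(2 * Real.pi * d)) • ContinuousLinearMap.snd ℝ ℝ ℝ) x :=
    (hasFDerivAt_snd (𝕜 := ℝ) (E := ℝ) (F := ℝ)).const_mul _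
  have h2 : HasFDerivAt (linearPair d).a2 (0 : ℝ × ℝ →L[ℝ] ℝ) x := hasFDerivAt_const _ _
  simp [curv, pd1, pd2, h.fderiv, h2.fderiv]

section Sections

variable (d : ℤ)

/-- The section of the bundle of degree `d` given by `g` on each strip between consecutive
integers. -/
def stripSection (τ : ℝ) (g : ℝ → ℝ) (x : ℝ × ℝ) : ℂ :=
  (g (x.2 + τ) : ℂ) * e (d * ⌊x.2 + τ⌋, 0) x

variable {d}

lemma QP_stripSection (τ : ℝ) {g : ℝ → ℝ} (hg : ContDiff ℝ (⊤ : ℕ∞) g) (hp : ∀ y, g (y + 1) = g y)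
    (h0 : ∀ y, 1 / 2 < Real.cos (2 * Real.pi * y) → g y = 0) : QP d (stripSection d τ g) where
  smooth := by
    rw [contDiff_iff_contDiffAt]
    intro x
    by_cases hx : 1 / 2 < Real.cos (2 * Real.pi * (x.2 + τ))
    · have h1 : ∀ᶠ z : ℝ × ℝ in nhds x, 1 / 2 < Real.cos (2 * Real.pi * (z.2 + τ)) :=
        (isOpen_lt continuous_const (by fun_prop)).mem_nhds hx
      refine (contDiffAt_const (c := (0 : ℂ))).congr_of_eventuallyEq ?_
      filter_upwards [h1] with z hz
      simp [stripSection, h0 _ hz]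
    · have hne : ((⌊x.2 + τ⌋ : ℤ) : ℝ) ≠ x.2 + τ := by
        intro h
        apply hx
        rw [← h, show 2 * Real.pi * (⌊x.2 + τ⌋ : ℝ) = ⌊x.2 + τ⌋ * (2 * Real.pi) by ring,
          Real.cos_int_mul_two_pi]
        norm_num
      have hlt : ((⌊x.2 + τ⌋ : ℤ) : ℝ) < x.2 + τ := lt_of_le_of_ne (Int.floor_le _) hne
      have hopen : IsOpen {z : ℝ × ℝ | ((⌊x.2 + τ⌋ : ℤ) : ℝ) < z.2 + τ ∧
          z.2 + τ < (⌊x.2 + τ⌋ : ℤ) + 1} :=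
        (isOpen_lt (f := fun _ : ℝ × ℝ => ((⌊x.2 + τ⌋ : ℤ) : ℝ)) (g := fun z => z.2 + τ)
          (by fun_prop) (by fun_prop)).inter
        (isOpen_lt (f := fun z : ℝ × ℝ => z.2 + τ) (g := fun _ => ((⌊x.2 + τ⌋ : ℤ) : ℝ) + 1)
          (by fun_prop) (by fun_prop))
      have h1 := hopen.mem_nhds (show x ∈ _ from ⟨hlt, Int.lt_floor_add_one _⟩)
      have h2 : ContDiff ℝ (⊤ : ℕ∞) fun z : ℝ × ℝ =>
          (g (z.2 + τ) : ℂ) * e (d * ⌊x.2 + τ⌋, 0) z :=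
        (Complex.ofRealCLM.contDiff.comp (hg.comp (contDiff_snd.add contDiff_const))).mul
          (contDiff_e _)
      refine h2.contDiffAt.congr_of_eventuallyEq ?_
      filter_upwards [h1] with z hz
      rw [stripSection, Int.floor_eq_iff.2 ⟨hz.1.le, hz.2⟩]
  per1 x := by simp only [stripSection, (SP_e _).per1]
  per2 x := by
    have h1 : x.2 + 1 + τ = x.2 + τ + 1 := by ring
    have h2 : ((d * (⌊x.2 + τ⌋ + 1), 0) : ℤ × ℤ) = (d, 0) + (d * ⌊x.2 + τ⌋, 0) := by
      ext <;> simp; ring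
    simp only [stripSection, (SP_e _).per2, h1, hp, Int.floor_add_one, h2, e_add]
    ring

/-- There are two sections without common zeros. -/
lemma exists_sections (d : ℤ) : ∃ s : Fin 2 → ℝ × ℝ → ℂ, (∀ j, QP d (s j)) ∧
    ∀ x, ‖s 0 x‖ ^ 2 + ‖s 1 x‖ ^ 2 = 1 := by
  have hper : ∀ y : ℝ, Real.cos (2 * Real.pi * (y + 1)) = Real.cos (2 * Real.pi * y) := fun y => by
    rw [mul_add, mul_one, Real.cos_add_two_pi]
  have hc : ContDiff ℝ (⊤ : ℕ∞) fun y : ℝ => Real.cos (2 * Real.pi * y) :=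
    (contDiff_const.mul contDiff_id).cos
  let g0 : ℝ → ℝ := fun y =>
    Real.sin (Real.pi / 2 * Real.smoothTransition (1 / 2 - Real.cos (2 * Real.pi * y)))
  let g1 : ℝ → ℝ := fun y =>
    Real.cos (Real.pi / 2 * Real.smoothTransition (1 / 2 + Real.cos (2 * Real.pi * y)))
  have h0 : QP d (stripSection d 0 g0) := by
    refine QP_stripSection 0 ?_ (fun y => by simp only [g0, hper]) fun y hy => ?_
    · exact (contDiff_const.mul (Real.smoothTransition.contDiff.comp (contDiff_const.sub hc))).sin
    · simp only [g0]
      rw [Real.smoothTransition.zero_of_nonpos (by linarith), mul_zero, Real.sin_zero]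
  have h1 : QP d (stripSection d (1 / 2) g1) := by
    refine QP_stripSection (1 / 2) ?_ (fun y => by simp only [g1, hper]) fun y hy => ?_
    · exact (contDiff_const.mul (Real.smoothTransition.contDiff.comp (contDiff_const.add hc))).cos
    · simp only [g1]
      rw [Real.smoothTransition.one_of_one_le (by linarith), mul_one, Real.cos_pi_div_two]
  refine ⟨![stripSection d 0 g0, stripSection d (1 / 2) g1], fun j => by fin_cases j; exacts [h0, h1],
    fun x => ?_⟩
  have hh : Real.cos (2 * Real.pi * (x.2 + 1 / 2)) = -Real.cos (2 * Real.pi * x.2) := by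
    rw [show 2 * Real.pi * (x.2 + 1 / 2) = 2 * Real.pi * x.2 + Real.pi by ring, Real.cos_add_pi]
  simp only [Matrix.cons_val_zero, Matrix.cons_val_one, stripSection, norm_mul, norm_e, mul_one,
    Complex.norm_real, Real.norm_eq_abs, sq_abs, g0, g1, hh, add_zero, ← sub_eq_add_neg,
    Real.sin_sq_add_cos_sq]

end Sections

lemma SP_S_components {c : ℤ × ℤ → ℂ} (h : ∀ s : ℕ, Summable fun k => jp k ^ s * ‖c k‖) (i : Fin 2) :
    SP fun x => bb i (S c x) := by
  fin_cases i
  exacts [(SP_S h).re, (SP_S h).im]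

/-- Poisson's equation on the torus, in the form of the Hodge system. -/
lemma exists_curl {f : ℝ × ℝ → ℝ} (hf : SP f) (h0 : ∫ x in unitSquare, f x = 0) :
    ∃ b : Fin 2 → ℝ × ℝ → ℝ, (∀ i, SP (b i)) ∧ ∀ x, dd 0 (b 1) x - dd 1 (b 0) x = f x := by
  let fc : ℝ × ℝ → ℂ := fun x => f x
  have hfc : SP fc := hf.ofReal
  have hA := fun s => hfc.inA s
  let c : ℤ × ℤ → ℂ := fun k => coef fc k / (2 * Real.pi * ((k.1 : ℂ) - I * k.2))
  have hn : ∀ k : ℤ × ℤ, k ≠ 0 → 1 ≤ ‖(k.1 : ℂ) - I * k.2‖ := by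
    intro k hk
    have h1 : ‖(k.1 : ℂ) - I * k.2‖ ^ 2 = ((k.1 ^ 2 + k.2 ^ 2 : ℤ) : ℝ) := by
      rw [norm_sq_eq]; simp
    have h2 : (1 : ℤ) ≤ k.1 ^ 2 + k.2 ^ 2 := by
      by_contra! h3
      have h4 : k.1 = 0 := by nlinarith [sq_nonneg k.1, sq_nonneg k.2]
      have h5 : k.2 = 0 := by nlinarith [sq_nonneg k.1, sq_nonneg k.2]
      exact hk (Prod.ext h4 h5)
    have h3 : (1 : ℝ) ≤ ‖(k.1 : ℂ) - I * k.2‖ ^ 2 := by rw [h1]; exact_mod_cast h2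
    nlinarith [norm_nonneg ((k.1 : ℂ) - I * k.2)]
  have hz : coef fc 0 = 0 := by
    simp only [coef, neg_zero, e_zero, mul_one, fc]
    exact (integral_ofReal (𝕜 := ℂ)).trans (by rw [h0]; rfl)
  have hle : ∀ k, ‖c k‖ ≤ ‖coef fc k‖ := by
    intro k
    by_cases hk : k = 0
    · simp [c, hk]
    · have h1 : 1 ≤ ‖2 * (Real.pi : ℂ) * ((k.1 : ℂ) - I * k.2)‖ := by
        rw [norm_mul, norm_mul, Complex.norm_real, Real.norm_eq_abs, abs_of_pos Real.pi_pos,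
          Complex.norm_ofNat]
        nlinarith [hn k hk, Real.pi_gt_three]
      simp only [c]
      rw [norm_div]
      exact div_le_self (norm_nonneg _) h1
  have hs : ∀ s : ℕ, Summable fun k => jp k ^ s * ‖c k‖ := fun s =>
    Summable.of_nonneg_of_le (weight_nonneg s c)
      (fun k => mul_le_mul_of_nonneg_left (hle k) (pow_nonneg (jp_pos k).le _)) (hA s).1
  have hS := SP_S hs
  refine ⟨fun i x => bb i (S c x), SP_S_components hs, fun x => ?_⟩
  have h1 : dd 0 (S c) x - I * dd 1 (S c) x = I * fc x := by
    rw [dd_S (hs 1), dd_S (hs 1), (hA 0).2]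
    have hd := fun i => summable_norm_of_weight (summable_dc (s := 0) (hs 1) i)
    have h2 := S_add_mul (hd 0) (hd 1) (-I) x
    have h3 := S_add_mul (c := fun _ => 0) (by simp)
      (summable_norm_of_weight (hA 0).1) I x
    have h4 : S (fun _ => 0) x = 0 := by simp [S]
    rw [h4, zero_add] at h3
    rw [← (hA 0).2] at h3 ⊢
    rw [sub_eq_add_neg, ← neg_mul, ← h2, ← h3]
    congr 1
    funext k
    by_cases hk : k = 0
    · subst hk; simp [dc, fr, hz]
    · have h5 : (k.1 : ℂ) - I * k.2 ≠ 0 := fun h => by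
        have := hn k hk
        rw [h, norm_zero] at this
        linarith
      have h6 : (Real.pi : ℂ) ≠ 0 := Complex.ofReal_ne_zero.2 Real.pi_ne_zero
      simp only [dc, fr, c, if_true, one_ne_zero, if_false]
      field_simp
      ring
  have h2 := congrArg Complex.im h1
  have e0 : dd 1 (fun y => bb 0 (S c y)) x = (dd 1 (S c) x).re := dd_re hS.smooth 1 x
  have e1 : dd 0 (fun y => bb 1 (S c y)) x = (dd 0 (S c) x).im := dd_im hS.smooth 0 x
  rw [e0, e1]
  simpa [fc] using h2

lemma curv_eq {d : ℤ} (P : FieldPair d) (x : ℝ × ℝ) :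
    curv P.a1 P.a2 x = dd 0 (conn P 1) x - dd 1 (conn P 0) x := rfl

/-- There is a connection with prescribed curvature and a normalised section. -/
lemma exists_normalized {d : ℤ} {F₀ : ℝ × ℝ → ℝ} (hF : ExternalField d F₀) :
    ∃ P : FieldPair d, (∀ x, curv P.a1 P.a2 x = F₀ x) ∧ ∫ x in unitSquare, ‖P.φ x‖ ^ 2 = 1 := by
  obtain ⟨hF1, hF2, hF3, hF4⟩ := hF
  have hSP : SP F₀ := ⟨hF1, hF2, hF3⟩
  obtain ⟨b, hb, hcurl⟩ := exists_curl (hSP.sub (SP_const (2 * Real.pi * d))) (by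
    rw [integral_sub (integrable_sq hSP.continuous) (integrable_sq continuous_const), hF4]
    simp [Measure.real])
  obtain ⟨s, hs, hs1⟩ := exists_sections d
  have hj : ∃ j, 0 < ∫ x in unitSquare, ‖s j x‖ ^ 2 := by
    by_contra! h
    have h1 : ∫ x in unitSquare, (‖s 0 x‖ ^ 2 + ‖s 1 x‖ ^ 2) = 1 := by
      simp [hs1, Measure.real]
    rw [integral_add (integrable_sq (hs 0).norm_sq.continuous)
      (integrable_sq (hs 1).norm_sq.continuous)] at h1
    linarith [h 0, h 1]
  obtain ⟨j, hj⟩ := hj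
  set N := ∫ x in unitSquare, ‖s j x‖ ^ 2
  refine ⟨mkPair (linearPair d) (fun i x => conn (linearPair d) i x + b i x)
    (fun i => by simpa using hb i) _ ((hs j).mul_SP (SP_const ((Real.sqrt N)⁻¹ : ℂ))),
    fun x => ?_, ?_⟩
  · rw [curv_eq]
    change dd 0 (fun x => conn (linearPair d) 1 x + b 1 x) x -
      dd 1 (fun x => conn (linearPair d) 0 x + b 0 x) x = F₀ x
    rw [dd_add (contDiff_conn _ _) (hb 1).smooth, dd_add (contDiff_conn _ _) (hb 0).smooth]
    have h1 := curv_linearPair d x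
    rw [curv_eq] at h1
    linarith [hcurl x]
  · change ∫ x in unitSquare, ‖s j x * ((Real.sqrt N)⁻¹ : ℂ)‖ ^ 2 = 1
    simp only [norm_mul, norm_inv, Complex.norm_real, Real.norm_eq_abs, mul_pow, inv_pow, sq_abs,
      Real.sq_sqrt hj.le]
    rw [integral_mul_const]
    exact mul_inv_cancel₀ hj.ne'

section frame

variable {d : ℤ} (P : FieldPair d) {s : Fin 2 → ℝ × ℝ → ℂ}

lemma conj_mul_self_add {z w : ℂ} (h : ‖z‖ ^ 2 + ‖w‖ ^ 2 = 1) :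
    (starRingEnd ℂ) z * z + (starRingEnd ℂ) w * w = 1 := by
  rw [Complex.conj_mul', Complex.conj_mul']
  exact_mod_cast h

/-- The trace of the connection matrix. -/
def frameTrace (s : Fin 2 → ℝ × ℝ → ℂ) (i : Fin 2) (x : ℝ × ℝ) : ℂ :=
  ∑ j, (starRingEnd ℂ) (s j x) * cov P i (s j) x

lemma frameTrace_add_conj (hs : ∀ j, QP d (s j)) (h1 : ∀ x, ‖s 0 x‖ ^ 2 + ‖s 1 x‖ ^ 2 = 1)
    (i : Fin 2) (x : ℝ × ℝ) :
    frameTrace P s i x + (starRingEnd ℂ) (frameTrace P s i x) = 0 := by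
  have hc : ∀ j, ContDiff ℝ (⊤ : ℕ∞) fun y => (starRingEnd ℂ) (s j y) := fun j =>
    Complex.conjCLE.contDiff.comp (hs j).smooth
  have h2 := dd_const (1 : ℂ) i x
  rw [← funext fun y => conj_mul_self_add (h1 y), dd_add ((hc 0).mul (hs 0).smooth)
    ((hc 1).mul (hs 1).smooth), dd_mul (hc 0) (hs 0).smooth, dd_mul (hc 1) (hs 1).smooth,
    dd_conj (hs 0).smooth, dd_conj (hs 1).smooth] at h2
  simp only [frameTrace, cov, Fin.sum_univ_two, map_add, map_mul, Complex.conj_conj,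
    Complex.conj_ofReal, Complex.conj_I]
  linear_combination h2

lemma SP_frameTrace (hs : ∀ j, QP d (s j)) (i : Fin 2) : SP (frameTrace P s i) := by
  unfold frameTrace
  simp only [Fin.sum_univ_two]
  exact ((hs 0).conj_mul ((hs 0).cov P i)).add ((hs 1).conj_mul ((hs 1).cov P i))

/-- The frame given by two sections and a connection. -/
def mkFrame (hs : ∀ j, QP d (s j)) (h1 : ∀ x, ‖s 0 x‖ ^ 2 + ‖s 1 x‖ ^ 2 = 1) : Frame where
  s := s
  Γ i j m x := (starRingEnd ℂ) (s j x) * cov P i (s m) x - (starRingEnd ℂ) (cov P i (s j) x) * s m x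
    - frameTrace P s i x * ((starRingEnd ℂ) (s j x) * s m x)
  smooth_s j := (hs j).smooth
  periodic_s j l := (hs j).conj_mul (hs l)
  periodic_Γ i j m := (((hs j).conj_mul ((hs m).cov P i)).sub
    (((hs j).cov P i).conj_mul (hs m))).sub ((SP_frameTrace P hs i).mul ((hs j).conj_mul (hs m)))
  unit_s := h1

variable (hs : ∀ j, QP d (s j)) (h1 : ∀ x, ‖s 0 x‖ ^ 2 + ‖s 1 x‖ ^ 2 = 1)

/-- The covariant derivative of a section in terms of its components. -/
lemma sum_s_nab {u : Fin 2 → ℝ × ℝ → ℂ} (hu : ∀ j, ContDiff ℝ (⊤ : ℕ∞) (u j)) {W : Fin 3 → ℂ}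
    {DW : Fin 2 → Fin 3 → ℂ} {x : ℝ × ℝ} {i : Fin 2} (hW : ∀ j, W j.succ = u j x)
    (hDW : ∀ j, DW i j.succ = dd i (u j) x) :
    ∑ j, s j x * (mkFrame P hs h1).nab x W DW i j =
      cov P i (fun y => ∑ j, s j y * u j y) x + I * (bb i (W 0) : ℂ) * ∑ j, s j x * u j x := by
  have h2 := frameTrace_add_conj P hs h1 i x
  have h3 := conj_mul_self_add (h1 x)
  have h4 : (starRingEnd ℂ) (frameTrace P s i x) =
      s 0 x * (starRingEnd ℂ) (cov P i (s 0) x) + s 1 x * (starRingEnd ℂ) (cov P i (s 1) x) := by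
    simp [frameTrace]
  rw [h4] at h2
  have h5 : cov P i (fun y => ∑ j, s j y * u j y) x =
      ∑ j, (cov P i (s j) x * u j x + s j x * dd i (u j) x) := by
    simp only [Fin.sum_univ_two, cov]
    rw [dd_add ((hs 0).smooth.mul (hu 0)) ((hs 1).smooth.mul (hu 1)), dd_mul (hs 0).smooth (hu 0),
      dd_mul (hs 1).smooth (hu 1)]
    ring
  rw [h5]
  simp only [Frame.nab, Frame.q, mkFrame, hW, hDW, Fin.sum_univ_two]
  linear_combination ((cov P i (s 0) x - frameTrace P s i x * s 0 x) * u 0 x +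
    (cov P i (s 1) x - frameTrace P s i x * s 1 x) * u 1 x) * h3
    - (s 0 x * u 0 x + s 1 x * u 1 x) * h2

/-- The components of the covariant derivative of a section. -/
lemma nab_conj_mul {f : ℝ × ℝ → ℂ} (hf : ContDiff ℝ (⊤ : ℕ∞) f) {W : Fin 3 → ℂ}
    {DW : Fin 2 → Fin 3 → ℂ} {x : ℝ × ℝ} {i : Fin 2}
    (hW : ∀ j : Fin 2, W j.succ = (starRingEnd ℂ) (s j x) * f x)
    (hDW : ∀ j : Fin 2, DW i j.succ = dd i (fun y => (starRingEnd ℂ) (s j y) * f y) x) (j : Fin 2) :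
    (mkFrame P hs h1).nab x W DW i j =
      (starRingEnd ℂ) (s j x) * (cov P i f x + I * (bb i (W 0) : ℂ) * f x) := by
  have h3 := conj_mul_self_add (h1 x)
  have h4 : frameTrace P s i x = (starRingEnd ℂ) (s 0 x) * cov P i (s 0) x +
      (starRingEnd ℂ) (s 1 x) * cov P i (s 1) x := by
    simp [frameTrace]
  have h5 : (starRingEnd ℂ) (cov P i (s j) x) =
      (starRingEnd ℂ) (dd i (s j) x) - I * (conn P i x : ℂ) * (starRingEnd ℂ) (s j x) := by
    simp only [cov, map_add, map_mul, Complex.conj_ofReal, Complex.conj_I]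
    ring
  simp only [Frame.nab, Frame.q, mkFrame, hW, hDW, Fin.sum_univ_two]
  have hc : ContDiff ℝ (⊤ : ℕ∞) fun y => (starRingEnd ℂ) (s j y) :=
    Complex.conjCLE.contDiff.comp (hs j).smooth
  rw [dd_mul hc hf, dd_conj (hs j).smooth, h5]
  have h6 : cov P i f x = dd i f x + I * (conn P i x : ℂ) * f x := rfl
  rw [h6]
  linear_combination (-(starRingEnd ℂ) (s j x) * f x) * h4 +
    (-(starRingEnd ℂ) (dd i (s j) x) * f x + I * (conn P i x : ℂ) * (starRingEnd ℂ) (s j x) * f x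
      - frameTrace P s i x * (starRingEnd ℂ) (s j x) * f x) * h3

end frame

section RelativeEnergy

variable {d : ℤ} (P₀ P : FieldPair d) (α β : ℝ)

/-- The difference of two connection forms. -/
def rel (i : Fin 2) (x : ℝ × ℝ) : ℝ := conn P i x - conn P₀ i x

/-- The curl of the difference of two connection forms. -/
def relCurl (x : ℝ × ℝ) : ℝ := dd 0 (rel P₀ P 1) x - dd 1 (rel P₀ P 0) x

/-- The divergence of the difference of two connection forms. -/
def relDiv (x : ℝ × ℝ) : ℝ := dd 0 (rel P₀ P 0) x + dd 1 (rel P₀ P 1) x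

lemma SP_rel (i : Fin 2) : SP (rel P₀ P i) := SP_conn_sub P P₀ i

lemma SP_relCurl : SP (relCurl P₀ P) := ((SP_rel P₀ P 1).dd 0).sub ((SP_rel P₀ P 0).dd 1)

lemma SP_relDiv : SP (relDiv P₀ P) := ((SP_rel P₀ P 0).dd 0).add ((SP_rel P₀ P 1).dd 1)

lemma relCurl_eq (x : ℝ × ℝ) :
    relCurl P₀ P x = curv P.a1 P.a2 x - curv P₀.a1 P₀.a2 x := by
  have h : ∀ i j, dd i (rel P₀ P j) x = dd i (conn P j) x - dd i (conn P₀ j) x := fun i j =>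
    dd_sub (contDiff_conn P j) (contDiff_conn P₀ j) i x
  rw [relCurl, h, h, curv_eq, curv_eq]
  ring

/-- The density of the energy with an additional gauge fixing term. -/
def relDens (x : ℝ × ℝ) : ℝ :=
  relCurl P₀ P x ^ 2 + relDiv P₀ P x ^ 2 + ∑ i, ‖cov P i P.φ x‖ ^ 2 - α * ‖P.φ x‖ ^ 2
    + β / 2 * (‖P.φ x‖ ^ 2) ^ 2

lemma continuous_relDens : Continuous (relDens P₀ P α β) := by
  have h1 := (SP_relCurl P₀ P).continuous
  have h2 := (SP_relDiv P₀ P).continuous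
  have h3 := fun i => ((QP_section P).cov P i).smooth.continuous
  have h4 := P.smooth_φ.continuous
  unfold relDens
  fun_prop

/-- The energy with an additional gauge fixing term. -/
def relEnergy : ℝ := (1 / 2) * ∫ x in unitSquare, relDens P₀ P α β x

/-- The gauge transformation by the character `e (-n)`. -/
def gauge (n : ℤ × ℤ) : FieldPair d :=
  mkPair P (fun i x => conn P i x + 2 * Real.pi * fr i n) (fun i => by
    simpa using SP_const (2 * Real.pi * (fr i n : ℝ))) _ ((QP_section P).mul_SP (SP_e (-n)))

lemma conn_mkPair {A : Fin 2 → ℝ × ℝ → ℝ} (hA : ∀ i, SP (fun x => A i x - conn P i x))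
    {f : ℝ × ℝ → ℂ} (hf : QP d f) (i : Fin 2) : conn (mkPair P A hA f hf) i = A i := by
  fin_cases i <;> rfl

lemma rel_gauge (n : ℤ × ℤ) (i : Fin 2) :
    rel P₀ (gauge P n) i = fun x => rel P₀ P i x + 2 * Real.pi * fr i n := by
  funext x
  rw [rel, gauge, conn_mkPair, rel]
  ring

lemma relDens_gauge (n : ℤ × ℤ) (x : ℝ × ℝ) :
    relDens P₀ (gauge P n) α β x = relDens P₀ P α β x := by
  have h1 : ∀ i j, dd i (rel P₀ (gauge P n) j) x = dd i (rel P₀ P j) x := fun i j => by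
    rw [rel_gauge, dd_add (SP_rel P₀ P j).smooth contDiff_const, dd_const, add_zero]
  have h2 : ∀ y, (gauge P n).φ y = P.φ y * e (-n) y := fun y => rfl
  have h3 : ∀ i, cov (gauge P n) i (gauge P n).φ x = cov P i P.φ x * e (-n) x := fun i => by
    rw [funext h2, cov, cov, dd_mul P.smooth_φ (contDiff_e _), dd_e, gauge, conn_mkPair]
    have : fr i (-n) = -fr i n := by unfold fr; split_ifs <;> rfl
    rw [this]
    push_cast
    ring
  simp only [relDens, relCurl, relDiv, h1, h2, h3, norm_mul, norm_e, mul_one]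

lemma relEnergy_gauge (n : ℤ × ℤ) : relEnergy P₀ (gauge P n) α β = relEnergy P₀ P α β := by
  simp only [relEnergy, relDens_gauge]

variable {s : Fin 2 → ℝ × ℝ → ℂ} (hs : ∀ j, QP d (s j))
  (h1 : ∀ x, ‖s 0 x‖ ^ 2 + ‖s 1 x‖ ^ 2 = 1)

/-- The coefficients of a field pair in a frame. -/
def ofPair (s : Fin 2 → ℝ × ℝ → ℂ) : St :=
  Fin.cons (coef fun x => (rel P₀ P 0 x : ℂ) + I * (rel P₀ P 1 x : ℂ))
    (fun j => coef fun x => (starRingEnd ℂ) (s j x) * P.φ x)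

lemma SP_rel_complex : SP fun x => (rel P₀ P 0 x : ℂ) + I * (rel P₀ P 1 x : ℂ) :=
  (SP_rel P₀ P 0).ofReal.add ((SP_const I).mul (SP_rel P₀ P 1).ofReal)

lemma Reg_ofPair (hs : ∀ j, QP d (s j)) (n : ℕ) : Reg n (ofPair P₀ P s) := by
  intro j
  refine Fin.cases ?_ (fun j => ?_) j
  · exact ((SP_rel_complex P₀ P).inA n).1
  · exact (((hs j).conj_mul (QP_section P)).inA n).1

lemma G_ofPair : (mkFrame P₀ hs h1).G α β (ofPair P₀ P s) = relEnergy P₀ P α β := by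
  have hw := SP_rel_complex P₀ P
  have hu := fun j => (hs j).conj_mul (QP_section P)
  have vw : ∀ x, val (ofPair P₀ P s) x 0 = (rel P₀ P 0 x : ℂ) + I * (rel P₀ P 1 x : ℂ) :=
    fun x => (congrFun (hw.inA 0).2 x).symm
  have vu : ∀ x (j : Fin 2), val (ofPair P₀ P s) x j.succ = (starRingEnd ℂ) (s j x) * P.φ x :=
    fun x j => (congrFun ((hu j).inA 0).2 x).symm
  have dw : ∀ x i, dval (ofPair P₀ P s) x i 0 =
      ((dd i (rel P₀ P 0) x : ℝ) : ℂ) + I * ((dd i (rel P₀ P 1) x : ℝ) : ℂ) := fun x i => by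
    have h2 := dd_S (hw.inA 1).1 i
    rw [← (hw.inA 1).2] at h2
    refine (congrFun h2 x).symm.trans ?_
    rw [dd_add (SP_rel P₀ P 0).ofReal.smooth ((SP_const I).mul (SP_rel P₀ P 1).ofReal).smooth,
      dd_mul contDiff_const (SP_rel P₀ P 1).ofReal.smooth, dd_const, dd_ofReal (SP_rel P₀ P 0).smooth,
      dd_ofReal (SP_rel P₀ P 1).smooth]
    ring
  have du : ∀ x i (j : Fin 2), dval (ofPair P₀ P s) x i j.succ =
      dd i (fun y => (starRingEnd ℂ) (s j y) * P.φ y) x := fun x i j => by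
    have h2 := dd_S ((hu j).inA 1).1 i
    rw [← ((hu j).inA 1).2] at h2
    exact (congrFun h2 x).symm
  unfold Frame.G relEnergy
  congr 2
  funext x
  have hb : ∀ i, bb i (val (ofPair P₀ P s) x 0) = rel P₀ P i x := fun i => by
    rw [vw]
    fin_cases i <;> simp [bb]
  have hn : ∀ i j, (mkFrame P₀ hs h1).nab x (val (ofPair P₀ P s) x) (dval (ofPair P₀ P s) x) i j =
      (starRingEnd ℂ) (s j x) * cov P i P.φ x := fun i j => by
    rw [nab_conj_mul P₀ hs h1 P.smooth_φ (vu x) (du x i), hb, cov, cov, rel]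
    push_cast
    ring
  have hsec : (mkFrame P₀ hs h1).sec x (val (ofPair P₀ P s) x) = P.φ x := by
    have h3 := conj_mul_self_add (h1 x)
    simp only [Frame.sec, mkFrame, vu, Fin.sum_univ_two]
    linear_combination P.φ x * h3
  have hsum : ∀ z : ℂ, ∑ j, ‖(starRingEnd ℂ) (s j x) * z‖ ^ 2 = ‖z‖ ^ 2 := fun z => by
    simp only [Fin.sum_univ_two, norm_mul, RCLike.norm_conj, mul_pow]
    linear_combination ‖z‖ ^ 2 * h1 x
  have hdiv : ‖dval (ofPair P₀ P s) x 0 0 - I * dval (ofPair P₀ P s) x 1 0‖ ^ 2 =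
      relCurl P₀ P x ^ 2 + relDiv P₀ P x ^ 2 := by
    rw [dw, dw, norm_sq_eq]
    simp [relCurl, relDiv]
    ring
  simp only [Frame.dens, relDens, hn, hsec, vu, hsum, hdiv]

/-- The field pair with given coefficients. -/
def toPair (hs : ∀ j, QP d (s j)) {v : St} (hv : ∀ n, Reg n v) : FieldPair d :=
  mkPair P₀ (fun i x => conn P₀ i x + bb i (S (v 0) x))
    (fun i => by simpa using SP_S_components (fun n => hv n 0) i)
    (fun x => s 0 x * S (v 1) x + s 1 x * S (v 2) x)
    (((hs 0).mul_SP (SP_S fun n => hv n 1)).add ((hs 1).mul_SP (SP_S fun n => hv n 2)))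

lemma relEnergy_toPair_le (hβ : 0 < β) {v : St} (hv : ∀ n, Reg n v) :
    relEnergy P₀ (toPair P₀ hs hv) α β ≤ (mkFrame P₀ hs h1).G α β v := by
  set P := toPair P₀ hs hv with hP
  have hSP : ∀ n, SP (S (v n)) := fun n => SP_S fun m => hv m n
  have hrel : ∀ i, rel P₀ P i = fun x => bb i (val v x 0) := fun i => by
    funext x
    rw [rel, hP, toPair, conn_mkPair]
    simp [val]
  have hφ : ∀ x, P.φ x = ∑ j : Fin 2, s j x * S (v j.succ) x := fun x => by
    rw [Fin.sum_univ_two]; rfl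
  have hdd : ∀ x i n, dval v x i n = dd i (S (v n)) x := fun x i n =>
    (congrFun (dd_S (hv 1 n) i) x).symm
  unfold Frame.G relEnergy
  refine mul_le_mul_of_nonneg_left (integral_mono (integrable_sq (continuous_relDens _ _ _ _))
    (integrable_sq ((mkFrame P₀ hs h1).continuous_dens _ _ (fun n => (hv 0).continuous_val n)
      fun i n => (hv 1).continuous_dval i n)) fun x => ?_) (by norm_num)
  have hdiv : ‖dval v x 0 0 - I * dval v x 1 0‖ ^ 2 = relCurl P₀ P x ^ 2 + relDiv P₀ P x ^ 2 := by
    have e0 : ∀ i, dd i (rel P₀ P 0) x = (dd i (S (v 0)) x).re := fun i => by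
      rw [hrel]; exact dd_re (hSP 0).smooth i x
    have e1 : ∀ i, dd i (rel P₀ P 1) x = (dd i (S (v 0)) x).im := fun i => by
      rw [hrel]; exact dd_im (hSP 0).smooth i x
    rw [hdd, hdd, norm_sq_eq, relCurl, relDiv, e0, e0, e1, e1]
    simp
    ring
  have hcov : ∀ i, ‖cov P i P.φ x‖ ^ 2 ≤
      ∑ j, ‖(mkFrame P₀ hs h1).nab x (val v x) (dval v x) i j‖ ^ 2 := fun i => by
    have h2 := sum_s_nab P₀ hs h1 (u := fun j => S (v j.succ)) (fun j => (hSP j.succ).smooth)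
      (W := val v x) (DW := dval v x) (x := x) (i := i) (fun j => rfl) (fun j => hdd x i j.succ)
    have h3 : cov P i P.φ x = (mkFrame P₀ hs h1).sec x (Fin.cons 0 fun j =>
        (mkFrame P₀ hs h1).nab x (val v x) (dval v x) i j) := by
      simp only [Frame.sec, Fin.cons_succ]
      refine Eq.trans ?_ h2.symm
      have h4 := congrFun (hrel i) x
      rw [rel] at h4
      rw [← funext hφ, ← hφ, cov, cov, show conn P i x = conn P₀ i x + bb i (val v x 0) by linarith]
      push_cast
      ring
    rw [h3]
    exact (Frame.norm_sec_sq_le _ _ _).trans (le_of_eq (by simp only [Fin.cons_succ]))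
  have hsec : (mkFrame P₀ hs h1).sec x (val v x) = P.φ x := (hφ x).symm
  have h4 : ‖P.φ x‖ ^ 2 ≤ ∑ j : Fin 2, ‖val v x j.succ‖ ^ 2 := by
    rw [← hsec]; exact Frame.norm_sec_sq_le _ _ _
  have h5 := pow_le_pow_left₀ (sq_nonneg _) h4 2
  have h6 := Finset.sum_le_sum fun i (_ : i ∈ Finset.univ) => hcov i
  simp only [relDens, Frame.dens, hdiv, hsec]
  have h7 := mul_le_mul_of_nonneg_left h5 (half_pos hβ).le
  linarith

/-- The energy with the gauge fixing term has a minimiser. -/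
lemma exists_relEnergy_min (hα : 0 < α) (hβ : 0 < β) :
    ∃ Q : FieldPair d, ∀ P : FieldPair d, relEnergy P₀ Q α β ≤ relEnergy P₀ P α β := by
  obtain ⟨s, hs, h1⟩ := exists_sections d
  obtain ⟨v, hv, hmin⟩ := (mkFrame P₀ hs h1).exists_min hα hβ
  refine ⟨toPair P₀ hs hv, fun P => (relEnergy_toPair_le P₀ α β hs h1 hβ hv).trans ?_⟩
  let m : Fin 2 → ℝ := fun i => ∫ x in unitSquare, rel P₀ P i x
  let r : Fin 2 → ℤ := fun i => -round (m i / (2 * Real.pi))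
  let n : ℤ × ℤ := (r 0, r 1)
  have hr : ∀ i, |m i + 2 * Real.pi * r i| ≤ Real.pi := fun i => by
    have h2 := abs_sub_round (m i / (2 * Real.pi))
    have h3 : m i + 2 * Real.pi * r i =
        2 * Real.pi * (m i / (2 * Real.pi) - round (m i / (2 * Real.pi))) := by
      have := Real.pi_ne_zero
      simp only [r]
      push_cast
      field_simp
      ring
    rw [h3, abs_mul, abs_of_pos Real.two_pi_pos]
    nlinarith [Real.pi_pos]
  have hm : ∀ i, ∫ x in unitSquare, rel P₀ (gauge P n) i x = m i + 2 * Real.pi * r i := fun i => by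
    rw [rel_gauge, integral_add (integrable_sq (SP_rel P₀ P i).continuous)
      (integrable_sq continuous_const)]
    have : fr i n = r i := by fin_cases i <;> rfl
    simp [this, Measure.real, m]
  have h0 : ofPair P₀ (gauge P n) s 0 0 = ((m 0 + 2 * Real.pi * r 0 : ℝ) : ℂ) +
      I * ((m 1 + 2 * Real.pi * r 1 : ℝ) : ℂ) := by
    have i0 := integrable_sq (SP_rel P₀ (gauge P n) 0).ofReal.continuous
    have i1 := integrable_sq (SP_rel P₀ (gauge P n) 1).ofReal.continuous
    rw [← hm, ← hm, ofPair, Fin.cons_zero]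
    simp only [coef, neg_zero, e_zero, mul_one]
    rw [integral_add i0 (i1.const_mul I), integral_const_mul]
    congr 1
    · exact integral_ofReal (𝕜 := ℂ)
    · exact congrArg (I * ·) (integral_ofReal (𝕜 := ℂ))
  have h2 := hmin (ofPair P₀ (gauge P n) s) (Reg_ofPair P₀ _ hs) (by rw [h0]; simpa using hr 0)
    (by rw [h0]; simpa using hr 1)
  rwa [G_ofPair, relEnergy_gauge] at h2

end RelativeEnergy

section Variation

variable {d : ℤ} (P₀ P : FieldPair d) (α β : ℝ) {c : Fin 2 → ℝ × ℝ → ℝ} {η : ℝ × ℝ → ℂ}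

/-- The first variation of the energy density, divided by two. -/
def relVar (c : Fin 2 → ℝ × ℝ → ℝ) (η : ℝ × ℝ → ℂ) (x : ℝ × ℝ) : ℝ :=
  relCurl P₀ P x * (dd 0 (c 1) x - dd 1 (c 0) x) + relDiv P₀ P x * (dd 0 (c 0) x + dd 1 (c 1) x)
    + ∑ i, ((starRingEnd ℂ) (cov P i P.φ x) * (cov P i η x + I * (c i x : ℂ) * P.φ x)).re
    + (β * ‖P.φ x‖ ^ 2 - α) * ((starRingEnd ℂ) (P.φ x) * η x).re

lemma norm_add_mul_sq (z w : ℂ) (t : ℝ) :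
    ‖z + t * w‖ ^ 2 = ‖z‖ ^ 2 + t * (2 * ((starRingEnd ℂ) z * w).re) + t ^ 2 * ‖w‖ ^ 2 := by
  simp only [norm_sq_eq]
  simp
  ring

lemma relVar_nonneg (hmin : ∀ P' : FieldPair d, relEnergy P₀ P α β ≤ relEnergy P₀ P' α β)
    (hc : ∀ i, SP (c i)) (hη : QP d η) : 0 ≤ ∫ x in unitSquare, relVar P₀ P α β c η x := by
  let V : ℝ → FieldPair d := fun t => mkPair P (fun i x => conn P i x + t * c i x)
    (fun i => by simpa using (SP_const t).mul (hc i)) _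
    ((QP_section P).add (hη.mul_SP (SP_const (t : ℂ))))
  have hrel : ∀ t i, rel P₀ (V t) i = fun x => rel P₀ P i x + t * c i x := fun t i => by
    funext x
    simp only [rel, V, conn_mkPair]
    ring
  have hdd : ∀ t i j x, dd j (rel P₀ (V t) i) x = dd j (rel P₀ P i) x + t * dd j (c i) x := by
    intro t i j x
    rw [hrel, dd_add (SP_rel P₀ P i).smooth (contDiff_const.mul (hc i).smooth),
      dd_mul contDiff_const (hc i).smooth, dd_const]
    ring
  have hφ : ∀ t x, (V t).φ x = P.φ x + t * η x := fun t x => by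
    rw [mul_comm]; rfl
  have hcov : ∀ t i x, cov (V t) i (V t).φ x = cov P i P.φ x +
      t * (cov P i η x + I * (c i x : ℂ) * P.φ x) + t ^ 2 * (I * (c i x : ℂ) * η x) := by
    intro t i x
    rw [funext (hφ t), cov, dd_add P.smooth_φ (contDiff_const.mul hη.smooth),
      dd_mul contDiff_const hη.smooth, dd_const, cov, cov]
    simp only [V, conn_mkPair]
    push_cast
    ring
  have c1 := (SP_relCurl P₀ P).continuous
  have c2 := (SP_relDiv P₀ P).continuous
  have c3 := fun i => ((QP_section P).cov P i).smooth.continuous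
  have c4 := P.smooth_φ.continuous
  have c5 := fun i => (hη.cov P i).smooth.continuous
  have c6 := fun i => (hc i).ofReal.continuous
  have c7 := fun i j => ((hc i).dd j).continuous
  have c8 := hη.smooth.continuous
  have c9 := ((QP_section P).conj_mul hη).re.continuous
  have c10 : Continuous fun x => ‖P.φ x‖ ^ 2 := by fun_prop
  have q1 := Q_quad_sq c1 ((c7 1 0).sub (c7 0 1)) (c := fun _ => 0) (by fun_prop)
  have q2 := Q_quad_sq c2 ((c7 0 0).add (c7 1 1)) (c := fun _ => 0) (by fun_prop)
  have q3 := fun i => Q_norm_sq (c3 i) ((c5 i).add (((continuous_const (y := I)).mul (c6 i)).mul c4))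
    (((continuous_const (y := I)).mul (c6 i)).mul c8)
  have q4 := Q_norm_sq c4 c8 (c := fun _ => 0) (by fun_prop)
  have q5 := Q_quad_sq c10 ((continuous_const (y := (2 : ℝ))).mul c9) (c8.norm.pow 2)
  have q := (((q1.add q2).add (Q.sum Finset.univ q3)).sub (q4.const_mul α)).add
    (q5.const_mul (β / 2))
  have hQ : Q (fun t x => relDens P₀ (V t) α β x) (fun x => 2 * relVar P₀ P α β c η x) := by
    convert q using 1
    · funext t x
      rw [relDens, relCurl, relDiv, hdd, hdd, hdd, hdd, hφ, norm_add_mul_sq]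
      simp only [hcov, relCurl, relDiv, mul_zero, add_zero]
      rw [norm_add_mul_sq]
      simp only [Pi.add_apply, Pi.mul_apply, Pi.sub_apply, Pi.pow_apply]
      ring
    · funext x
      simp only [relVar, Fin.sum_univ_two, Pi.add_apply, Pi.mul_apply, Pi.sub_apply]
      ring
  have hV : ∀ x, relDens P₀ (V 0) α β x = relDens P₀ P α β x := fun x => by
    rw [relDens, relDens, relCurl, relDiv, hdd, hdd, hdd, hdd, hφ]
    simp only [hcov, relCurl, relDiv]
    simp
  have h0 := hQ.nonneg fun t _ => by
    have := hmin (V t)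
    unfold relEnergy at this
    simp only [hV]
    linarith
  rw [integral_const_mul] at h0
  linarith

end Variation

section EulerLagrange

variable {d : ℤ} {P₀ P : FieldPair d} {α β : ℝ}

lemma dd_re_conj_mul (P : FieldPair d) {f g : ℝ × ℝ → ℂ} (hf : ContDiff ℝ (⊤ : ℕ∞) f)
    (hg : ContDiff ℝ (⊤ : ℕ∞) g) (i : Fin 2) (x : ℝ × ℝ) :
    dd i (fun y => ((starRingEnd ℂ) (f y) * g y).re) x =
      ((starRingEnd ℂ) (cov P i f x) * g x).re + ((starRingEnd ℂ) (f x) * cov P i g x).re := by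
  have hc : ContDiff ℝ (⊤ : ℕ∞) fun y => (starRingEnd ℂ) (f y) := Complex.conjCLE.contDiff.comp hf
  rw [dd_re (hc.mul hg), dd_mul hc hg, dd_conj hf, cov, cov, ← Complex.add_re]
  congr 1
  simp only [map_add, map_mul, Complex.conj_ofReal, Complex.conj_I]
  ring

/-- The divergence of the relative connection of a minimiser is constant. -/
lemma dd_relDiv_eq_zero (hmin : ∀ P' : FieldPair d, relEnergy P₀ P α β ≤ relEnergy P₀ P' α β)
    (i : Fin 2) (x : ℝ × ℝ) : dd i (relDiv P₀ P) x = 0 := by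
  set δ := relDiv P₀ P with hδ
  have hS : SP δ := SP_relDiv P₀ P
  have hη : QP d fun x => P.φ x * (-I * (δ x : ℂ)) :=
    (QP_section P).mul_SP ((SP_const (-I)).mul hS.ofReal)
  have h := relVar_nonneg P₀ P α β (c := fun i => dd i δ) hmin (fun i => hS.dd i) hη
  have hF := fun j => hS.mul (hS.dd j)
  have key : ∀ y, relVar P₀ P α β (fun i => dd i δ) (fun x => P.φ x * (-I * (δ x : ℂ))) y =
      (dd 0 (fun z => δ z * dd 0 δ z) y + dd 1 (fun z => δ z * dd 1 δ z) y)
        - (dd 0 δ y ^ 2 + dd 1 δ y ^ 2) := fun y => by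
    have hm := (SP_const (-I)).mul hS.ofReal
    have h1 : ∀ j, cov P j (fun x => P.φ x * (-I * (δ x : ℂ))) y + I * ((dd j δ y : ℝ) : ℂ) * P.φ y =
        -I * (δ y : ℂ) * cov P j P.φ y := fun j => by
      rw [cov, dd_mul P.smooth_φ hm.smooth, dd_mul contDiff_const hS.ofReal.smooth, dd_const,
        dd_ofReal hS.smooth, cov]
      ring
    have h2 : ∀ z : ℂ, ((starRingEnd ℂ) z * (-I * (δ y : ℂ) * z)).re = 0 := fun z => by
      simp; ring
    have h3 : ((starRingEnd ℂ) (P.φ y) * (P.φ y * (-I * (δ y : ℂ)))).re = 0 := by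
      simp; ring
    simp only [relVar, h1, h2, h3]
    rw [dd_comm hS.smooth, dd_mul hS.smooth (hS.dd 0).smooth, dd_mul hS.smooth (hS.dd 1).smooth,
      ← hδ]
    simp
    ring
  have hG : SP fun y => dd 0 δ y ^ 2 + dd 1 δ y ^ 2 := by
    simpa only [sq] using ((hS.dd 0).mul (hS.dd 0)).add ((hS.dd 1).mul (hS.dd 1))
  have i1 := fun j => integrable_sq ((hF j).dd j).continuous
  have i2 : Integrable (fun y => dd 0 (fun z => δ z * dd 0 δ z) y + dd 1 (fun z => δ z * dd 1 δ z) y)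
    (volume.restrict unitSquare) := (i1 0).add (i1 1)
  simp only [key] at h
  rw [integral_sub i2 (integrable_sq hG.continuous), integral_add (i1 0) (i1 1), (hF 0).integral_dd, (hF 1).integral_dd] at h
  have h4 := hG.eq_zero (integral_sq_nonneg_eq_zero hG.continuous (fun y => by positivity)
    (by linarith)) x
  have h5 := (add_eq_zero_iff_of_nonneg (sq_nonneg _) (sq_nonneg _)).1 h4
  fin_cases i
  exacts [pow_eq_zero_iff two_ne_zero |>.1 h5.1, pow_eq_zero_iff two_ne_zero |>.1 h5.2]

/-- Minimisers solve the Ginzburg–Landau equations. -/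
lemma isGLSolution_of_min {F₀ : ℝ × ℝ → ℝ} (hF : ∀ x, curv P₀.a1 P₀.a2 x = F₀ x)
    (hmin : ∀ P' : FieldPair d, relEnergy P₀ P α β ≤ relEnergy P₀ P' α β) :
    IsGLSolution α β F₀ P := by
  have hκ : relCurl P₀ P = fun x => curv P.a1 P.a2 x - F₀ x := funext fun x => by
    rw [relCurl_eq, hF]
  set κ := relCurl P₀ P with hκ'
  set δ := relDiv P₀ P with hδ'
  have hS : SP κ := SP_relCurl P₀ P
  have hT : SP δ := SP_relDiv P₀ P
  have hφ := QP_section P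
  have hD := fun i => hφ.cov P i
  let X : Fin 2 → ℝ × ℝ → ℝ := fun i x => (if i = 0 then dd 1 κ x else -dd 0 κ x) +
    ((starRingEnd ℂ) (P.φ x) * cov P i P.φ x).im
  let η : ℝ × ℝ → ℂ := fun x => cov P 0 (cov P 0 P.φ) x + cov P 1 (cov P 1 P.φ) x
    + P.φ x * ((α - β * ‖P.φ x‖ ^ 2 : ℝ) : ℂ)
  have hX : ∀ i, SP (X i) := fun i => by
    refine SP.add ?_ (hφ.conj_mul (hD i)).im
    fin_cases i
    exacts [hS.dd 1, (hS.dd 0).neg]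
  have hη : QP d η := (((hD 0).cov P 0).add ((hD 1).cov P 1)).add
    (hφ.mul_SP ((SP_const α).sub ((SP_const β).mul hφ.norm_sq)).ofReal)
  have h := relVar_nonneg P₀ P α β (c := fun i x => -X i x) hmin (fun i => (hX i).neg) hη
  have hf := fun i => (((hD i).conj_mul hη)).re
  have hF0 : SP fun x => κ x * -X 1 x + δ x * -X 0 x + ((starRingEnd ℂ) (cov P 0 P.φ x) * η x).re :=
    ((hS.mul (hX 1).neg).add (hT.mul (hX 0).neg)).add (hf 0)
  have hF1 : SP fun x => κ x * X 0 x + δ x * -X 1 x + ((starRingEnd ℂ) (cov P 1 P.φ x) * η x).re :=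
    ((hS.mul (hX 0)).add (hT.mul (hX 1).neg)).add (hf 1)
  have key : ∀ y, relVar P₀ P α β (fun i x => -X i x) η y =
      (dd 0 (fun x => κ x * -X 1 x + δ x * -X 0 x + ((starRingEnd ℂ) (cov P 0 P.φ x) * η x).re) y +
      dd 1 (fun x => κ x * X 0 x + δ x * -X 1 x + ((starRingEnd ℂ) (cov P 1 P.φ x) * η x).re) y)
      - (X 0 y ^ 2 + X 1 y ^ 2 + ‖η y‖ ^ 2) := fun y => by
    have hneg : ∀ i j, dd i (fun x => -X j x) y = -dd i (X j) y := fun i j => by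
      have := dd_sub (SP_const (0 : ℝ)).smooth (hX j).smooth i y
      simpa [dd_const] using this
    have hδ0 := fun i => dd_relDiv_eq_zero hmin i y
    have n0 := (hX 0).neg.smooth
    have n1 := (hX 1).neg.smooth
    rw [dd_add ((hS.mul (hX 1).neg).add (hT.mul (hX 0).neg)).smooth (hf 0).smooth,
      dd_add (hS.mul (hX 1).neg).smooth (hT.mul (hX 0).neg).smooth,
      dd_add ((hS.mul (hX 0)).add (hT.mul (hX 1).neg)).smooth (hf 1).smooth,
      dd_add (hS.mul (hX 0)).smooth (hT.mul (hX 1).neg).smooth,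
      dd_mul hS.smooth n1, dd_mul hT.smooth n0, dd_mul hS.smooth (hX 0).smooth, dd_mul hT.smooth n1,
      dd_re_conj_mul P (hD 0).smooth hη.smooth, dd_re_conj_mul P (hD 1).smooth hη.smooth,
      hδ0, hδ0, relVar]
    simp only [hneg, Fin.sum_univ_two, ← hκ', ← hδ']
    have hX0 : X 0 y = dd 1 κ y + ((starRingEnd ℂ) (P.φ y) * cov P 0 P.φ y).im := rfl
    have hX1 : X 1 y = -dd 0 κ y + ((starRingEnd ℂ) (P.φ y) * cov P 1 P.φ y).im := rfl
    have hη0 : ‖η y‖ ^ 2 = ((starRingEnd ℂ) (cov P 0 (cov P 0 P.φ) y) * η y).re +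
        ((starRingEnd ℂ) (cov P 1 (cov P 1 P.φ) y) * η y).re +
        (α - β * ‖P.φ y‖ ^ 2) * ((starRingEnd ℂ) (P.φ y) * η y).re := by
      have h1 : ‖η y‖ ^ 2 = ((starRingEnd ℂ) (η y) * η y).re := by
        rw [Complex.conj_mul', ← Complex.ofReal_pow, Complex.ofReal_re]
      have h2 : (starRingEnd ℂ) (η y) = (starRingEnd ℂ) (cov P 0 (cov P 0 P.φ) y) +
          (starRingEnd ℂ) (cov P 1 (cov P 1 P.φ) y) +
          (starRingEnd ℂ) (P.φ y) * ((α - β * ‖P.φ y‖ ^ 2 : ℝ) : ℂ) := by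
        simp only [η, map_add, map_mul, Complex.conj_ofReal]
      rw [h1, h2, add_mul, add_mul, Complex.add_re, Complex.add_re, mul_right_comm,
        Complex.re_mul_ofReal]
      ring
    have hre : ∀ (z w : ℂ) (r : ℝ), ((starRingEnd ℂ) z * (w + I * ((-r : ℝ) : ℂ) * P.φ y)).re =
        ((starRingEnd ℂ) z * w).re - r * ((starRingEnd ℂ) (P.φ y) * z).im := fun z w r => by
      simp
      ring
    rw [hre, hre, hη0]
    linear_combination X 0 y * hX0 + X 1 y * hX1
  have hG : SP fun y => X 0 y ^ 2 + X 1 y ^ 2 + ‖η y‖ ^ 2 := by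
    have := (((hX 0).mul (hX 0)).add ((hX 1).mul (hX 1))).add hη.norm_sq
    simpa only [← sq] using this
  have i0 := integrable_sq (hF0.dd 0).continuous
  have i1 := integrable_sq (hF1.dd 1).continuous
  have i2 : Integrable (fun y =>
      dd 0 (fun x => κ x * -X 1 x + δ x * -X 0 x + ((starRingEnd ℂ) (cov P 0 P.φ x) * η x).re) y +
      dd 1 (fun x => κ x * X 0 x + δ x * -X 1 x + ((starRingEnd ℂ) (cov P 1 P.φ x) * η x).re) y)
    (volume.restrict unitSquare) := i0.add i1
  simp only [key] at h
  rw [integral_sub i2 (integrable_sq hG.continuous),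
    integral_add i0 i1, hF0.integral_dd, hF1.integral_dd] at h
  have h4 : ∀ x, X 0 x ^ 2 + X 1 x ^ 2 + ‖η x‖ ^ 2 = 0 := hG.eq_zero
    (integral_sq_nonneg_eq_zero hG.continuous (fun y => by positivity) (by linarith))
  have h0 : ∀ x, X 0 x = 0 := fun x => pow_eq_zero_iff two_ne_zero |>.1 (by
    nlinarith [sq_nonneg (X 0 x), sq_nonneg (X 1 x), sq_nonneg ‖η x‖, h4 x])
  have h1 : ∀ x, X 1 x = 0 := fun x => pow_eq_zero_iff two_ne_zero |>.1 (by
    nlinarith [sq_nonneg (X 0 x), sq_nonneg (X 1 x), sq_nonneg ‖η x‖, h4 x])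
  have h2 : ∀ x, η x = 0 := fun x => norm_eq_zero.1 (pow_eq_zero_iff two_ne_zero |>.1 (by
    nlinarith [sq_nonneg (X 0 x), sq_nonneg (X 1 x), sq_nonneg ‖η x‖, h4 x]))
  refine ⟨fun x => ?_, fun x => ?_, fun x => ?_⟩
  · rw [← hκ]
    exact h0 x
  · rw [← hκ]
    exact h1 x
  · have h3 := h2 x
    simp only [η] at h3
    rw [← cov_zero, ← cov_one, ← cov_zero, ← cov_one]
    push_cast at h3
    linear_combination -h3

end EulerLagrange

section Comparison

variable {d : ℤ} {P₀ : FieldPair d} {α β : ℝ} {F₀ : ℝ × ℝ → ℝ}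

lemma energy_eq (hF : ∀ x, curv P₀.a1 P₀.a2 x = F₀ x) (P : FieldPair d) :
    energy α β F₀ P = (1 / 2) * ∫ x in unitSquare, (relDens P₀ P α β x - relDiv P₀ P x ^ 2) := by
  unfold energy
  congr 2
  funext x
  rw [relDens, relCurl_eq, hF, Fin.sum_univ_two, cov_zero, cov_one]
  ring

lemma relDens_sub_ge (hβ : 0 < β) (P : FieldPair d) (x : ℝ × ℝ) :
    -(α ^ 2 / (2 * β)) ≤ relDens P₀ P α β x - relDiv P₀ P x ^ 2 := by
  have h1 : 0 ≤ (β * ‖P.φ x‖ ^ 2 - α) ^ 2 / (2 * β) := by positivity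
  have h2 : (β * ‖P.φ x‖ ^ 2 - α) ^ 2 / (2 * β) =
      β / 2 * (‖P.φ x‖ ^ 2) ^ 2 - α * ‖P.φ x‖ ^ 2 + α ^ 2 / (2 * β) := by
    field_simp
    ring
  have h3 : 0 ≤ ∑ i, ‖cov P i P.φ x‖ ^ 2 := Finset.sum_nonneg fun i _ => sq_nonneg _
  unfold relDens
  nlinarith [sq_nonneg (relCurl P₀ P x)]

lemma bddBelow_energySet (hF : ∀ x, curv P₀.a1 P₀.a2 x = F₀ x) (hβ : 0 < β) :
    BddBelow (energySet α β F₀ d) := by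
  refine ⟨1 / 2 * -(α ^ 2 / (2 * β)), ?_⟩
  rintro _ ⟨P, rfl⟩
  rw [energy_eq hF]
  refine mul_le_mul_of_nonneg_left ?_ (by norm_num)
  have h1 := integral_mono (integrable_sq continuous_const) (integrable_sq
    ((continuous_relDens P₀ P α β).sub ((SP_relDiv P₀ P).continuous.pow 2)))
    (relDens_sub_ge (P₀ := P₀) hβ P)
  simpa [Measure.real] using h1

lemma relDens_sub_nonneg {P : FieldPair d} (hP : ∀ x, P.φ x = 0) (x : ℝ × ℝ) :
    0 ≤ relDens P₀ P α β x - relDiv P₀ P x ^ 2 := by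
  have h3 : 0 ≤ ∑ i, ‖cov P i P.φ x‖ ^ 2 := Finset.sum_nonneg fun i _ => sq_nonneg _
  simp only [relDens, hP, norm_zero]
  nlinarith [sq_nonneg (relCurl P₀ P x)]

lemma energy_nonneg_of_reducible (hF : ∀ x, curv P₀.a1 P₀.a2 x = F₀ x) {P : FieldPair d}
    (hP : ∀ x, P.φ x = 0) : 0 ≤ energy α β F₀ P := by
  rw [energy_eq hF]
  exact mul_nonneg (by norm_num) (integral_nonneg (relDens_sub_nonneg hP))

lemma relEnergy_nonneg_of_reducible {P : FieldPair d} (hP : ∀ x, P.φ x = 0) :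
    0 ≤ relEnergy P₀ P α β :=
  mul_nonneg (by norm_num) (integral_nonneg fun x =>
    (relDens_sub_nonneg hP x).trans (sub_le_self _ (sq_nonneg _)))

/-- Above the first eigenvalue there is a field pair of negative energy. -/
lemma exists_energy_neg (hβ : 0 < β) (hF : ∀ x, curv P₀.a1 P₀.a2 x = F₀ x)
    (h1 : ∫ x in unitSquare, ‖P₀.φ x‖ ^ 2 = 1)
    (hlt : ∫ x in unitSquare, (‖D1 P₀.a1 P₀.φ x‖ ^ 2 + ‖D2 P₀.a2 P₀.φ x‖ ^ 2) < α) :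
    ∃ P : FieldPair d, relEnergy P₀ P α β < 0 ∧ energy α β F₀ P < 0 := by
  set r := ∫ x in unitSquare, (‖D1 P₀.a1 P₀.φ x‖ ^ 2 + ‖D2 P₀.a2 P₀.φ x‖ ^ 2) with hr
  set q := ∫ x in unitSquare, (‖P₀.φ x‖ ^ 2) ^ 2 with hq
  have hq0 : 0 ≤ q := integral_nonneg fun x => sq_nonneg _
  have hden : 0 < β * q + 1 := by positivity
  set t := Real.sqrt ((α - r) / (β * q + 1)) with ht
  have ht2 : t ^ 2 = (α - r) / (β * q + 1) := Real.sq_sqrt (div_nonneg (by linarith) hden.le)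
  have hφ := QP_section P₀
  let P : FieldPair d := mkPair P₀ (conn P₀) (fun i => by simpa using SP_const (0 : ℝ)) _
    (hφ.mul_SP (SP_const (t : ℂ)))
  have hrel : ∀ i, rel P₀ P i = fun _ => 0 := fun i => funext fun x => by
    simp only [rel, P, conn_mkPair, sub_self]
  have hdiv : ∀ x, relDiv P₀ P x = 0 := fun x => by
    rw [relDiv, hrel, hrel, dd_const, dd_const, add_zero]
  have hcurl : ∀ x, relCurl P₀ P x = 0 := fun x => by
    rw [relCurl, hrel, hrel, dd_const, dd_const, sub_zero]
  have hPφ : ∀ x, P.φ x = P₀.φ x * t := fun x => rfl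
  have hcov : ∀ i x, cov P i P.φ x = cov P₀ i P₀.φ x * t := fun i x => by
    rw [funext hPφ, cov, cov, dd_mul P₀.smooth_φ contDiff_const, dd_const]
    simp only [P, conn_mkPair]
    ring
  have hd : ∀ x, relDens P₀ P α β x = t ^ 2 * (‖D1 P₀.a1 P₀.φ x‖ ^ 2 + ‖D2 P₀.a2 P₀.φ x‖ ^ 2)
      - α * t ^ 2 * ‖P₀.φ x‖ ^ 2 + β / 2 * t ^ 4 * (‖P₀.φ x‖ ^ 2) ^ 2 := fun x => by
    rw [relDens, hdiv, hcurl, Fin.sum_univ_two, hcov, hcov, hPφ, cov_zero, cov_one]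
    simp only [norm_mul, Complex.norm_real, Real.norm_eq_abs, mul_pow, sq_abs]
    ring
  have hneg : relEnergy P₀ P α β < 0 := by
    have j1 : Integrable (fun x => ‖D1 P₀.a1 P₀.φ x‖ ^ 2 + ‖D2 P₀.a2 P₀.φ x‖ ^ 2)
        (volume.restrict unitSquare) := by
      simpa only [cov_zero, cov_one] using integrable_sq ((hφ.cov P₀ 0).norm_sq.add (hφ.cov P₀ 1).norm_sq).continuous
    have j2 := integrable_sq hφ.norm_sq.continuous
    have j3 : Integrable (fun x => (‖P₀.φ x‖ ^ 2) ^ 2) (volume.restrict unitSquare) :=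
      integrable_sq (hφ.norm_sq.continuous.pow 2)
    have j4 : Integrable (fun x => t ^ 2 * (‖D1 P₀.a1 P₀.φ x‖ ^ 2 + ‖D2 P₀.a2 P₀.φ x‖ ^ 2)
        - α * t ^ 2 * ‖P₀.φ x‖ ^ 2) (volume.restrict unitSquare) :=
      (j1.const_mul (t ^ 2)).sub (j2.const_mul (α * t ^ 2))
    have h2 : ∫ x in unitSquare, relDens P₀ P α β x =
        t ^ 2 * r - α * t ^ 2 * 1 + β / 2 * t ^ 4 * q := by
      simp only [hd]
      rw [integral_add j4 (j3.const_mul (β / 2 * t ^ 4)), integral_sub (j1.const_mul (t ^ 2))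
        (j2.const_mul (α * t ^ 2)), integral_const_mul, integral_const_mul, integral_const_mul, h1]
    have h3 : 0 < t ^ 2 := by rw [ht2]; exact div_pos (by linarith) hden
    have h4 : t ^ 2 * (β * q + 1) = α - r := by rw [ht2]; field_simp
    have h5 : t ^ 2 * r - α * t ^ 2 * 1 + β / 2 * t ^ 4 * q =
        -(t ^ 2 * t ^ 2 * (β * q / 2 + 1)) := by
      linear_combination t ^ 2 * h4
    unfold relEnergy
    rw [h2, h5]
    have h6 : 0 < β * q / 2 + 1 := by positivity
    nlinarith [mul_pos (mul_pos h3 h3) h6]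
  refine ⟨P, hneg, ?_⟩
  rw [energy_eq hF]
  simp only [hdiv, ne_eq, OfNat.ofNat_ne_zero, not_false_eq_true, zero_pow, sub_zero]
  exact hneg

end Comparison

end GinzburgLandau

/-- if `α > λ₁` then an irreducible degree-`d` GL solution exists, and
every energy-minimizing degree-`d` field pair is irreducible. -/
theorem statement0 (α β : ℝ) (hα : 0 < α) (hβ : 0 < β) (d : ℤ) (F₀ : ℝ × ℝ → ℝ)
    (hF₀ : ExternalField d F₀) (h : α > lambda1 d F₀) :
    (∃ P : FieldPair d, IsGLSolution α β F₀ P ∧ ∃ x : ℝ × ℝ, P.φ x ≠ 0) ∧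
    (∀ P : FieldPair d, energy α β F₀ P = sInf (energySet α β F₀ d) →
      ∃ x : ℝ × ℝ, P.φ x ≠ 0) := by
  have hne : { t : ℝ | ∃ P : FieldPair d, (∀ x : ℝ × ℝ, curv P.a1 P.a2 x = F₀ x) ∧
      (∫ x in unitSquare, ‖P.φ x‖ ^ 2) = 1 ∧
      t = ∫ x in unitSquare, (‖D1 P.a1 P.φ x‖ ^ 2 + ‖D2 P.a2 P.φ x‖ ^ 2) }.Nonempty := by
    obtain ⟨P, hP, h1⟩ := GinzburgLandau.exists_normalized hF₀
    exact ⟨_, P, hP, h1, rfl⟩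
  obtain ⟨_, ⟨P₀, hF, h1, rfl⟩, hlt⟩ := exists_lt_of_csInf_lt hne h
  obtain ⟨P₁, hrel, hen⟩ := GinzburgLandau.exists_energy_neg hβ hF h1 hlt
  refine ⟨?_, fun P hP => ?_⟩
  · obtain ⟨Q, hQ⟩ := GinzburgLandau.exists_relEnergy_min P₀ α β hα hβ
    refine ⟨Q, GinzburgLandau.isGLSolution_of_min hF hQ, ?_⟩
    by_contra! hred
    exact ((GinzburgLandau.relEnergy_nonneg_of_reducible hred).trans (hQ P₁)).not_gt hrel
  · by_contra! hred
    have h0 := GinzburgLandau.energy_nonneg_of_reducible (α := α) (β := β) hF hred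
    rw [hP] at h0
    exact (h0.trans (csInf_le (GinzburgLandau.bddBelow_energySet hF hβ) ⟨P₁, rfl⟩)).not_gt hen
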